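/- The group of self-homeomorphisms of the open annulus S¹ × ℝ is strongly distorted: there exist m ∈ ℕ and a sequence (w_n)_{n∈ℕ} of natural numbers such that for every sequence (g_n)_{n∈ℕ} of homeomorphisms of S¹ × ℝ there exists a subset S of Homeo(S¹ × ℝ) of cardinality m with g_n ∈ S^{w_n} for every n. -/

import Mathlib

open Pointwise

instance instGroupHomeomorph (X : Type*) [TopologicalSpace X] : Group (X ≃ₜ X) where
  mul f g := g.trans f
  one := Homeomorph.refl X
  inv := Homeomorph.symm
  mul_assoc _ _ _ := Homeomorph.ext fun _ => rfl
  one_mul _ := Homeomorph.ext fun _ => rfl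
  mul_one _ := Homeomorph.ext fun _ => rfl
  inv_mul_cancel f := Homeomorph.ext fun x => f.symm_apply_apply x

/-- A group `G` is *strongly distorted* if there exist `m : ℕ` and a sequence
`w : ℕ → ℕ` such that for every sequence `g : ℕ → G` there is a subset `S` of `G`
of cardinality `m` with `g n ∈ S ^ (w n)` for every `n`. -/
def StronglyDistorted (G : Type*) [Group G] : Prop :=
  ∃ (m : ℕ) (w : ℕ → ℕ), ∀ g : ℕ → G, ∃ S : Set G,
    S.Finite ∧ S.ncard = m ∧ ∀ n, g n ∈ S ^ w n

namespace Annulus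

open Set Metric Filter Topology

/-- Pointwise limits of uniformly bounded holomorphic functions are locally uniform limits. -/
theorem tendstoLocallyUniformlyOn_of_bounded {ι : Type*} {F : ι → ℂ → ℂ} {f : ℂ → ℂ}
    {U : Set ℂ} (hU : IsOpen U) {φ : Filter ι} [φ.NeBot]
    (hd : ∀ i, DifferentiableOn ℂ (F i) U) (hb : ∀ i, MapsTo (F i) U (ball 0 1))
    (hlim : ∀ z ∈ U, Tendsto (fun i => F i z) φ (𝓝 (f z))) :
    TendstoLocallyUniformlyOn F f φ U := by
  rw [Metric.tendstoLocallyUniformlyOn_iff]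
  intro ε hε z hz
  obtain ⟨r, hr, hrU⟩ := Metric.isOpen_iff.1 hU z hz
  have hlip : ∀ i, ∀ y ∈ ball z r, dist (F i y) (F i z) ≤ 2 / r * dist y z := by
    intro i y hy
    refine Complex.dist_le_div_mul_dist_of_mapsTo_ball ((hd i).mono hrU) ?_ hy
    intro w hw
    have h1 := hb i (hrU hw)
    have h2 := hb i hz
    simp only [mem_closedBall, mem_ball, dist_zero_right] at *
    rw [dist_eq_norm]
    linarith [norm_sub_le (F i w) (F i z)]
  have hlipf : ∀ y ∈ ball z r, dist (f y) (f z) ≤ 2 / r * dist y z := fun y hy =>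
    le_of_tendsto ((hlim y (hrU hy)).dist (hlim z hz)) (.of_forall fun i => hlip i y hy)
  have hδ : 0 < min r (r * ε / 6) := by positivity
  refine ⟨ball z (min r (r * ε / 6)), mem_nhdsWithin_of_mem_nhds (ball_mem_nhds z hδ), ?_⟩
  filter_upwards [(Metric.tendsto_nhds.1 (hlim z hz)) (ε / 3) (by positivity)] with i hi y hy
  have hyr : y ∈ ball z r := ball_subset_ball (min_le_left _ _) hy
  have hy' : dist y z < r * ε / 6 := lt_of_lt_of_le hy (min_le_right _ _)
  have h3 : 2 / r * dist y z < ε / 3 := by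
    calc 2 / r * dist y z < 2 / r * (r * ε / 6) := by gcongr
      _ = ε / 3 := by field_simp; norm_num
  have h1 := hlip i y hyr
  have h2 := hlipf y hyr
  have h4 := dist_triangle4 (f y) (f z) (F i z) (F i y)
  rw [dist_comm (f z), dist_comm (F i z) (F i y)] at h4
  linarith

/-- **Hurwitz's theorem**: a nonconstant locally uniform limit of injective holomorphic functions
is injective. -/
theorem injOn_of_tendstoLocallyUniformlyOn {ι : Type*} {F : ι → ℂ → ℂ} {f : ℂ → ℂ}
    {U : Set ℂ} (hU : IsOpen U) (hUc : IsPreconnected U) {φ : Filter ι} [φ.NeBot]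
    (hd : ∀ i, DifferentiableOn ℂ (F i) U) (hinj : ∀ i, InjOn (F i) U)
    (hlim : TendstoLocallyUniformlyOn F f φ U) {c : ℂ} (hc : c ∈ U) (hf' : deriv f c ≠ 0) :
    InjOn f U := by
  have hfd : DifferentiableOn ℂ f U := hlim.differentiableOn (.of_forall hd) hU
  intro a ha b hb hab
  by_contra hne
  have han : AnalyticOnNhd ℂ (fun z => f z - f a) U :=
    (hfd.sub_const _).analyticOnNhd hU
  have hnz : ∀ᶠ z in 𝓝[≠] b, f z - f a ≠ 0 := by
    rcases (han b hb).eventually_eq_zero_or_eventually_ne_zero with h | h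
    · exfalso
      have := han.eqOn_zero_of_preconnected_of_eventuallyEq_zero hUc hb h
      have h2 : f =ᶠ[𝓝 c] fun _ => f a := by
        filter_upwards [hU.mem_nhds hc] with z hz
        simpa [sub_eq_zero] using this hz
      exact hf' (by rw [h2.deriv_eq]; simp)
    · exact h
  obtain ⟨r, hr, hrb⟩ : ∃ r > 0, ∀ z ∈ closedBall b r, z ∈ U ∧ z ≠ a ∧ (z ≠ b → f z - f a ≠ 0) := by
    have h1 : ∀ᶠ z in 𝓝 b, z ∈ U ∧ z ≠ a ∧ (z ≠ b → f z - f a ≠ 0) := by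
      filter_upwards [hU.mem_nhds hb, isOpen_ne.mem_nhds (Ne.symm hne),
        eventually_nhdsWithin_iff.1 hnz] with z h1 h2 h3 using ⟨h1, h2, h3⟩
    exact Metric.nhds_basis_closedBall.eventually_iff.1 h1
  have hsub : closedBall b r ⊆ U := fun z hz => (hrb z hz).1
  obtain ⟨z0, hz0, hmin⟩ := (isCompact_sphere b r).exists_isMinOn
    (f := fun z => ‖f z - f a‖) (NormedSpace.sphere_nonempty.2 hr.le)
    ((hfd.continuousOn.mono (sphere_subset_closedBall.trans hsub)).sub continuousOn_const).norm
  set δ := ‖f z0 - f a‖ with hδ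
  have hδ0 : 0 < δ := by
    refine norm_pos_iff.2 ((hrb z0 (sphere_subset_closedBall hz0)).2.2 ?_)
    rintro rfl
    simp at hz0; linarith
  have hK := (tendstoLocallyUniformlyOn_iff_forall_isCompact hU).1 hlim (insert a (closedBall b r))
    (insert_subset ha hsub) ((isCompact_closedBall b r).insert a)
  obtain ⟨i, hi⟩ := (Metric.tendstoUniformlyOn_iff.1 hK (δ / 4) (by positivity)).exists
  have hia := hi a (mem_insert _ _)
  have hib := hi b (mem_insert_of_mem _ (mem_closedBall_self hr.le))
  rw [dist_eq_norm] at hia hib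
  have hne0 : ∀ z ∈ closedBall b r, F i z - F i a ≠ 0 := fun z hz h =>
    (hrb z hz).2.1 (hinj i (hsub hz) ha (sub_eq_zero.1 h))
  have hdi : DifferentiableOn ℂ (fun z => (F i z - F i a)⁻¹) (closedBall b r) :=
    DifferentiableOn.fun_inv (((hd i).mono hsub).sub_const _) hne0
  have hcl : DiffContOnCl ℂ (fun z => (F i z - F i a)⁻¹) (ball b r) :=
    hdi.diffContOnCl_ball subset_rfl
  have hbd : ∀ z ∈ frontier (ball b r), ‖(F i z - F i a)⁻¹‖ ≤ (δ / 2)⁻¹ := by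
    intro z hz
    rw [frontier_ball b hr.ne'] at hz
    have h1 : δ ≤ ‖f z - f a‖ := hmin hz
    have h2 := hi z (mem_insert_of_mem _ (sphere_subset_closedBall hz))
    rw [dist_eq_norm] at h2
    rw [norm_inv]
    apply inv_anti₀ (by positivity)
    have : f z - f a = (f z - F i z) - (f a - F i a) + (F i z - F i a) := by ring
    have h3 : ‖f z - f a‖ ≤ ‖f z - F i z‖ + ‖f a - F i a‖ + ‖F i z - F i a‖ := by
      rw [this]
      exact (norm_add_le _ _).trans (by gcongr; exact norm_sub_le _ _)
    linarith
  have h5 := Complex.norm_le_of_forall_mem_frontier_norm_le isBounded_ball hcl hbd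
    (subset_closure (mem_ball_self hr))
  rw [norm_inv, inv_le_inv₀ (norm_pos_iff.2 (hne0 b (mem_closedBall_self hr.le)))
    (by positivity)] at h5
  have : F i b - F i a = (f a - F i a) - (f b - F i b) := by rw [hab]; ring
  have h6 : ‖F i b - F i a‖ ≤ ‖f a - F i a‖ + ‖f b - F i b‖ := by rw [this]; exact norm_sub_le _ _
  linarith

end Annulus

namespace Annulus

open Set Metric Filter Topology

open ComplexConjugate in
/-- The automorphism of the unit disc that takes `a` to `0`. -/
noncomputable def mobius (a z : ℂ) : ℂ := (z - a) / (1 - conj a * z)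

open ComplexConjugate in
theorem mobius_denom_ne_zero {a z : ℂ} (ha : ‖a‖ < 1) (hz : ‖z‖ < 1) : 1 - conj a * z ≠ 0 := by
  intro h
  have h1 : conj a * z = 1 := (sub_eq_zero.1 h).symm
  have h2 : ‖a‖ * ‖z‖ = 1 := by
    have := congrArg norm h1
    simpa using this
  nlinarith [norm_nonneg a, norm_nonneg z]

theorem norm_mobius_lt_one {a z : ℂ} (ha : ‖a‖ < 1) (hz : ‖z‖ < 1) : ‖mobius a z‖ < 1 := by
  rw [mobius, norm_div, div_lt_one (norm_pos_iff.2 (mobius_denom_ne_zero ha hz))]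
  refine lt_of_pow_lt_pow_left₀ 2 (norm_nonneg _) ?_
  rw [← Complex.normSq_eq_norm_sq, ← Complex.normSq_eq_norm_sq]
  have h1 : Complex.normSq a < 1 := by
    rw [Complex.normSq_eq_norm_sq]; nlinarith [norm_nonneg a]
  have h2 : Complex.normSq z < 1 := by
    rw [Complex.normSq_eq_norm_sq]; nlinarith [norm_nonneg z]
  simp only [Complex.normSq_apply, Complex.sub_re, Complex.sub_im, Complex.mul_re, Complex.mul_im,
    Complex.conj_re, Complex.conj_im, Complex.one_re, Complex.one_im] at *
  nlinarith [mul_pos (sub_pos.2 h1) (sub_pos.2 h2)]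

theorem mobius_injOn {a : ℂ} (ha : ‖a‖ < 1) : InjOn (mobius a) (ball 0 1) := by
  intro z hz w hw h
  rw [mem_ball_zero_iff] at hz hw
  rw [mobius, mobius, div_eq_div_iff (mobius_denom_ne_zero ha hz) (mobius_denom_ne_zero ha hw)] at h
  have h1 : (z - w) * (1 - (starRingEnd ℂ) a * a) = 0 := by linear_combination h
  exact sub_eq_zero.1 ((mul_eq_zero.1 h1).resolve_right (mobius_denom_ne_zero ha ha))

theorem hasDerivAt_mobius {a z : ℂ} (ha : ‖a‖ < 1) (hz : ‖z‖ < 1) :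
    HasDerivAt (mobius a) ((1 - ‖a‖ ^ 2) / (1 - (starRingEnd ℂ) a * z) ^ 2) z := by
  have h := ((hasDerivAt_id z).sub_const a).div
    (((hasDerivAt_id z).const_mul ((starRingEnd ℂ) a)).const_sub 1) (mobius_denom_ne_zero ha hz)
  refine (h.congr_deriv ?_)
  simp only [id]
  congr 1
  rw [← Complex.conj_mul']
  ring

theorem mobius_self (a : ℂ) : mobius a a = 0 := by simp [mobius]

/-- Continuous square roots of holomorphic functions are holomorphic. -/
theorem hasDerivAt_of_sq_eq {h g : ℂ → ℂ} {U : Set ℂ} (hU : IsOpen U) (hc : ContinuousOn h U)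
    (hg : ∀ z, h z ^ 2 = g z) {z g' : ℂ} (hz : z ∈ U) (hz0 : h z ≠ 0) (hg' : HasDerivAt g g' z) :
    HasDerivAt h (g' / (2 * h z)) z := by
  rw [hasDerivAt_iff_tendsto_slope] at *
  have hcz : Tendsto h (𝓝 z) (𝓝 (h z)) := hc.continuousAt (hU.mem_nhds hz)
  have h1 : Tendsto (fun w => h w + h z) (𝓝 z) (𝓝 (2 * h z)) := by
    rw [two_mul]; exact hcz.add_const _
  refine (hg'.div (h1.mono_left nhdsWithin_le_nhds) (by simpa using hz0)).congr' ?_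
  have h2 : ∀ᶠ w in 𝓝[≠] z, h w + h z ≠ 0 :=
    nhdsWithin_le_nhds (h1.eventually_ne (by simpa using hz0))
  filter_upwards [h2] with w hw
  rw [Pi.div_apply, slope_def_field, slope_def_field, ← hg, ← hg, div_right_comm]
  congr 1
  rw [div_eq_iff hw]; ring

/-- The square root trick in the proof of the Riemann mapping theorem. -/
theorem exists_deriv_lt_of_notMem_image {Ω : Set ℂ} (ho : IsOpen Ω) (hs : IsSimplyConnected Ω)
    (h0 : 0 ∈ Ω) {f : ℂ → ℂ} (hd : DifferentiableOn ℂ f Ω) (hi : InjOn f Ω)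
    (hm : MapsTo f Ω (ball 0 1)) (hf0 : f 0 = 0) (hf' : deriv f 0 ≠ 0) {w : ℂ} (hw : ‖w‖ < 1)
    (hwf : w ∉ f '' Ω) :
    ∃ k : ℂ → ℂ, DifferentiableOn ℂ k Ω ∧ InjOn k Ω ∧ MapsTo k Ω (ball 0 1) ∧ k 0 = 0 ∧
      ‖deriv f 0‖ < ‖deriv k 0‖ := by
  have hm' : ∀ z ∈ Ω, ‖f z‖ < 1 := fun z hz => by simpa using hm hz
  have hw0 : 0 < ‖w‖ := norm_pos_iff.2 fun h => hwf ⟨0, h0, by rw [hf0, h]⟩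
  have hgd : ∀ z ∈ Ω, HasDerivAt (fun z => mobius w (f z))
      ((1 - ‖w‖ ^ 2) / (1 - (starRingEnd ℂ) w * f z) ^ 2 * deriv f z) z := fun z hz =>
    (hasDerivAt_mobius hw (hm' z hz)).comp z
      ((hd.differentiableAt (ho.mem_nhds hz)).hasDerivAt)
  have hg0 : ∀ z ∈ Ω, mobius w (f z) ≠ 0 := by
    intro z hz h
    rw [← mobius_self w] at h
    exact hwf ⟨z, hz, mobius_injOn hw (hm hz) (by simpa using hw) h⟩
  obtain ⟨h, hhc, hh⟩ := Complex.exists_continuousOn_pow_eq hs ho (g := fun z => mobius w (f z))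
    (fun z hz => (hgd z hz).continuousAt.continuousWithinAt)
    (by rintro ⟨z, hz, h⟩; exact hg0 z hz h) two_ne_zero
  have hhn : ∀ z ∈ Ω, h z ≠ 0 := fun z hz h0 => hg0 z hz (by
    have := hh z; rw [h0] at this; simpa using this.symm)
  have hhd : ∀ z ∈ Ω, HasDerivAt h _ z := fun z hz =>
    hasDerivAt_of_sq_eq ho hhc hh hz (hhn z hz) (hgd z hz)
  have hhb : ∀ z ∈ Ω, ‖h z‖ < 1 := by
    intro z hz
    have h1 := norm_mobius_lt_one hw (hm' z hz)
    rw [← hh z, norm_pow] at h1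
    nlinarith [norm_nonneg (h z)]
  have hkd : ∀ z ∈ Ω, HasDerivAt (fun z => mobius (h 0) (h z)) _ z := fun z hz =>
    (hasDerivAt_mobius (hhb 0 h0) (hhb z hz)).comp z (hhd z hz)
  refine ⟨fun z => mobius (h 0) (h z), fun z hz => (hkd z hz).differentiableAt.differentiableWithinAt,
    ?_, fun z hz => by simpa using norm_mobius_lt_one (hhb 0 h0) (hhb z hz), mobius_self _, ?_⟩
  · intro x hx y hy hxy
    have h1 := mobius_injOn (hhb 0 h0) (by simpa using hhb x hx) (by simpa using hhb y hy) hxy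
    have h2 : mobius w (f x) = mobius w (f y) := by
      rw [← hh, ← hh, h1]
    exact hi hx hy (mobius_injOn hw (hm hx) (hm hy) h2)
  · rw [(hkd 0 h0).deriv, hf0]
    have hs : ‖h 0‖ ^ 2 = ‖w‖ := by
      rw [← norm_pow, hh 0, hf0, mobius]; simp
    set s := ‖h 0‖ with hsdef
    have hs0 : 0 < s := norm_pos_iff.2 (hhn 0 h0)
    have hs1 : s < 1 := hhb 0 h0
    rw [← hs]
    simp only [mul_zero, sub_zero, one_pow, div_one, norm_mul, norm_div, norm_pow]
    have e1 : ‖(1 - (s:ℂ) ^ 2)‖ = 1 - s ^ 2 := by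
      rw [← Complex.ofReal_one, ← Complex.ofReal_pow, ← Complex.ofReal_sub, Complex.norm_real,
        Real.norm_of_nonneg (by nlinarith)]
    have e2 : ‖(1 - ((s ^ 2 : ℝ) : ℂ) ^ 2)‖ = 1 - s ^ 4 := by
      rw [← Complex.ofReal_one, ← Complex.ofReal_pow, ← Complex.ofReal_sub, Complex.norm_real,
        ← pow_mul, Real.norm_of_nonneg (by
          have : s ^ 4 ≤ 1 := pow_le_one₀ hs0.le hs1.le
          simpa using this)]
    have e3 : ‖1 - (starRingEnd ℂ) (h 0) * h 0‖ = 1 - s ^ 2 := by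
      rw [Complex.conj_mul', e1]
    rw [e1, e2, e3, Complex.norm_ofNat, ← hsdef]
    have hpos : 0 < ‖deriv f 0‖ := norm_pos_iff.2 hf'
    have hq : 0 < 1 - s ^ 2 := by nlinarith
    have : (1 - s ^ 2) / (1 - s ^ 2) ^ 2 * ((1 - s ^ 4) * ‖deriv f 0‖ / (2 * s))
        = ‖deriv f 0‖ * ((1 + s ^ 2) / (2 * s)) := by
      field_simp; ring
    rw [this]
    have h7 : 1 < (1 + s ^ 2) / (2 * s) := by
      rw [one_lt_div (by positivity)]; nlinarith
    nlinarith

end Annulus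

namespace Annulus

open Set Metric Filter Topology

/-- The **Riemann mapping theorem** for bounded domains. -/
theorem exists_riemann_map {Ω : Set ℂ} (ho : IsOpen Ω) (hs : IsSimplyConnected Ω)
    (h0 : 0 ∈ Ω) (hb : Bornology.IsBounded Ω) :
    ∃ f : ℂ → ℂ, DifferentiableOn ℂ f Ω ∧ BijOn f Ω (ball 0 1) ∧ f 0 = 0 := by
  obtain ⟨R, hR0, hR⟩ := hb.subset_ball_lt 0 0
  obtain ⟨r, hr0, hr⟩ := Metric.isOpen_iff.1 ho 0 h0
  let C : Set (ℂ → ℂ) := {f | DifferentiableOn ℂ f Ω ∧ InjOn f Ω ∧ MapsTo f Ω (ball 0 1) ∧ f 0 = 0}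
  let D : Set ℝ := (fun f : ℂ → ℂ => ‖deriv f 0‖) '' C
  have hRC : (fun z : ℂ => z / R) ∈ C := by
    have hR' : (R : ℂ) ≠ 0 := by exact_mod_cast hR0.ne'
    refine ⟨by fun_prop, fun x _ y _ h => by simpa [hR'] using h, fun z hz => ?_, by simp⟩
    have := hR hz
    rw [mem_ball_zero_iff] at *
    rw [norm_div, Complex.norm_real, Real.norm_of_nonneg hR0.le, div_lt_one hR0]
    exact this
  have hRD : 1 / R ∈ D := ⟨_, hRC, by simp [deriv_div_const, abs_of_pos hR0]⟩
  have hbdd : BddAbove D := by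
    refine ⟨1 / r, ?_⟩
    rintro _ ⟨f, hf, rfl⟩
    refine Complex.norm_deriv_le_div_of_mapsTo_ball (hf.1.mono hr) (fun z hz => ?_) hr0
    rw [hf.2.2.2]
    exact ball_subset_closedBall (hf.2.2.1 (hr hz))
  have hM : 0 < sSup D := (by positivity : 0 < 1 / R).trans_le (le_csSup hbdd hRD)
  obtain ⟨u, -, hu, huD⟩ := exists_seq_tendsto_sSup ⟨_, hRD⟩ hbdd
  choose F hFC hFu using huD
  obtain ⟨φ, hφ⟩ : ∃ φ : Ultrafilter ℕ, (φ : Filter ℕ) ≤ atTop := ⟨Ultrafilter.of atTop,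
    Ultrafilter.of_le _⟩
  have hlim : ∀ z, ∃ y, z ∈ Ω → ‖y‖ ≤ 1 ∧ Tendsto (fun i => F i z) φ (𝓝 y) := by
    intro z
    by_cases hz : z ∈ Ω
    · obtain ⟨y, hy, hy'⟩ := (isCompact_closedBall (0 : ℂ) 1).ultrafilter_le_nhds
        (φ.map fun i => F i z) (by
          rw [le_principal_iff]
          exact Filter.mem_map.2 <| Filter.univ_mem' fun i => ball_subset_closedBall ((hFC i).2.2.1 hz))
      exact ⟨y, fun _ => ⟨by simpa using hy, hy'⟩⟩
    · exact ⟨0, fun h => absurd h hz⟩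
  choose f hf using hlim
  have hlu : TendstoLocallyUniformlyOn F f φ Ω := tendstoLocallyUniformlyOn_of_bounded ho
    (fun i => (hFC i).1) (fun i => (hFC i).2.2.1) (fun z hz => (hf z hz).2)
  have hfd : DifferentiableOn ℂ f Ω := hlu.differentiableOn (.of_forall fun n => (hFC n).1) ho
  have hf0 : f 0 = 0 := tendsto_nhds_unique (hf 0 h0).2
    (tendsto_const_nhds.congr fun i => ((hFC i).2.2.2).symm)
  have hder : ‖deriv f 0‖ = sSup D := by
    have h1 := ((hlu.deriv (.of_forall fun i => (hFC i).1) ho).tendsto_at h0).norm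
    refine tendsto_nhds_unique h1 ((hu.mono_left hφ).congr fun i => ?_)
    exact (hFu i).symm
  have hf' : deriv f 0 ≠ 0 := norm_pos_iff.1 (hder ▸ hM)
  have hconn : IsPreconnected Ω := hs.isPathConnected.isConnected.isPreconnected
  have hinj : InjOn f Ω := injOn_of_tendstoLocallyUniformlyOn ho hconn (fun i => (hFC i).1)
    (fun i => (hFC i).2.1) hlu h0 hf'
  have hmaps : MapsTo f Ω (ball 0 1) := by
    intro z hz
    rw [mem_ball_zero_iff]
    refine lt_of_le_of_ne (hf z hz).1 fun h => ?_
    have hmax : IsMaxOn (norm ∘ f) Ω z := fun y hy => by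
      simpa [h] using (hf y hy).1
    have := Complex.eqOn_of_isPreconnected_of_isMaxOn_norm hconn ho hfd hz hmax h0
    simp only [Function.const_apply, hf0] at this
    rw [← this] at h
    simp at h
  refine ⟨f, hfd, ⟨hmaps, hinj, fun w hw => ?_⟩, hf0⟩
  by_contra hwf
  obtain ⟨k, h1, h2, h3, h4, h5⟩ := exists_deriv_lt_of_notMem_image ho hs h0 hfd hinj hmaps hf0 hf'
    (by simpa using hw) hwf
  exact (h5.trans_le (le_csSup hbdd ⟨k, ⟨h1, h2, h3, h4⟩, rfl⟩)).ne' hder.symm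

end Annulus

namespace Annulus

open Set Metric Filter Topology

/-- The inverse of an injective holomorphic function is holomorphic. -/
theorem differentiableOn_of_invOn {h f : ℂ → ℂ} {U V : Set ℂ} (hU : IsOpen U) (hV : IsOpen V)
    (hUc : IsPreconnected U) (hd : DifferentiableOn ℂ h U) (hf : MapsTo f V U)
    (hinv : InvOn f h U V) : DifferentiableOn ℂ f V := by
  rcases U.subsingleton_or_nontrivial with hUs | hUn
  · have hUe : U = ∅ := by
      by_contra hne
      obtain ⟨x, hx⟩ := nonempty_iff_ne_empty.2 hne
      have : U = {x} := hUs.eq_singleton_of_mem hx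
      exact not_isOpen_singleton x (this ▸ hU)
    intro z hz
    exact absurd (hf hz) (by simp [hUe])
  have hinj : InjOn h U := hinv.1.injOn
  obtain ⟨a, ha, b, hb, hab⟩ := hUn
  have han : AnalyticOnNhd ℂ h U := hd.analyticOnNhd hU
  have hopen : ∀ s ⊆ U, IsOpen s → IsOpen (h '' s) := by
    refine (han.is_constant_or_isOpen hUc).resolve_left ?_
    rintro ⟨w, hw⟩
    exact hab (hinj ha hb ((hw a ha).trans (hw b hb).symm))
  have hcont : ∀ w ∈ V, ContinuousAt f w := by
    intro w hw
    rw [ContinuousAt, _root_.tendsto_nhds]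
    intro s hs hws
    have h1 := hopen (s ∩ U) inter_subset_right (hs.inter hU)
    filter_upwards [h1.mem_nhds ⟨f w, ⟨hws, hf hw⟩, hinv.2 hw⟩]
    rintro _ ⟨y, hy, rfl⟩
    simpa [hinv.1 hy.2] using hy.1
  have hdiff : ∀ w ∈ V, deriv h (f w) ≠ 0 → DifferentiableAt ℂ f w := by
    intro w hw hne
    refine (HasDerivAt.of_local_left_inverse (hcont w hw)
      (hd.differentiableAt (hU.mem_nhds (hf hw))).hasDerivAt hne ?_).differentiableAt
    filter_upwards [hV.mem_nhds hw] with y hy using hinv.2 hy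
  have hisol : ∀ z ∈ U, ∀ᶠ y in 𝓝[≠] z, deriv h y ≠ 0 := by
    intro z hz
    refine (han.deriv z hz).eventually_eq_zero_or_eventually_ne_zero.resolve_left fun h0 => ?_
    have h1 : EqOn (deriv h) 0 U := han.deriv.eqOn_zero_of_preconnected_of_eventuallyEq_zero hUc hz h0
    exact hab (hinj ha hb (hU.is_const_of_deriv_eq_zero hUc hd h1 ha hb))
  intro w hw
  refine DifferentiableAt.differentiableWithinAt ?_
  have h2 : ∀ᶠ y in 𝓝[≠] w, deriv h (f y) ≠ 0 := by
    have : Tendsto f (𝓝[≠] w) (𝓝[≠] (f w)) := by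
      refine tendsto_nhdsWithin_iff.2 ⟨(hcont w hw).mono_left nhdsWithin_le_nhds, ?_⟩
      filter_upwards [self_mem_nhdsWithin, nhdsWithin_le_nhds (hV.mem_nhds hw)] with y hy hyV heq
      exact hy (by rw [mem_singleton_iff, ← hinv.2 hyV, ← hinv.2 hw, heq])
    exact this.eventually (hisol _ (hf hw))
  obtain ⟨s, hsw, hs⟩ : ∃ s ∈ 𝓝 w, ∀ y ∈ s \ {w}, DifferentiableAt ℂ f y := by
    rw [eventually_nhdsWithin_iff] at h2
    refine ⟨_, h2.and (hV.mem_nhds hw), fun y hy => hdiff y hy.1.2 (hy.1.1 hy.2)⟩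
  exact ((Complex.differentiableOn_compl_singleton_and_continuousAt_iff hsw).1
    ⟨fun y hy => (hs y hy).differentiableWithinAt, hcont w hw⟩).differentiableAt hsw

/-- Riemann maps and their inverses. -/
theorem exists_riemann_map_inverse {Ω : Set ℂ} (ho : IsOpen Ω) (hs : IsSimplyConnected Ω)
    (h0 : 0 ∈ Ω) (hb : Bornology.IsBounded Ω) :
    ∃ f h : ℂ → ℂ, DifferentiableOn ℂ f (ball 0 1) ∧ DifferentiableOn ℂ h Ω ∧
      MapsTo f (ball 0 1) Ω ∧ MapsTo h Ω (ball 0 1) ∧ InvOn h f (ball 0 1) Ω ∧ f 0 = 0 ∧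
      deriv f 0 ≠ 0 := by
  obtain ⟨h, hd, hbij, hh0⟩ := exists_riemann_map ho hs h0 hb
  have hinv := hbij.invOn_invFunOn
  set f := Function.invFunOn h Ω with hf
  have hm : MapsTo f (ball 0 1) Ω := hbij.surjOn.mapsTo_invFunOn
  have hfd : DifferentiableOn ℂ f (ball 0 1) := differentiableOn_of_invOn ho isOpen_ball
    hs.isPathConnected.isConnected.isPreconnected hd hm hinv
  have hf0 : f 0 = 0 := by
    have := hinv.1 h0
    rwa [hh0] at this
  refine ⟨f, h, hfd, hd, hm, hbij.mapsTo, hinv.symm, hf0, fun hz => ?_⟩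
  have h1 : HasDerivAt f 0 (h 0) := by
    rw [hh0]
    simpa only [hz] using (hfd.differentiableAt (ball_mem_nhds 0 one_pos)).hasDerivAt
  have h2 := h1.comp 0 (hd.differentiableAt (ho.mem_nhds h0)).hasDerivAt
  have h3 : f ∘ h =ᶠ[𝓝 0] id := by
    filter_upwards [ho.mem_nhds h0] with z hz using hinv.1 hz
  have h4 := h3.deriv_eq
  rw [h2.deriv] at h4
  simp at h4

end Annulus

namespace Annulus

open Set Metric Filter Topology MeasureTheory
open scoped ENNReal Real

theorem sq_setLIntegral_le {a : ℝ → ℝ≥0∞} (ha : Measurable a) (s : Set ℝ) :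
    (∫⁻ t in s, a t) ^ 2 ≤ volume s * ∫⁻ t in s, a t ^ 2 := by
  have h := ENNReal.lintegral_mul_le_Lp_mul_Lq (volume.restrict s) Real.HolderConjugate.two_two
    (f := fun _ => 1) (g := a) aemeasurable_const ha.aemeasurable
  simp only [Pi.mul_apply, one_mul, one_pow, lintegral_const, Measure.restrict_apply,
    MeasurableSet.univ, univ_inter, ENNReal.rpow_two] at h
  calc (∫⁻ t in s, a t) ^ 2
      ≤ (volume s ^ (1 / 2 : ℝ) * (∫⁻ t in s, a t ^ 2) ^ (1 / 2 : ℝ)) ^ 2 := by gcongr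
    _ = _ := by
      rw [mul_pow, ← ENNReal.rpow_natCast, ← ENNReal.rpow_natCast, ← ENNReal.rpow_mul,
        ← ENNReal.rpow_mul]
      norm_num

theorem lintegral_enorm_deriv_sq {u : ℂ → ℂ} {U : Set ℂ} (hU : IsOpen U)
    (hd : DifferentiableOn ℂ u U) (hi : InjOn u U) :
    ∫⁻ z in U, ‖deriv u z‖ₑ ^ 2 = volume (u '' U) := by
  rw [← lintegral_abs_det_fderiv_eq_addHaar_image volume hU.measurableSet
    (f' := fun z => (ContinuousLinearMap.toSpanSingleton ℂ (deriv u z)).restrictScalars ℝ) ?_ hi]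
  · refine setLIntegral_congr_fun hU.measurableSet fun z _ => ?_
    have : ((ContinuousLinearMap.toSpanSingleton ℂ (deriv u z)).restrictScalars ℝ).det
        = ‖deriv u z‖ ^ 2 := by
      simp [ContinuousLinearMap.det, LinearMap.det_restrictScalars, Algebra.norm_complex_eq,
        Complex.normSq_eq_norm_sq]
    simp only [this]
    rw [abs_of_nonneg (by positivity), ENNReal.ofReal_pow (norm_nonneg _), ofReal_norm]
  · intro z hz
    have := (hd.differentiableAt (hU.mem_nhds hz)).hasDerivAt.hasFDerivAt.restrictScalars ℝ
    exact this.hasFDerivWithinAt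

theorem lintegral_inv_eq_top {δ c : ℝ} (hδ : 0 < δ) (hc : 0 < c) :
    ∫⁻ r in Ioo 0 δ, ENNReal.ofReal (c * r⁻¹) = ∞ := by
  by_contra h
  have h1 : IntegrableOn (fun r : ℝ => c * r⁻¹) (Ioo 0 δ) := by
    refine ⟨(by fun_prop : Measurable fun r : ℝ => c * r⁻¹).aestronglyMeasurable, ?_⟩
    rw [hasFiniteIntegral_iff_ofReal]
    · exact lt_top_iff_ne_top.2 h
    · refine (ae_restrict_iff' measurableSet_Ioo).2 (.of_forall fun r hr => ?_)
      have := hr.1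
      positivity
  have h2 : IntervalIntegrable (fun r : ℝ => c * r⁻¹) volume 0 δ :=
    (intervalIntegrable_iff_integrableOn_Ioo_of_le hδ.le).2 h1
  have h3 := (intervalIntegrable_inv_iff (a := 0) (b := δ)).1 (by
    simpa [hc.ne'] using h2.const_mul c⁻¹)
  rcases h3 with h3 | h3
  · exact hδ.ne h3
  · exact h3 left_mem_uIcc

end Annulus

namespace Annulus

open Set Metric Filter Topology MeasureTheory
open scoped ENNReal Real

theorem polar_mem_ball_iff {ρ θ : ℝ} (hρ : 0 < ρ) :
    (ρ * Complex.exp (θ * Complex.I) : ℂ) ∈ ball (1 : ℂ) 1 ↔ ρ < 2 * Real.cos θ := by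
  rw [mem_ball, dist_eq_norm, ← sq_lt_one_iff₀ (norm_nonneg _), ← Complex.normSq_eq_norm_sq,
    Complex.normSq_apply]
  simp only [Complex.sub_re, Complex.re_ofReal_mul, Complex.exp_ofReal_mul_I_re, Complex.one_re,
    Complex.sub_im, Complex.im_ofReal_mul, Complex.exp_ofReal_mul_I_im, Complex.one_im]
  have : (ρ * Real.cos θ - 1) * (ρ * Real.cos θ - 1) + (ρ * Real.sin θ - 0) * (ρ * Real.sin θ - 0)
      = 1 + ρ * (ρ - 2 * Real.cos θ) := by
    linear_combination ρ ^ 2 * Real.sin_sq_add_cos_sq θ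
  rw [this]
  constructor
  · intro h; nlinarith
  · intro h; nlinarith

theorem enorm_sub_le_lintegral_arc {u : ℂ → ℂ} (hd : DifferentiableOn ℂ u (ball 1 1)) {ρ : ℝ}
    (hρ : 0 < ρ) {w₁ w₂ : ℂ} (h₁ : w₁ ∈ ball (1 : ℂ) 1) (h₂ : w₂ ∈ ball (1 : ℂ) 1)
    (hw₁ : ‖w₁‖ = ρ) (hw₂ : ‖w₂‖ = ρ) :
    ‖u w₁ - u w₂‖ₑ ≤ ENNReal.ofReal ρ * ∫⁻ θ in Ioo (-π) π,
      (ball (1 : ℂ) 1).indicator (fun w => ‖deriv u w‖ₑ) (ρ * Complex.exp (θ * Complex.I)) := by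
  wlog hle : w₂.arg ≤ w₁.arg generalizing w₁ w₂
  · rw [← neg_sub, enorm_neg]
    exact this h₂ h₁ hw₂ hw₁ (le_of_not_ge hle)
  set c : ℝ → ℂ := fun θ => ρ * Complex.exp (θ * Complex.I) with hc
  have hc1 : c w₁.arg = w₁ := by rw [hc, ← hw₁]; exact Complex.norm_mul_exp_arg_mul_I w₁
  have hc2 : c w₂.arg = w₂ := by rw [hc, ← hw₂]; exact Complex.norm_mul_exp_arg_mul_I w₂
  have hcd : ∀ θ : ℝ, HasDerivAt c (ρ * (Complex.exp (θ * Complex.I) * Complex.I)) θ := by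
    intro θ
    have h := ((HasDerivAt.ofReal_comp (hasDerivAt_id θ)).mul_const Complex.I).cexp.const_mul (ρ : ℂ)
    simpa using h
  rw [← hc1, polar_mem_ball_iff hρ] at h₁
  rw [← hc2, polar_mem_ball_iff hρ] at h₂
  have harg : ∀ {w : ℂ}, ρ < 2 * Real.cos w.arg → w.arg ∈ Icc (-(π / 2)) (π / 2) := by
    intro w hw
    rw [mem_Icc, ← abs_le, Complex.abs_arg_le_pi_div_two_iff]
    have h1 : 0 < Real.cos w.arg := by linarith
    rcases eq_or_ne w 0 with rfl | h0
    · simp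
    rw [Complex.cos_arg h0] at h1
    have : 0 < ‖w‖ := norm_pos_iff.2 h0
    exact ((div_pos_iff_of_pos_right this).1 h1).le
  have hmem : ∀ θ ∈ Icc w₂.arg w₁.arg, c θ ∈ ball (1 : ℂ) 1 := by
    intro θ hθ
    rw [polar_mem_ball_iff hρ]
    have := strictConcaveOn_cos_Icc.concaveOn.min_le_of_mem_Icc (harg h₂) (harg h₁) hθ
    rcases min_le_iff.1 this with h | h <;> linarith
  have hder : ∀ θ ∈ uIcc w₂.arg w₁.arg, HasDerivAt (u ∘ c)
      (deriv u (c θ) * (ρ * (Complex.exp (θ * Complex.I) * Complex.I))) θ := by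
    intro θ hθ
    rw [uIcc_of_le hle] at hθ
    exact (hd.differentiableAt (isOpen_ball.mem_nhds (hmem θ hθ))).hasDerivAt.comp θ (hcd θ)
  have hcont : ContinuousOn (fun θ : ℝ =>
      deriv u (c θ) * (ρ * (Complex.exp (θ * Complex.I) * Complex.I))) (uIcc w₂.arg w₁.arg) := by
    rw [uIcc_of_le hle]
    refine ContinuousOn.mul ?_ (by fun_prop)
    exact ((hd.deriv isOpen_ball).continuousOn).comp (by fun_prop) hmem
  have hint := intervalIntegral.integral_eq_sub_of_hasDerivAt hder hcont.intervalIntegrable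
  rw [Function.comp, Function.comp, hc1, hc2, intervalIntegral.integral_of_le hle] at hint
  rw [← hint]
  refine (enorm_integral_le_lintegral_enorm _).trans ?_
  rw [← lintegral_const_mul' _ _ ENNReal.ofReal_ne_top]
  have hsub : Ioc w₂.arg w₁.arg ⊆ Ioo (-π) π := by
    intro θ hθ
    have := (harg h₁).2
    have := (harg h₂).1
    constructor <;> linarith [hθ.1, hθ.2, Real.pi_pos]
  refine le_trans ?_ (lintegral_mono_set hsub)
  refine setLIntegral_mono' measurableSet_Ioc fun θ hθ => ?_
  rw [indicator_of_mem (hmem θ (Ioc_subset_Icc_self hθ)), mul_comm, enorm_mul, enorm_mul, enorm_mul]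
  have e1 : ‖Complex.exp (θ * Complex.I)‖ₑ = 1 := by
    rw [← ofReal_norm, Complex.norm_exp_ofReal_mul_I]; simp
  have e2 : ‖(ρ : ℂ)‖ₑ = ENNReal.ofReal ρ := by
    rw [← ofReal_norm, Complex.norm_real, Real.norm_of_nonneg hρ.le]
  have e3 : ‖Complex.I‖ₑ = 1 := by rw [← ofReal_norm]; simp
  rw [e1, e2, e3]
  simp [hc]

/-- The length-area estimate: there are arbitrarily small circular crosscuts with small image. -/
theorem exists_small_crosscut {u : ℂ → ℂ} (hd : DifferentiableOn ℂ u (ball 1 1))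
    (hi : InjOn u (ball 1 1)) (hb : Bornology.IsBounded (u '' ball 1 1)) {ε δ : ℝ} (hε : 0 < ε)
    (hδ : 0 < δ) :
    ∃ ρ ∈ Ioo 0 δ, ∀ w₁ ∈ ball (1 : ℂ) 1, ∀ w₂ ∈ ball (1 : ℂ) 1, ‖w₁‖ = ρ → ‖w₂‖ = ρ →
      dist (u w₁) (u w₂) < ε := by
  by_contra! hcon
  set A : ℂ → ℝ≥0∞ := (ball (1 : ℂ) 1).indicator (fun w => ‖deriv u w‖ₑ) with hA
  have hAm : Measurable A := (measurable_deriv u).enorm.indicator measurableSet_ball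
  have harea : ∫⁻ z, A z ^ 2 ≠ ∞ := by
    have h1 : ∫⁻ z, A z ^ 2 = ∫⁻ z in ball 1 1, ‖deriv u z‖ₑ ^ 2 := by
      rw [← lintegral_indicator measurableSet_ball]
      congr 1 with z
      by_cases hz : z ∈ ball (1 : ℂ) 1 <;> simp [hA, hz]
    rw [h1, lintegral_enorm_deriv_sq isOpen_ball hd hi]
    exact hb.measure_lt_top.ne
  rw [← Complex.lintegral_comp_polarCoord_symm, polarCoord_target, Measure.volume_eq_prod,
    setLIntegral_prod] at harea
  · apply harea
    rw [eq_top_iff]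
    have hc : 0 < ε ^ 2 / (2 * π) := by positivity
    rw [← lintegral_inv_eq_top hδ hc]
    refine le_trans ?_ (lintegral_mono_set (Ioo_subset_Ioi_self : Ioo 0 δ ⊆ Ioi 0))
    refine setLIntegral_mono' measurableSet_Ioo fun ρ hρ => ?_
    obtain ⟨w₁, h₁, w₂, h₂, hw₁, hw₂, hdist⟩ := hcon ρ hρ
    have hlen := enorm_sub_le_lintegral_arc hd hρ.1 h₁ h₂ hw₁ hw₂
    have hcs := sq_setLIntegral_le (a := fun θ : ℝ => A (ρ * Complex.exp (θ * Complex.I)))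
      (by fun_prop) (Ioo (-π) π)
    rw [← ofReal_norm, ← dist_eq_norm] at hlen
    have h3 := (ENNReal.ofReal_le_ofReal hdist).trans hlen
    set L := ∫⁻ θ in Ioo (-π) π, A (ρ * Complex.exp (θ * Complex.I)) with hL
    have h4 : ∫⁻ θ in Ioo (-π) π, ENNReal.ofReal ρ • A (Complex.polarCoord.symm (ρ, θ)) ^ 2
        = ENNReal.ofReal ρ * ∫⁻ θ in Ioo (-π) π, A (ρ * Complex.exp (θ * Complex.I)) ^ 2 := by
      rw [← lintegral_const_mul' _ _ ENNReal.ofReal_ne_top]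
      congr 1 with θ
      rw [smul_eq_mul, Complex.polarCoord_symm_apply, Complex.exp_mul_I, Complex.ofReal_cos,
        Complex.ofReal_sin]
    rw [h4]
    set B := ∫⁻ θ in Ioo (-π) π, A (ρ * Complex.exp (θ * Complex.I)) ^ 2 with hB
    rw [Real.volume_Ioo, show π - -π = 2 * π by ring] at hcs
    have h5 : ENNReal.ofReal ε ^ 2 ≤ ENNReal.ofReal ρ ^ 2 * (ENNReal.ofReal (2 * π) * B) :=
      calc ENNReal.ofReal ε ^ 2 ≤ (ENNReal.ofReal ρ * L) ^ 2 := by gcongr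
        _ = ENNReal.ofReal ρ ^ 2 * L ^ 2 := mul_pow _ _ _
        _ ≤ _ := by gcongr
    have hρ0 := hρ.1
    have h6 : ENNReal.ofReal (ε ^ 2 / (2 * π) * ρ⁻¹)
        = ENNReal.ofReal (1 / (2 * π * ρ)) * ENNReal.ofReal ε ^ 2 := by
      rw [← ENNReal.ofReal_pow hε.le, ← ENNReal.ofReal_mul (by positivity)]
      congr 1; field_simp
    rw [h6]
    calc ENNReal.ofReal (1 / (2 * π * ρ)) * ENNReal.ofReal ε ^ 2
        ≤ ENNReal.ofReal (1 / (2 * π * ρ)) *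
          (ENNReal.ofReal ρ ^ 2 * (ENNReal.ofReal (2 * π) * B)) := by gcongr
      _ = ENNReal.ofReal (1 / (2 * π * ρ) * ρ * (2 * π)) * (ENNReal.ofReal ρ * B) := by
        rw [ENNReal.ofReal_mul (p := 1 / (2 * π * ρ) * ρ) (by positivity),
          ENNReal.ofReal_mul (p := 1 / (2 * π * ρ)) (by positivity)]
        ring
      _ = ENNReal.ofReal ρ * B := by
        have : 1 / (2 * π * ρ) * ρ * (2 * π) = 1 := by field_simp
        rw [this]; simp
  · refine Measurable.aemeasurable ?_
    simp_rw [Complex.polarCoord_symm_apply]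
    refine Measurable.smul (measurable_fst.ennreal_ofReal) ((hAm.comp ?_).pow_const 2)
    fun_prop

end Annulus

namespace Annulus

open Set Metric Filter Topology MeasureTheory
open scoped ENNReal Real

theorem dist_lt_near_boundary (G : ℂ ≃ₜ ℂ) {f h : ℂ → ℂ}
    (hf : DifferentiableOn ℂ f (ball 0 1)) (hh : ContinuousOn h (G '' ball 0 1))
    (mf : MapsTo f (ball 0 1) (G '' ball 0 1)) (mh : MapsTo h (G '' ball 0 1) (ball 0 1))
    (hi : InvOn h f (ball 0 1) (G '' ball 0 1)) (hG : G 0 = 0) (hf0 : f 0 = 0) {ζ : ℂ}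
    (hζ : ‖ζ‖ = 1) {ε : ℝ} (hε : 0 < ε) :
    ∃ δ > 0, ∀ z ∈ ball (0 : ℂ) 1, ∀ w ∈ ball (0 : ℂ) 1, dist z ζ < δ → dist w ζ < δ →
      dist (f z) (f w) < ε := by
  have hcb : IsCompact (closedBall (0 : ℂ) 1) := isCompact_closedBall 0 1
  obtain ⟨η, hη, hGu⟩ := Metric.uniformContinuousOn_iff.1
    (hcb.uniformContinuousOn_of_continuous G.continuous.continuousOn) ε hε
  obtain ⟨η', hη', h4, h1⟩ : ∃ η' > 0, 4 * η' ≤ η ∧ η' ≤ 1 :=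
    ⟨min (η / 4) 1, by positivity, by linarith [min_le_left (η / 4) 1], min_le_right _ _⟩
  obtain ⟨ε', hε', hGi⟩ := Metric.uniformContinuousOn_iff.1
    ((hcb.image G.continuous).uniformContinuousOn_of_continuous G.symm.continuous.continuousOn)
    η' hη'
  set φ : ℂ → ℂ := fun z => h (G z) with hφ
  have hφc : ContinuousOn φ (ball 0 1) :=
    hh.comp G.continuous.continuousOn (mapsTo_image _ _)
  have mφ : MapsTo φ (ball 0 1) (ball 0 1) := fun z hz => mh (mem_image_of_mem _ hz)
  have mψ : ∀ z ∈ ball (0 : ℂ) 1, G.symm (f z) ∈ ball (0 : ℂ) 1 := by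
    intro z hz
    obtain ⟨y, hy, he⟩ := mf hz
    rw [← he, G.symm_apply_apply]; exact hy
  have hφψ : ∀ z ∈ ball (0 : ℂ) 1, φ (G.symm (f z)) = z := by
    intro z hz
    simp only [hφ, G.apply_symm_apply]; exact hi.1 hz
  have hψφ : ∀ z ∈ ball (0 : ℂ) 1, G.symm (f (φ z)) = z := by
    intro z hz
    rw [hφ, hi.2 (mem_image_of_mem _ hz), G.symm_apply_apply]
  have hφ0 : φ 0 = 0 := by
    have := hφψ 0 (by simp)
    rwa [hf0, ← hG, G.symm_apply_apply, hG] at this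
  have hsub : closedBall (0 : ℂ) (1 - η') ⊆ ball 0 1 := closedBall_subset_ball (by linarith)
  obtain ⟨z₀, hz₀, hmax⟩ := (isCompact_closedBall (0 : ℂ) (1 - η')).exists_isMaxOn
    ⟨0, by simp; linarith⟩ (hφc.mono hsub).norm
  have hr0 : ‖φ z₀‖ < 1 := by simpa using mφ (hsub hz₀)
  have hζ0 : ζ ≠ 0 := by rintro rfl; simp at hζ
  have mw : ∀ w, ζ * (1 - w) ∈ ball (0 : ℂ) 1 ↔ w ∈ ball (1 : ℂ) 1 := by
    intro w
    rw [mem_ball_zero_iff, norm_mul, hζ, one_mul, mem_ball, dist_comm, dist_eq_norm]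
  have hb : Bornology.IsBounded ((fun w => f (ζ * (1 - w))) '' ball 1 1) := by
    refine (hcb.image G.continuous).isBounded.subset ?_
    rintro _ ⟨w, hw, rfl⟩
    exact image_mono ball_subset_closedBall (mf ((mw w).2 hw))
  obtain ⟨ρ, hρ, hcut⟩ := exists_small_crosscut (u := fun w => f (ζ * (1 - w)))
    (hf.comp (by fun_prop) fun w hw => (mw w).2 hw)
    (fun w hw w' hw' he => by
      have := hi.1.injOn ((mw w).2 hw) ((mw w').2 hw') he
      have := mul_left_cancel₀ hζ0 this
      linear_combination -this) hb hε' (show 0 < 1 - ‖φ z₀‖ by linarith)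
  have hρ1 : ρ < 1 := by linarith [hρ.2, norm_nonneg (φ z₀)]
  have hcut' : ∀ z ∈ ball (0 : ℂ) 1, ∀ w ∈ ball (0 : ℂ) 1, dist z ζ = ρ → dist w ζ = ρ →
      dist (G.symm (f z)) (G.symm (f w)) < η' := by
    have key : ∀ z, ζ * (1 - (1 - z / ζ)) = z := fun z => by field_simp; ring
    have key2 : ∀ z, ‖1 - z / ζ‖ = dist z ζ := fun z => by
      rw [dist_comm, dist_eq_norm, ← one_mul ‖1 - z / ζ‖, ← hζ, ← norm_mul]; congr 1; field_simp
    intro z hz w hw hz' hw'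
    refine hGi _ (image_mono ball_subset_closedBall (mf hz)) _
      (image_mono ball_subset_closedBall (mf hw)) ?_
    have := hcut (1 - z / ζ) ((mw _).1 (by rwa [key])) (1 - w / ζ) ((mw _).1 (by rwa [key]))
      (by rw [key2, hz']) (by rw [key2, hw'])
    simpa only [key] using this
  have hq : ζ * (1 - ρ) ∈ ball (0 : ℂ) 1 ∧ dist (ζ * (1 - ρ)) ζ = ρ := by
    constructor
    · rw [mem_ball_zero_iff, norm_mul, hζ, one_mul, ← Complex.ofReal_one, ← Complex.ofReal_sub,
        Complex.norm_real, Real.norm_eq_abs, abs_lt]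
      constructor <;> linarith [hρ.1]
    · rw [dist_eq_norm, show ζ * (1 - ρ) - ζ = -(ζ * ρ) by ring, norm_neg, norm_mul, hζ, one_mul,
        Complex.norm_real, Real.norm_of_nonneg hρ.1.le]
  have main : ∀ z ∈ ball (0 : ℂ) 1, dist z ζ < ρ →
      dist (G.symm (f z)) (G.symm (f (ζ * (1 - ρ)))) < 2 * η' := by
    intro z hz hzd
    set p := G.symm (f z) with hp
    have hp1 := mψ z hz
    rw [← hp] at hp1
    have hseg : ∀ t ∈ Icc (0 : ℝ) 1, (t : ℂ) * p ∈ ball (0 : ℂ) 1 := by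
      intro t ht
      rw [mem_ball_zero_iff] at hp1 ⊢
      rw [norm_mul, Complex.norm_real, Real.norm_of_nonneg ht.1]
      nlinarith [ht.2, ht.1, norm_nonneg p]
    have hc : ContinuousOn (fun t : ℝ => dist (φ (t * p)) ζ) (Icc 0 1) :=
      continuous_dist.comp_continuousOn ((hφc.comp (f := fun t : ℝ => (t : ℂ) * p)
        (by fun_prop) hseg).prodMk continuousOn_const)
    obtain ⟨t, ht, hte⟩ := intermediate_value_Icc' zero_le_one hc
      (show ρ ∈ _ by
        constructor
        · simp only [Complex.ofReal_one, one_mul, hp, hφψ z hz]; exact hzd.le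
        · simp [hφ0, hζ, hρ1.le])
    simp only at hte
    have hd := hcut' _ (mφ (hseg t ht)) _ hq.1 hte hq.2
    rw [hψφ _ (hseg t ht)] at hd
    have hn : 1 - η' < ‖(t : ℂ) * p‖ := by
      by_contra! hle
      have h2 : ‖φ (t * p)‖ ≤ ‖φ z₀‖ := hmax (show (t : ℂ) * p ∈ _ by simpa using hle)
      have h3 : ‖ζ‖ ≤ dist (φ (t * p)) ζ + ‖φ (t * p)‖ := by
        rw [dist_comm, dist_eq_norm]; simpa using norm_add_le (ζ - φ (t * p)) (φ (t * p))
      rw [hζ, hte] at h3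
      linarith [hρ.2]
    have h5 : dist p (t * p) < η' := by
      rw [mem_ball_zero_iff] at hp1
      rw [dist_eq_norm, show p - t * p = ((1 - t : ℝ) : ℂ) * p by push_cast; ring, norm_mul,
        Complex.norm_real, Real.norm_of_nonneg (by linarith [ht.2])]
      rw [norm_mul, Complex.norm_real, Real.norm_of_nonneg ht.1] at hn
      nlinarith
    linarith [dist_triangle p (t * p) (G.symm (f (ζ * (1 - ρ))))]
  refine ⟨ρ, hρ.1, fun z hz w hw hzd hwd => ?_⟩
  have h1 := main z hz hzd
  have h2 := main w hw hwd
  rw [dist_comm] at h2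
  have := hGu _ (ball_subset_closedBall (mψ z hz)) _ (ball_subset_closedBall (mψ w hw))
    (by linarith [dist_triangle (G.symm (f z)) (G.symm (f (ζ * (1 - ρ)))) (G.symm (f w))])
  simpa using this

end Annulus

namespace Annulus

open Set Metric Filter Topology MeasureTheory
open scoped ENNReal Real

theorem isSimplyConnected_ball : IsSimplyConnected (ball (0 : ℂ) 1) := by
  have := ((convex_ball (0 : ℂ) 1).starConvex (mem_ball_self one_pos)).contractibleSpace
    ⟨0, mem_ball_self one_pos⟩
  show SimplyConnectedSpace _
  infer_instance

/-- A non-constant-at-zero boundary vanishing principle: a function on the closed disc that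
extends holomorphically and does not take the value `p` at `0` cannot satisfy
`F ξ = p ∨ F (-ξ) = p` for all `ξ` in an open sector. -/
theorem exists_ne_of_sector {F : ℂ → ℂ} (hF : DiffContOnCl ℂ F (ball 0 1)) {p : ℂ} (hp : F 0 ≠ p)
    {O : Set ℂ} (hO : IsOpen O) (hne : (O ∩ sphere 0 1).Nonempty) :
    ∃ ξ ∈ O ∩ sphere 0 1, F ξ ≠ p ∧ F (-ξ) ≠ p := by
  by_contra! hcon
  obtain ⟨ξ₀, hξ₀, hn₀⟩ := hne
  rw [mem_sphere_zero_iff_norm] at hn₀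
  have hn0 : ξ₀ ≠ 0 := by rintro rfl; simp at hn₀
  obtain ⟨t, ht, hcov⟩ := (isCompact_sphere (0 : ℂ) 1).elim_nhds_subcover
    (fun c => (fun z => ξ₀ * c⁻¹ * z) ⁻¹' O) (fun c hc => by
      rw [mem_sphere_zero_iff_norm] at hc
      have : c ≠ 0 := by rintro rfl; simp at hc
      refine (hO.preimage (by fun_prop)).mem_nhds ?_
      simpa [mul_assoc, inv_mul_cancel₀ this] using hξ₀)
  have hmaps : ∀ a : ℂ, ‖a‖ = 1 → DiffContOnCl ℂ (fun z => F (a * z)) (ball 0 1) := by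
    intro a ha
    have hd : Differentiable ℂ fun z => a * z := by fun_prop
    refine hF.comp hd.diffContOnCl ?_
    intro z hz
    simpa [ha] using hz
  have hnorm : ∀ c ∈ t, ‖ξ₀ * c⁻¹‖ = 1 := by
    intro c hc
    have := ht c hc
    rw [mem_sphere_zero_iff_norm] at this
    simp [hn₀, this]
  have hprod : ∀ s ⊆ t, DiffContOnCl ℂ
      (fun z => ∏ c ∈ s, (F (ξ₀ * c⁻¹ * z) - p) * (F (-(ξ₀ * c⁻¹) * z) - p)) (ball 0 1) := by
    intro s
    induction s using Finset.induction_on with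
    | empty => intro _; simpa using diffContOnCl_const
    | insert c s hc ih =>
      intro hs
      simp only [Finset.prod_insert hc]
      have h1 := hnorm c (hs (Finset.mem_insert_self _ _))
      have := (((hmaps _ h1).sub_const p).smul ((hmaps (-(ξ₀ * c⁻¹)) (by rwa [norm_neg])).sub_const p)).smul
        (ih ((Finset.subset_insert _ _).trans hs))
      simpa [smul_eq_mul] using this
  have hzero := Complex.eqOn_of_eqOn_frontier isBounded_ball (hprod t subset_rfl)
    (diffContOnCl_const (c := 0)) (fun z hz => by
      rw [frontier_ball (0 : ℂ) one_ne_zero] at hz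
      obtain ⟨c, hc, hcO⟩ := mem_iUnion₂.1 (hcov hz)
      refine Finset.prod_eq_zero hc ?_
      have hsp : ξ₀ * c⁻¹ * z ∈ O ∩ sphere 0 1 := by
        refine ⟨hcO, ?_⟩
        rw [mem_sphere_zero_iff_norm] at hz ⊢
        rw [norm_mul, hnorm c hc, hz, one_mul]
      by_cases h : F (ξ₀ * c⁻¹ * z) = p
      · rw [h]; simp
      · rw [neg_mul, hcon _ hsp h]; simp)
  have h0 := hzero (mem_ball_self one_pos)
  simp only [mul_zero] at h0
  rw [Finset.prod_eq_zero_iff] at h0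
  obtain ⟨c, -, hc⟩ := h0
  rw [mul_self_eq_zero, sub_eq_zero] at hc
  exact hp hc

end Annulus

namespace Annulus

open Set Metric Filter Topology MeasureTheory
open scoped ENNReal Real

/-- **Carathéodory's theorem** for the image of the disc under a homeomorphism of the plane. -/
theorem exists_caratheodory (G : ℂ ≃ₜ ℂ) (hG : G 0 = 0) :
    ∃ F : ℂ → ℂ, ContinuousOn F (closedBall 0 1) ∧ DifferentiableOn ℂ F (ball 0 1) ∧
      BijOn F (ball 0 1) (G '' ball 0 1) ∧
      BijOn F (sphere 0 1) (G '' sphere 0 1) ∧ F 0 = 0 ∧ deriv F 0 ≠ 0 := by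
  have hcb : IsCompact (closedBall (0 : ℂ) 1) := isCompact_closedBall 0 1
  have hcl : closure (ball (0 : ℂ) 1) = closedBall 0 1 := closure_ball 0 one_ne_zero
  have hop : IsOpen (G '' ball (0 : ℂ) 1) := G.isOpenMap _ isOpen_ball
  obtain ⟨f, h, hf, hh, mf, mh, hi, hf0, hf0'⟩ := exists_riemann_map_inverse
    hop (G.isSimplyConnected_image.2 isSimplyConnected_ball)
    ⟨0, mem_ball_self one_pos, hG⟩ ((hcb.image G.continuous).isBounded.subset
      (image_mono ball_subset_closedBall))
  have hlim : ∀ ζ ∈ closedBall (0 : ℂ) 1, ∃ y, Tendsto f (𝓝[ball 0 1] ζ) (𝓝 y) := by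
    intro ζ hζ
    rcases (mem_closedBall.1 hζ).lt_or_eq with hlt | heq
    · exact ⟨_, hf.continuousOn ζ hlt⟩
    · have hne : (𝓝[ball 0 1] ζ).NeBot := mem_closure_iff_nhdsWithin_neBot.1 (hcl ▸ hζ)
      rw [← cauchy_map_iff_exists_tendsto, Metric.cauchy_iff]
      refine ⟨hne.map f, fun ε hε => ?_⟩
      obtain ⟨δ, hδ, hd⟩ := dist_lt_near_boundary G hf hh.continuousOn mf mh hi hG hf0
        (by simpa using heq) hε
      refine ⟨f '' (ball ζ δ ∩ ball 0 1), image_mem_map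
        (inter_mem (mem_nhdsWithin_of_mem_nhds (ball_mem_nhds ζ hδ)) self_mem_nhdsWithin), ?_⟩
      rintro _ ⟨z, hz, rfl⟩ _ ⟨w, hw, rfl⟩
      exact hd z hz.2 w hw.2 hz.1 hw.1
  set F := extendFrom (ball 0 1) f with hFdef
  have hFc : ContinuousOn F (closedBall 0 1) := continuousOn_extendFrom hcl.ge hlim
  have hFf : EqOn F f (ball 0 1) := extendFrom_extends hf.continuousOn
  have hFd : DifferentiableOn ℂ F (ball 0 1) := hf.congr hFf
  have hbij : BijOn F (ball 0 1) (G '' ball 0 1) := (hi.bijOn mf mh).congr hFf.symm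
  have hdisj : ∀ {x}, ‖x‖ = 1 → G x ∉ G '' ball 0 1 := by
    intro x hx hm
    rw [G.injective.mem_set_image, mem_ball_zero_iff] at hm
    linarith
  have hcbs : ∀ z ∈ closedBall (0 : ℂ) 1, z ∈ ball (0 : ℂ) 1 ∨ z ∈ sphere (0 : ℂ) 1 := by
    intro z hz
    exact (mem_closedBall.1 hz).lt_or_eq
  have hmem : MapsTo F (closedBall 0 1) (G '' closedBall 0 1) := by
    have := hbij.mapsTo.closure_of_continuousOn (hcl.symm ▸ hFc)
    rwa [hcl, ← G.image_closure, hcl] at this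
  have hmaps : MapsTo F (sphere 0 1) (G '' sphere 0 1) := by
    intro ζ hζ
    obtain ⟨x, hx, hxe⟩ := hmem (sphere_subset_closedBall hζ)
    refine ⟨x, ?_, hxe⟩
    refine (hcbs x hx).resolve_left fun hxb => ?_
    have hFΩ : F ζ ∈ G '' ball 0 1 := ⟨x, hxb, hxe⟩
    have hne : (𝓝[ball 0 1] ζ).NeBot :=
      mem_closure_iff_nhdsWithin_neBot.1 (hcl ▸ sphere_subset_closedBall hζ)
    have h1 : Tendsto (fun z => h (F z)) (𝓝[ball 0 1] ζ) (𝓝 (h (F ζ))) :=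
      ((hh.continuousOn.continuousAt (hop.mem_nhds hFΩ)).tendsto).comp
        ((hFc ζ (sphere_subset_closedBall hζ)).mono_left
          (nhdsWithin_mono _ ball_subset_closedBall))
    have h2 : Tendsto (fun z => h (F z)) (𝓝[ball 0 1] ζ) (𝓝 ζ) := by
      refine Tendsto.congr' ?_ (tendsto_nhdsWithin_of_tendsto_nhds tendsto_id)
      filter_upwards [self_mem_nhdsWithin] with z hz
      rw [hFf hz, hi.1 hz]; rfl
    have h3 := tendsto_nhds_unique h1 h2
    have h4 := mh hFΩ
    rw [h3, mem_ball_zero_iff] at h4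
    rw [mem_sphere_zero_iff_norm] at hζ
    linarith
  refine ⟨F, hFc, hFd, hbij, ⟨hmaps, ?_, ?_⟩, ?_, ?_⟩
  · intro ζ₁ h₁ ζ₂ h₂ he
    by_contra hne
    obtain ⟨x, hx, hxe⟩ := hmaps h₁
    have hx1 : ‖x‖ = 1 := by simpa using hx
    have hp0 : F 0 ≠ F ζ₁ := by
      intro h0
      exact hdisj hx1 (hxe ▸ h0 ▸ hbij.mapsTo (mem_ball_self one_pos))
    let O : Set ℂ := {ξ | 0 < (ζ₁ * (starRingEnd ℂ) ξ).im ∧ (ζ₂ * (starRingEnd ℂ) ξ).im < 0}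
    have hcζ : ∀ ζ : ℂ, Continuous fun ξ : ℂ => (ζ * (starRingEnd ℂ) ξ).im := fun ζ =>
      Complex.continuous_im.comp (continuous_const.mul Complex.continuous_conj)
    have hO : IsOpen O := (isOpen_lt continuous_const (hcζ ζ₁)).inter
      (isOpen_lt (hcζ ζ₂) continuous_const)
    have hv : 0 < ‖ζ₁ - ζ₂‖ := by rwa [norm_pos_iff, sub_ne_zero]
    have hOne : (O ∩ sphere 0 1).Nonempty := by
      rw [mem_sphere_zero_iff_norm] at h₁ h₂
      have e1 : ζ₁.re ^ 2 + ζ₁.im ^ 2 = 1 := by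
        have := Complex.sq_norm ζ₁; rw [h₁, Complex.normSq_apply] at this; linarith
      have e2 : ζ₂.re ^ 2 + ζ₂.im ^ 2 = 1 := by
        have := Complex.sq_norm ζ₂; rw [h₂, Complex.normSq_apply] at this; linarith
      have e3 : 0 < (ζ₁.re - ζ₂.re) ^ 2 + (ζ₁.im - ζ₂.im) ^ 2 := by
        have := Complex.sq_norm (ζ₁ - ζ₂); rw [Complex.normSq_apply] at this
        simp only [Complex.sub_re, Complex.sub_im] at this
        nlinarith
      refine ⟨((‖ζ₁ - ζ₂‖⁻¹ : ℝ) : ℂ) * (-Complex.I * (ζ₁ - ζ₂)), ⟨?_, ?_⟩, ?_⟩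
      · have : (ζ₁ * (starRingEnd ℂ) (((‖ζ₁ - ζ₂‖⁻¹ : ℝ) : ℂ) * (-Complex.I * (ζ₁ - ζ₂)))).im
            = ‖ζ₁ - ζ₂‖⁻¹ * (1 - (ζ₁.re * ζ₂.re + ζ₁.im * ζ₂.im)) := by
          rw [← e1]
          simp [Complex.mul_im]; ring
        rw [this]
        exact mul_pos (inv_pos.2 hv) (by nlinarith)
      · have : (ζ₂ * (starRingEnd ℂ) (((‖ζ₁ - ζ₂‖⁻¹ : ℝ) : ℂ) * (-Complex.I * (ζ₁ - ζ₂)))).im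
            = -(‖ζ₁ - ζ₂‖⁻¹ * (1 - (ζ₁.re * ζ₂.re + ζ₁.im * ζ₂.im))) := by
          rw [← e2]
          simp [Complex.mul_im]; ring
        rw [this, neg_lt_zero]
        exact mul_pos (inv_pos.2 hv) (by nlinarith)
      · rw [mem_sphere_zero_iff_norm, norm_mul, norm_mul, norm_neg, Complex.norm_I, one_mul,
          Complex.norm_real, norm_inv, norm_norm, inv_mul_cancel₀ hv.ne']
    obtain ⟨ξ, ⟨hξO, hξ⟩, hξ1, hξ2⟩ := exists_ne_of_sector ⟨hFd, hcl ▸ hFc⟩ hp0 hO hOne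
    rw [mem_sphere_zero_iff_norm] at hξ
    have key : F ζ₁ ∈ F '' (closedBall 0 1 ∩ {z | (z * (starRingEnd ℂ) ξ).im = 0}) := by
      have hclosed : IsClosed (F '' (closedBall 0 1 ∩ {z | (z * (starRingEnd ℂ) ξ).im = 0})) :=
        ((hcb.inter_right (isClosed_eq (by fun_prop) continuous_const)).image_of_continuousOn
          (hFc.mono inter_subset_left)).isClosed
      have hcl2 := hclosed.preimage G.continuous
      rw [← hxe]
      refine (hcl2.closure_eq ▸ Metric.mem_closure_iff.2 fun ε hε => ?_ :
        x ∈ G ⁻¹' (F '' (closedBall 0 1 ∩ {z | (z * (starRingEnd ℂ) ξ).im = 0})))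
      have hcc : (𝓝[Ico (0 : ℝ) 1] 1).NeBot := by
        rw [← mem_closure_iff_nhdsWithin_neBot, closure_Ico zero_ne_one]; simp
      have htend : ∀ ζ ∈ sphere (0 : ℂ) 1, F ζ = F ζ₁ →
          ∀ᶠ t : ℝ in 𝓝[Ico (0 : ℝ) 1] 1, G.symm (F (t * ζ)) ∈ ball x ε := by
        intro ζ hζ hζe
        rw [mem_sphere_zero_iff_norm] at hζ
        have hc : ContinuousOn (fun t : ℝ => G.symm (F (t * ζ))) (Icc 0 1) := by
          refine G.symm.continuous.comp_continuousOn (hFc.comp (by fun_prop) fun t ht => ?_)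
          rw [mem_closedBall_zero_iff, norm_mul, hζ, mul_one, Complex.norm_real,
            Real.norm_of_nonneg ht.1]
          exact ht.2
        have := (hc 1 (by simp)).mono Ico_subset_Icc_self
        refine this (isOpen_ball.mem_nhds ?_)
        simpa [hζe, ← hxe] using hε
      obtain ⟨t, ⟨ha, hb⟩, ht⟩ :=
        (((htend ζ₁ h₁ rfl).and (htend ζ₂ h₂ he.symm)).and self_mem_nhdsWithin).exists
      have htz : ∀ ζ ∈ sphere (0 : ℂ) 1, (t : ℂ) * ζ ∈ ball (0 : ℂ) 1 := by
        intro ζ hζ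
        rw [mem_sphere_zero_iff_norm] at hζ
        rw [mem_ball_zero_iff, norm_mul, hζ, mul_one, Complex.norm_real,
            Real.norm_of_nonneg ht.1]
        exact ht.2
      have hGF : ∀ z ∈ ball (0 : ℂ) 1, G.symm (F z) ∈ ball (0 : ℂ) 1 := by
        intro z hz
        obtain ⟨w, hw, hwe⟩ := hbij.mapsTo hz
        rwa [← hwe, G.symm_apply_apply]
      set y : ℝ → ℂ := fun s => AffineMap.lineMap (k := ℝ) (G.symm (F (t * ζ₁))) (G.symm (F (t * ζ₂))) s with hy
      have hyb : ∀ s ∈ Icc (0 : ℝ) 1, y s ∈ ball (0 : ℂ) 1 := fun s hs =>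
        (convex_ball 0 1).lineMap_mem (hGF _ (htz _ h₁)) (hGF _ (htz _ h₂)) hs
      have hyx : ∀ s ∈ Icc (0 : ℝ) 1, y s ∈ ball x ε := fun s hs =>
        (convex_ball x ε).lineMap_mem ha hb hs
      have hyc : Continuous y := AffineMap.lineMap_continuous
      have hhF : ∀ z ∈ ball (0 : ℂ) 1, h (F z) = z := fun z hz => by rw [hFf hz, hi.1 hz]
      have hcont : ContinuousOn (fun s => (h (G (y s)) * (starRingEnd ℂ) ξ).im) (Icc 0 1) := by
        refine Complex.continuous_im.comp_continuousOn (ContinuousOn.mul ?_ continuousOn_const)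
        exact hh.continuousOn.comp (G.continuous.comp hyc).continuousOn
          fun s hs => mem_image_of_mem _ (hyb s hs)
      obtain ⟨s, hs, hse⟩ := intermediate_value_Icc' zero_le_one hcont (show (0 : ℝ) ∈ _ by
        constructor
        · simp only [hy, AffineMap.lineMap_apply_one, G.apply_symm_apply, hhF _ (htz _ h₂)]
          rw [mul_assoc, Complex.im_ofReal_mul]
          exact mul_nonpos_of_nonneg_of_nonpos ht.1 hξO.2.le
        · simp only [hy, AffineMap.lineMap_apply_zero, G.apply_symm_apply, hhF _ (htz _ h₁)]
          rw [mul_assoc, Complex.im_ofReal_mul]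
          exact mul_nonneg ht.1 hξO.1.le)
      have hGy : G (y s) ∈ G '' ball 0 1 := mem_image_of_mem _ (hyb s hs)
      refine ⟨y s, ⟨h (G (y s)), ⟨ball_subset_closedBall (mh hGy), hse⟩, ?_⟩, ?_⟩
      · rw [hFf (mh hGy), hi.2 hGy]
      · rw [dist_comm]; exact hyx s hs
    obtain ⟨z, ⟨hz1, hz2⟩, hze⟩ := key
    have hzs : ‖z‖ = 1 := by
      have := (hcbs z hz1).resolve_left fun hzb => hdisj hx1 (hxe ▸ hze ▸ hbij.mapsTo hzb)
      simpa using this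
    have hzz : z * (starRingEnd ℂ) ξ = ((z * (starRingEnd ℂ) ξ).re : ℂ) :=
      Complex.ext (by simp) (by simpa using hz2)
    have hnn : |(z * (starRingEnd ℂ) ξ).re| = 1 := by
      rw [← Real.norm_eq_abs, ← Complex.norm_real, ← hzz, norm_mul, hzs, Complex.norm_conj, hξ,
        one_mul]
    have hz' : z = z * (starRingEnd ℂ) ξ * ξ := by
      rw [mul_assoc, mul_comm _ ξ, Complex.mul_conj, Complex.normSq_eq_norm_sq, hξ]; simp
    rw [hzz] at hz'
    rcases eq_or_eq_neg_of_abs_eq hnn with h1 | h1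
    · rw [h1] at hz'
      exact hξ1 (by rw [← hze, hz']; simp)
    · rw [h1] at hz'
      exact hξ2 (by rw [← hze, hz']; simp)
  · intro y hy
    have h1 : G '' closedBall 0 1 ⊆ F '' closedBall 0 1 := by
      rw [← hcl, G.image_closure, hcl]
      exact closure_minimal (hbij.image_eq ▸ image_mono ball_subset_closedBall)
        (hcb.image_of_continuousOn hFc).isClosed
    obtain ⟨z, hz, hze⟩ := h1 (image_mono sphere_subset_closedBall hy)
    obtain ⟨x, hx, hxe⟩ := hy
    refine ⟨z, (hcbs z hz).resolve_left fun hzb => ?_, hze⟩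
    exact hdisj (by simpa using hx) (hxe ▸ hze ▸ hbij.mapsTo hzb)
  · rw [hFf (mem_ball_self one_pos), hf0]
  · rwa [(hFf.eventuallyEq_of_mem (ball_mem_nhds 0 one_pos)).deriv_eq]

end Annulus

namespace Annulus

open Set Metric Filter Topology MeasureTheory
open scoped ENNReal NNReal Real

theorem approximatesLinearOn_refl {f : ℂ → ℂ} {s : Set ℂ}
    (h : ∀ x ∈ s, ∀ y ∈ s, ‖f x - f y - (x - y)‖ ≤ 1 / 2 * ‖x - y‖) :
    ApproximatesLinearOn f (ContinuousLinearEquiv.refl ℝ ℂ : ℂ →L[ℝ] ℂ) s 2⁻¹ := by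
  refine LipschitzOnWith.approximatesLinearOn (LipschitzOnWith.of_dist_le_mul fun x hx y hy => ?_)
  have := h x hx y hy
  rw [dist_eq_norm, dist_eq_norm]
  simpa [sub_sub_sub_comm] using this

theorem half_lt_inv_nnnorm_refl :
    (2⁻¹ : ℝ≥0) < ‖((ContinuousLinearEquiv.refl ℝ ℂ).symm : ℂ →L[ℝ] ℂ)‖₊⁻¹ := by
  have : ‖((ContinuousLinearEquiv.refl ℝ ℂ).symm : ℂ →L[ℝ] ℂ)‖₊ = 1 := by
    apply NNReal.eq
    simp
  rw [this, inv_one]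
  exact inv_lt_one_of_one_lt₀ (by norm_num)

theorem injOn_of_near_id {f : ℂ → ℂ} {s : Set ℂ}
    (h : ∀ x ∈ s, ∀ y ∈ s, ‖f x - f y - (x - y)‖ ≤ 1 / 2 * ‖x - y‖) : InjOn f s :=
  (approximatesLinearOn_refl h).injOn (Or.inr half_lt_inv_nnnorm_refl)

theorem isOpen_image_of_near_id {f : ℂ → ℂ} {s : Set ℂ} (hs : IsOpen s)
    (h : ∀ x ∈ s, ∀ y ∈ s, ‖f x - f y - (x - y)‖ ≤ 1 / 2 * ‖x - y‖) : IsOpen (f '' s) :=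
  ((approximatesLinearOn_refl h).toOpenPartialHomeomorph f s
    (Or.inr half_lt_inv_nnnorm_refl) hs).open_target

theorem image_ball_subset {u v : ℂ → ℂ} {R : ℝ} (hR : 0 < R)
    (hu : ContinuousOn u (closedBall 0 R)) (hv : ContinuousOn v (closedBall 0 R))
    (hvi : InjOn v (closedBall 0 R)) (huo : IsOpen (u '' ball 0 R))
    (h0 : u 0 = v 0)
    (he : EqOn u v (sphere 0 R)) : v '' ball 0 R ⊆ u '' ball 0 R := by
  have hc : IsPreconnected (v '' ball 0 R) :=
    (convex_ball (0 : ℂ) R).isPreconnected.image _ (hv.mono ball_subset_closedBall)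
  have hcl : IsClosed (u '' closedBall 0 R) :=
    ((isCompact_closedBall _ _).image_of_continuousOn hu).isClosed
  have hsp : ∀ z ∈ closedBall (0 : ℂ) R, u z ∈ v '' ball 0 R → z ∈ ball (0 : ℂ) R := by
    rintro z hz ⟨w, hw, hwe⟩
    rcases (mem_closedBall.1 hz).lt_or_eq with h | h
    · exact h
    · have h' : z ∈ sphere (0 : ℂ) R := h
      rw [he h'] at hwe
      rwa [← hvi (ball_subset_closedBall hw) hz hwe]
  rintro x hx
  by_contra hxu
  obtain ⟨y, hy, hy1, hy2⟩ := hc (u '' ball 0 R) (u '' closedBall 0 R)ᶜ huo hcl.isOpen_compl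
    (fun y hy => by
      by_cases hyu : y ∈ u '' closedBall 0 R
      · obtain ⟨z, hz, rfl⟩ := hyu
        exact Or.inl ⟨z, hsp z hz hy, rfl⟩
      · exact Or.inr hyu)
    ⟨v 0, ⟨0, mem_ball_self hR, rfl⟩, ⟨0, mem_ball_self hR, h0⟩⟩
    ⟨x, hx, by
      rintro ⟨z, hz, rfl⟩
      exact hxu ⟨z, hsp z hz hx, rfl⟩⟩
  exact hy2 (image_mono ball_subset_closedBall hy1)

/-- A map which is `C¹`-close to the identity near `0` can be made equal to the identity near
`0` without changing it away from `0`. -/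
theorem exists_modify_near_zero {f : ℂ → ℂ} {r : ℝ} (hr : 0 < r)
    (hf : ∀ x ∈ ball (0 : ℂ) r, ∀ y ∈ ball (0 : ℂ) r, ‖f x - f y - (x - y)‖ ≤ 1 / 10 * ‖x - y‖)
    (hf0 : f 0 = 0) {s : Set ℂ} (hs : ball 0 r ⊆ s) (hc : ContinuousOn f s) (hi : InjOn f s) :
    ∃ ψ : ℂ → ℂ, ContinuousOn ψ s ∧ BijOn ψ s (f '' s) ∧ (∀ z, r ≤ ‖z‖ → ψ z = f z) ∧
      ∃ ε > 0, ∀ z, ‖z‖ ≤ ε → ψ z = z := by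
  let ω : ℝ → ℝ := fun t => max 0 (min 1 (4 * t / r - 1))
  have hω0 : ∀ t, 0 ≤ ω t := fun t => le_max_left _ _
  have hω1 : ∀ t, ω t ≤ 1 := fun t => max_le zero_le_one (min_le_left _ _)
  have hωL : ∀ s t, |ω s - ω t| ≤ 4 / r * |s - t| := by
    intro s t
    calc |ω s - ω t| ≤ |min 1 (4 * s / r - 1) - min 1 (4 * t / r - 1)| := by
          simpa [max_comm] using abs_max_sub_max_le_abs (min 1 (4 * s / r - 1)) (min 1 (4 * t / r - 1)) 0
      _ ≤ |(4 * s / r - 1) - (4 * t / r - 1)| := by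
          simpa [min_comm] using abs_min_sub_min_le_max (4 * s / r - 1) 1 (4 * t / r - 1) 1
      _ = 4 / r * |s - t| := by
          rw [show 4 * s / r - 1 - (4 * t / r - 1) = 4 / r * (s - t) by ring, abs_mul,
            abs_of_pos (show 0 < 4 / r by positivity)]
  have hωs : ∀ t, t ≤ r / 4 → ω t = 0 := by
    intro t ht
    have : 4 * t / r ≤ 1 := by rw [div_le_one hr]; linarith
    exact max_eq_left ((min_le_right _ _).trans (by linarith))
  have hωb : ∀ t, r / 2 ≤ t → ω t = 1 := by
    intro t ht
    have : 2 ≤ 4 * t / r := by rw [le_div_iff₀ hr]; linarith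
    simp only [ω]
    rw [min_eq_left (by linarith), max_eq_right zero_le_one]
  let ψ : ℂ → ℂ := fun z => z + (ω ‖z‖ : ℂ) * (f z - z)
  have hψf : ∀ z, r / 2 ≤ ‖z‖ → ψ z = f z := by
    intro z hz
    simp only [ψ, hωb _ hz]; push_cast; ring
  have hψc : ContinuousOn ψ s := by
    have : Continuous fun z : ℂ => (ω ‖z‖ : ℂ) := by simp only [ω]; fun_prop
    exact continuousOn_id.add (this.continuousOn.mul (hc.sub continuousOn_id))
  have hψe : ∀ x ∈ ball (0 : ℂ) r, ∀ y ∈ ball (0 : ℂ) r,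
      ‖ψ x - ψ y - (x - y)‖ ≤ 1 / 2 * ‖x - y‖ := by
    intro x hx y hy
    have e1 := hf x hx y hy
    have e2 := hf y hy 0 (mem_ball_self hr)
    rw [hf0, sub_zero, sub_zero] at e2
    rw [mem_ball_zero_iff] at hy
    have : ψ x - ψ y - (x - y) = (ω ‖x‖ : ℂ) * (f x - f y - (x - y))
        + ((ω ‖x‖ - ω ‖y‖ : ℝ) : ℂ) * (f y - y) := by
      simp only [ψ]; push_cast; ring
    rw [this]
    refine (norm_add_le _ _).trans ?_
    rw [norm_mul, norm_mul, Complex.norm_real, Complex.norm_real, Real.norm_of_nonneg (hω0 _),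
      Real.norm_eq_abs]
    have e3 : |ω ‖x‖ - ω ‖y‖| ≤ 4 / r * ‖x - y‖ :=
      (hωL _ _).trans (mul_le_mul_of_nonneg_left (abs_norm_sub_norm_le x y) (by positivity))
    have e4 : |ω ‖x‖ - ω ‖y‖| * ‖f y - y‖ ≤ 4 / r * ‖x - y‖ * (1 / 10 * r) :=
      mul_le_mul e3 (e2.trans (by linarith)) (norm_nonneg _) (by positivity)
    have e5 : 4 / r * ‖x - y‖ * (1 / 10 * r) = 4 / 10 * ‖x - y‖ := by field_simp
    have e6 : ω ‖x‖ * ‖f x - f y - (x - y)‖ ≤ 1 * (1 / 10 * ‖x - y‖) :=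
      mul_le_mul (hω1 _) e1 (norm_nonneg _) zero_le_one
    linarith
  have hfe : ∀ x ∈ ball (0 : ℂ) r, ∀ y ∈ ball (0 : ℂ) r,
      ‖f x - f y - (x - y)‖ ≤ 1 / 2 * ‖x - y‖ := fun x hx y hy =>
    (hf x hx y hy).trans (by gcongr; norm_num)
  set R := 3 * r / 4 with hRdef
  have hR : 0 < R := by positivity
  have hRr : closedBall (0 : ℂ) R ⊆ ball 0 r := closedBall_subset_ball (by linarith)
  have hRr' : ball (0 : ℂ) R ⊆ ball 0 r := ball_subset_closedBall.trans hRr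
  have hsp : EqOn ψ f (sphere 0 R) := fun z hz => hψf z (by
    rw [mem_sphere_zero_iff_norm] at hz; linarith)
  have hψ0 : ψ 0 = f 0 := by simp [ψ, hf0]
  have himg : ψ '' ball 0 R = f '' ball 0 R := by
    apply Subset.antisymm
    · exact image_ball_subset hR (hc.mono (hRr.trans hs)) (hψc.mono (hRr.trans hs))
        ((injOn_of_near_id hψe).mono hRr) (isOpen_image_of_near_id isOpen_ball
          fun x hx y hy => hfe x (hRr' hx) y (hRr' hy)) hψ0.symm hsp.symm
    · exact image_ball_subset hR (hψc.mono (hRr.trans hs)) (hc.mono (hRr.trans hs))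
        (hi.mono (hRr.trans hs)) (isOpen_image_of_near_id isOpen_ball
          fun x hx y hy => hψe x (hRr' hx) y (hRr' hy)) hψ0 hsp
  have hb1 : BijOn ψ (ball 0 R) (f '' ball 0 R) := by
    rw [← himg]; exact ((injOn_of_near_id hψe).mono hRr').bijOn_image
  have hb2 : BijOn ψ (s \ ball 0 R) (f '' (s \ ball 0 R)) :=
    ((hi.mono sdiff_subset).bijOn_image).congr fun z hz => (hψf z (by
      have := hz.2; rw [mem_ball_zero_iff, not_lt] at this; linarith)).symm
  have hRs : ball 0 R ⊆ s := hRr'.trans hs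
  have hdisj : Disjoint (f '' ball 0 R) (f '' (s \ ball 0 R)) := by
    rw [Set.disjoint_left]
    rintro _ ⟨x, hx, rfl⟩ ⟨y, hy, he⟩
    exact hy.2 (hi hy.1 (hRs hx) he ▸ hx)
  refine ⟨ψ, hψc, ?_, fun z hz => hψf z (by linarith), r / 4, by positivity, fun z hz => ?_⟩
  · have := hb1.union hb2 ((injOn_union disjoint_sdiff_right).2 ⟨hb1.injOn, hb2.injOn, ?_⟩)
    · rwa [← image_union, union_sdiff_cancel hRs] at this
    · intro x hx y hy he
      exact hdisj.ne_of_mem (hb1.mapsTo hx) (hb2.mapsTo hy) he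
  · simp [ψ, hωs _ hz]

end Annulus

namespace Annulus

open Set Metric Filter Topology MeasureTheory
open scoped ENNReal NNReal Real

/-- A homeomorphic image of the closed disc is parametrised by the closed disc through a map which
is linear near the origin. -/
theorem exists_parametrization_linear (G : ℂ ≃ₜ ℂ) (hG : G 0 = 0) :
    ∃ (F : ℂ → ℂ) (a : ℂ), a ≠ 0 ∧ ContinuousOn F (closedBall 0 1) ∧
      BijOn F (closedBall 0 1) (G '' closedBall 0 1) ∧
      BijOn F (sphere 0 1) (G '' sphere 0 1) ∧ ∃ ε > 0, ∀ z, ‖z‖ ≤ ε → F z = a * z := by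
  obtain ⟨F, hFc, hFd, hb, hbs, hF0, ha⟩ := exists_caratheodory G hG
  set a := deriv F 0 with ha'
  have hbc : BijOn F (closedBall 0 1) (G '' closedBall 0 1) := by
    rw [← ball_union_sphere, image_union]
    refine hb.union hbs ((injOn_union ?_).2 ⟨hb.injOn, hbs.injOn, ?_⟩)
    · exact sphere_disjoint_ball.symm
    · intro x hx y hy he
      refine Disjoint.ne_of_mem ?_ (hb.mapsTo hx) (hbs.mapsTo hy) he
      exact (disjoint_image_iff G.injective).2 sphere_disjoint_ball.symm
  have hstrict : HasStrictDerivAt F a 0 :=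
    (hFd.analyticAt (ball_mem_nhds 0 one_pos)).hasStrictDerivAt
  have hη : (0 : ℝ) < ‖a‖ / 10 := by positivity
  have hlo := hstrict.hasStrictFDerivAt.isLittleO.bound hη
  rw [nhds_prod_eq] at hlo
  obtain ⟨t, ht, htl⟩ : ∃ t ∈ 𝓝 (0 : ℂ), ∀ x ∈ t, ∀ y ∈ t,
      ‖F x - F y - (x - y) • a‖ ≤ ‖a‖ / 10 * ‖x - y‖ := by
    simpa using Filter.eventually_prod_self_iff'.1 hlo
  obtain ⟨r₀, hr₀, hrt⟩ := Metric.mem_nhds_iff.1 ht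
  set r := min r₀ 1 with hr
  have hr0 : 0 < r := lt_min hr₀ one_pos
  obtain ⟨ψ, hψc, hψb, hψe, ε, hε, hψi⟩ := exists_modify_near_zero (f := fun z => a⁻¹ * F z)
    (s := closedBall 0 1) hr0 (fun x hx y hy => by
      have := htl x (hrt (ball_subset_ball (min_le_left _ _) hx)) y
        (hrt (ball_subset_ball (min_le_left _ _) hy))
      have e : a⁻¹ * F x - a⁻¹ * F y - (x - y) = a⁻¹ * (F x - F y - (x - y) • a) := by
        rw [smul_eq_mul]; field_simp
      rw [e, norm_mul, norm_inv, inv_mul_le_iff₀ (norm_pos_iff.2 ha)]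
      refine this.trans (le_of_eq ?_)
      ring) (by simp [hF0])
      ((ball_subset_ball (min_le_right _ _)).trans ball_subset_closedBall)
      (continuousOn_const.mul hFc) (fun x hx y hy he => hbc.injOn hx hy (by
        simpa [ha] using he))
  have haψ : ∀ z, r ≤ ‖z‖ → a * ψ z = F z := fun z hz => by
    rw [hψe z hz, mul_inv_cancel_left₀ ha]
  refine ⟨fun z => a * ψ z, a, ha, continuousOn_const.mul hψc, ?_, ?_, ε, hε, fun z hz => by
    simp only [hψi z hz]⟩
  · have h1 : BijOn (fun z => a * z) ((fun z => a⁻¹ * F z) '' closedBall 0 1)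
        (G '' closedBall 0 1) := by
      have := ((mul_right_injective₀ ha).injOn
        (s := (fun z => a⁻¹ * F z) '' closedBall 0 1)).bijOn_image
      rw [image_image] at this
      simpa only [mul_inv_cancel_left₀ ha, hbc.image_eq] using this
    exact h1.comp hψb
  · refine hbs.congr fun z hz => (haψ z ?_).symm
    rw [mem_sphere_zero_iff_norm] at hz
    rw [hz]; exact min_le_right _ _

end Annulus

namespace Annulus

open Set Metric Filter Topology

/-- Polar coordinates on the punctured plane. -/
noncomputable def polar : (Circle × ℝ) ≃ₜ {z : ℂ // z ≠ 0} where
  toFun p := ⟨Real.exp p.2 * p.1, mul_ne_zero (by simp) p.1.coe_ne_zero⟩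
  invFun z := (⟨(z : ℂ) / ‖(z : ℂ)‖, by
    have : ‖(z : ℂ)‖ ≠ 0 := norm_ne_zero_iff.2 z.2
    simp [Submonoid.unitSphere, this]⟩, Real.log ‖(z : ℂ)‖)
  left_inv p := by
    have h : ‖((Real.exp p.2 : ℂ)) * p.1‖ = Real.exp p.2 := by
      rw [norm_mul, Circle.norm_coe, mul_one, Complex.norm_real, Real.norm_eq_abs, Real.abs_exp]
    refine Prod.ext (Circle.ext ?_) ?_
    · show (Real.exp p.2 * p.1 : ℂ) / ‖(Real.exp p.2 * p.1 : ℂ)‖ = p.1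
      rw [h, mul_div_assoc, mul_div_cancel₀]
      simp
    · show Real.log ‖(Real.exp p.2 * p.1 : ℂ)‖ = p.2
      rw [h, Real.log_exp]
  right_inv z := by
    have : (‖(z : ℂ)‖ : ℂ) ≠ 0 := by simpa using z.2
    refine Subtype.ext ?_
    show (Real.exp (Real.log ‖(z : ℂ)‖) : ℂ) * ((z : ℂ) / ‖(z : ℂ)‖) = z
    rw [Real.exp_log (norm_pos_iff.2 z.2), mul_div_cancel₀ _ this]
  continuous_toFun := by
    refine Continuous.subtype_mk ?_ _
    exact (Complex.continuous_ofReal.comp (Real.continuous_exp.comp continuous_snd)).mul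
      (continuous_subtype_val.comp continuous_fst)
  continuous_invFun := by
    refine Continuous.prodMk (Continuous.subtype_mk ?_ _) ?_
    · exact continuous_subtype_val.div (by fun_prop) fun z => by simpa using z.2
    · exact Real.continuousOn_log.comp_continuous (by fun_prop) fun z => by simpa using z.2

theorem norm_polar (p : Circle × ℝ) : ‖(polar p : ℂ)‖ = Real.exp p.2 := by
  show ‖(Real.exp p.2 * p.1 : ℂ)‖ = _
  rw [norm_mul, Circle.norm_coe, mul_one, Complex.norm_real, Real.norm_eq_abs, Real.abs_exp]

theorem coe_polar (p : Circle × ℝ) : (polar p : ℂ) = Real.exp p.2 * p.1 := rfl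

theorem polar_ne_zero (p : Circle × ℝ) : (polar p : ℂ) ≠ 0 := (polar p).2

/-- A self-homeomorphism of the annulus preserves the ends if it maps each end to itself. -/
def PreservesEnds (g : (Circle × ℝ) ≃ₜ (Circle × ℝ)) : Prop :=
  (∀ N : ℝ, ∃ M : ℝ, ∀ p, p.2 ≤ M → (g p).2 ≤ N) ∧ ∀ N : ℝ, ∃ M : ℝ, ∀ p, M ≤ p.2 → N ≤ (g p).2

theorem isCompact_band (a b : ℝ) : IsCompact {p : Circle × ℝ | a ≤ p.2 ∧ p.2 ≤ b} := by
  have : {p : Circle × ℝ | a ≤ p.2 ∧ p.2 ≤ b} = univ ×ˢ Icc a b := by ext; simp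
  rw [this]
  exact isCompact_univ.prod isCompact_Icc

theorem exists_bound_of_isCompact {K : Set (Circle × ℝ)} (hK : IsCompact K) :
    ∃ A : ℝ, ∀ p ∈ K, |p.2| ≤ A := by
  obtain ⟨A, hA⟩ := (hK.image continuous_snd).isBounded.exists_norm_le
  exact ⟨A, fun p hp => hA _ (mem_image_of_mem _ hp)⟩

theorem PreservesEnds.symm {g : (Circle × ℝ) ≃ₜ (Circle × ℝ)} (hg : PreservesEnds g) :
    PreservesEnds g.symm := by
  constructor
  · intro N
    obtain ⟨M, hM⟩ := hg.2 0
    obtain ⟨A, hA⟩ := exists_bound_of_isCompact ((isCompact_band N M).image g.continuous)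
    refine ⟨min (-1) (-A - 1), fun p hp => ?_⟩
    by_contra! hlt
    have h1 := hp.trans (min_le_left _ _)
    have h2 := hp.trans (min_le_right _ _)
    rcases le_total M (g.symm p).2 with h | h
    · have := hM _ h; rw [g.apply_symm_apply] at this; linarith
    · have := hA (g (g.symm p)) (mem_image_of_mem _ ⟨hlt.le, h⟩)
      rw [g.apply_symm_apply, abs_le] at this; linarith
  · intro N
    obtain ⟨M, hM⟩ := hg.1 0
    obtain ⟨A, hA⟩ := exists_bound_of_isCompact ((isCompact_band M N).image g.continuous)
    refine ⟨max 1 (A + 1), fun p hp => ?_⟩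
    by_contra! hlt
    have h1 := (le_max_left _ _).trans hp
    have h2 := (le_max_right _ _).trans hp
    rcases le_total (g.symm p).2 M with h | h
    · have := hM _ h; rw [g.apply_symm_apply] at this; linarith
    · have := hA (g (g.symm p)) (mem_image_of_mem _ ⟨h, hlt.le⟩)
      rw [g.apply_symm_apply, abs_le] at this; linarith

theorem PreservesEnds.trans {g h : (Circle × ℝ) ≃ₜ (Circle × ℝ)} (hg : PreservesEnds g)
    (hh : PreservesEnds h) : PreservesEnds (g.trans h) := by
  constructor
  · intro N
    obtain ⟨M, hM⟩ := hh.1 N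
    obtain ⟨M', hM'⟩ := hg.1 M
    exact ⟨M', fun p hp => hM _ (hM' p hp)⟩
  · intro N
    obtain ⟨M, hM⟩ := hh.2 N
    obtain ⟨M', hM'⟩ := hg.2 M
    exact ⟨M', fun p hp => hM _ (hM' p hp)⟩

open Classical in
/-- The map of the plane fixing the origin induced by a map of the annulus. -/
noncomputable def planeMap (g : (Circle × ℝ) → (Circle × ℝ)) (z : ℂ) : ℂ :=
  if h : z ≠ 0 then polar (g (polar.symm ⟨z, h⟩)) else 0

theorem planeMap_zero (g : (Circle × ℝ) → (Circle × ℝ)) : planeMap g 0 = 0 := by simp [planeMap]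

theorem planeMap_polar (g : (Circle × ℝ) → (Circle × ℝ)) (p : Circle × ℝ) :
    planeMap g (polar p) = polar (g p) := by simp [planeMap, polar_ne_zero]

theorem exists_polar_eq {z : ℂ} (hz : z ≠ 0) : ∃ p, (polar p : ℂ) = z :=
  ⟨polar.symm ⟨z, hz⟩, by simp⟩

theorem continuous_planeMap {g : (Circle × ℝ) ≃ₜ (Circle × ℝ)} (hg : PreservesEnds g) :
    Continuous (planeMap g) := by
  rw [continuous_iff_continuousAt]
  intro z
  by_cases hz : z = 0
  · subst hz
    rw [Metric.continuousAt_iff]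
    intro ε hε
    obtain ⟨M, hM⟩ := hg.1 (Real.log (ε / 2))
    refine ⟨Real.exp M, Real.exp_pos _, fun {w} hw => ?_⟩
    rw [planeMap_zero, dist_zero_right]
    by_cases hw0 : w = 0
    · rw [hw0, planeMap_zero, norm_zero]; exact hε
    · obtain ⟨p, rfl⟩ := exists_polar_eq hw0
      rw [dist_zero_right, norm_polar, Real.exp_lt_exp] at hw
      rw [planeMap_polar, norm_polar]
      calc Real.exp (g p).2 ≤ Real.exp (Real.log (ε / 2)) := Real.exp_le_exp.2 (hM p hw.le)
        _ = ε / 2 := Real.exp_log (by positivity)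
        _ < ε := by linarith
  · have ho : IsOpen {z : ℂ | z ≠ 0} := isOpen_ne
    refine ContinuousOn.continuousAt ?_ (ho.mem_nhds hz)
    rw [continuousOn_iff_continuous_domRestrict]
    have : Set.domRestrict {z : ℂ | z ≠ 0} (planeMap g) =
        fun z : {z : ℂ // z ≠ 0} => (polar (g (polar.symm z)) : ℂ) := by
      ext z
      obtain ⟨z, hz⟩ := z
      simp only [domRestrict_apply, planeMap]
      exact dif_pos (show z ≠ 0 from hz)
    rw [this]
    exact continuous_subtype_val.comp (polar.continuous.comp (g.continuous.comp
      polar.symm.continuous))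

theorem planeMap_planeMap {g h : (Circle × ℝ) → (Circle × ℝ)} (hgh : ∀ p, g (h p) = p) (z : ℂ) :
    planeMap g (planeMap h z) = z := by
  by_cases hz : z = 0
  · rw [hz, planeMap_zero, planeMap_zero]
  · obtain ⟨p, rfl⟩ := exists_polar_eq hz
    rw [planeMap_polar, planeMap_polar, hgh]

/-- An end-preserving homeomorphism of the annulus induces a homeomorphism of the plane. -/
noncomputable def planeHomeomorph {g : (Circle × ℝ) ≃ₜ (Circle × ℝ)} (hg : PreservesEnds g) :
    ℂ ≃ₜ ℂ where
  toFun := planeMap g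
  invFun := planeMap g.symm
  left_inv := planeMap_planeMap g.symm_apply_apply
  right_inv := planeMap_planeMap g.apply_symm_apply
  continuous_toFun := continuous_planeMap hg
  continuous_invFun := continuous_planeMap hg.symm

end Annulus

namespace Annulus

open Set Metric Filter Topology
open scoped Real

theorem exists_homeomorph_of_bijective {f : (Circle × ℝ) → (Circle × ℝ)} (hc : Continuous f)
    (hb : Function.Bijective f)
    (hK : ∀ K : Set (Circle × ℝ), IsCompact K → ∃ K', IsCompact K' ∧ f ⁻¹' K ⊆ K') :
    ∃ h : (Circle × ℝ) ≃ₜ (Circle × ℝ), ⇑h = f := by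
  have hp : IsProperMap f := isProperMap_iff_isCompact_preimage.2 ⟨hc, fun K h => by
    obtain ⟨K', hK', hsub⟩ := hK K h
    exact hK'.of_isClosed_subset (h.isClosed.preimage hc) hsub⟩
  exact ⟨(Equiv.ofBijective f hb).toHomeomorphOfIsInducing
    (IsClosedEmbedding.of_continuous_injective_isClosedMap hc hb.1 hp.isClosedMap).isInducing, rfl⟩

theorem exists_homeomorph_of_strictMono {f : ℝ → ℝ} (hm : StrictMono f)
    (hs : Function.Surjective f) : ∃ e : ℝ ≃ₜ ℝ, ⇑e = f :=
  ⟨(hm.orderIsoOfSurjective f hs).toHomeomorph, rfl⟩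

theorem surjective_of_dist_le {f : ℝ → ℝ} (hc : Continuous f) {C : ℝ} (h : ∀ t, |f t - t| ≤ C) :
    Function.Surjective f := by
  refine hc.surjective ?_ ?_
  · refine tendsto_atTop_mono (f := fun t => t - C) (fun t => ?_)
      (tendsto_atTop_add_const_right _ _ tendsto_id)
    linarith [(abs_le.1 (h t)).1]
  · refine tendsto_atBot_mono (f := fun t => t + C) (fun t => ?_)
      (tendsto_atBot_add_const_right _ _ tendsto_id)
    linarith [(abs_le.1 (h t)).2]

theorem exists_int_of_exp_eq {f g : ℝ → ℝ} (hf : Continuous f) (hg : Continuous g)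
    (h : ∀ x, Circle.exp (f x) = Circle.exp (g x)) :
    ∃ m : ℤ, ∀ x, f x = g x + m * (2 * π) := by
  obtain ⟨m, hm⟩ := Circle.exp_eq_exp.1 (h 0)
  refine ⟨m, fun x => congrFun (Circle.isCoveringMap_exp.eq_of_comp_eq hf
    (show Continuous fun x => g x + m * (2 * π) by fun_prop) (funext fun y => ?_) 0 hm) x⟩
  simp only [Function.comp]
  rw [h y]
  exact Circle.exp_eq_exp.2 ⟨-m, by push_cast; ring⟩

theorem exists_lift (χ : C(Circle, Circle)) :
    ∃ X : ℝ → ℝ, Continuous X ∧ ∀ x, Circle.exp (X x) = χ (Circle.exp x) := by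
  obtain ⟨e, he⟩ := Circle.exp_surjective (χ (Circle.exp 0))
  obtain ⟨X, ⟨-, hX⟩, -⟩ := Circle.isCoveringMap_exp.existsUnique_continuousMap_lifts
    (χ.comp Circle.exp) 0 e he
  exact ⟨X, X.continuous, fun x => congrFun hX x⟩

theorem strictMono_or_strictAnti_lift (χ : Circle ≃ₜ Circle) {X : ℝ → ℝ} (hc : Continuous X)
    (hX : ∀ x, Circle.exp (X x) = χ (Circle.exp x)) : StrictMono X ∨ StrictAnti X := by
  obtain ⟨Y, hYc, hY⟩ := exists_lift (χ.symm : C(Circle, Circle))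
  obtain ⟨m, hm⟩ := exists_int_of_exp_eq (hYc.comp hc) continuous_id fun x => by
    simp [hY, hX]
  refine hc.strictMono_of_inj fun x y hxy => ?_
  have h1 := hm x
  have h2 := hm y
  simp only [Function.comp, id, hxy] at h1 h2
  linarith

theorem lift_add_two_pi (χ : Circle ≃ₜ Circle) {X : ℝ → ℝ} (hc : Continuous X)
    (hX : ∀ x, Circle.exp (X x) = χ (Circle.exp x)) (hm : StrictMono X) (x : ℝ) :
    X (x + 2 * π) = X x + 2 * π := by
  obtain ⟨k, hk⟩ := exists_int_of_exp_eq (f := fun x => X (x + 2 * π)) (by fun_prop) hc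
    fun x => by rw [hX, hX, Circle.exp_add_two_pi]
  have hpi := Real.pi_pos
  have h0 := hm (show x < x + 2 * π by linarith)
  have hkx := hk x
  have hk0 : 0 < k := by
    have : (0 : ℝ) < k := by
      by_contra! h
      nlinarith
    exact_mod_cast this
  have hk1 : k < 2 := by
    by_contra! h
    have h2 : (2 : ℝ) ≤ k := by exact_mod_cast h
    obtain ⟨y, hy, hye⟩ := intermediate_value_Ioo (show x ≤ x + 2 * π by linarith)
      hc.continuousOn (show X x + 2 * π ∈ Ioo (X x) (X (x + 2 * π)) by
        constructor
        · linarith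
        · rw [hkx]; nlinarith)
    have h3 : Circle.exp y = Circle.exp x := χ.injective (by
      rw [← hX, ← hX, hye, Circle.exp_add_two_pi])
    obtain ⟨j, hj⟩ := Circle.exp_eq_exp.1 h3
    have hj0 : 0 < j := by
      have : (0 : ℝ) < j := by
        by_contra! h
        nlinarith [hy.1]
      exact_mod_cast this
    have hj1 : j < 1 := by
      have : (j : ℝ) < 1 := by
        by_contra! h
        nlinarith [hy.2]
      exact_mod_cast this
    omega
  have : k = 1 := by omega
  rw [hkx, this]; simp

/-- The reflection of the annulus reversing the circle factor. -/
noncomputable def circleFlip : (Circle × ℝ) ≃ₜ (Circle × ℝ) :=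
  (Homeomorph.inv Circle).prodCongr (Homeomorph.refl ℝ)

@[simp] theorem circleFlip_apply (p : Circle × ℝ) : circleFlip p = (p.1⁻¹, p.2) := rfl

theorem exists_isotopy_of_strictMono (χ : Circle ≃ₜ Circle) {X : ℝ → ℝ} (hc : Continuous X)
    (hX : ∀ x, Circle.exp (X x) = χ (Circle.exp x)) (hm : StrictMono X) (β s : ℝ) :
    ∃ (Θ : (Circle × ℝ) ≃ₜ (Circle × ℝ)) (N : ℝ), (∀ θ, Θ (θ, 0) = (χ θ, 0)) ∧
      (∀ p, (Θ p).2 ≤ 0 ↔ p.2 ≤ 0) ∧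
      ∀ p, p.2 ≤ N → Θ p = (p.1 * Circle.exp β, p.2 + s) := by
  have hper : Function.Periodic (fun x => X x - x) (2 * π) := fun x => by
    simp only [lift_add_two_pi χ hc hX hm]; ring
  let D : Circle → ℝ := fun θ => X (Complex.arg θ) - Complex.arg θ
  have hD : ∀ x, D (Circle.exp x) = X x - x := by
    intro x
    obtain ⟨m, hm⟩ := Circle.exp_eq_exp.1 (Circle.exp_arg (Circle.exp x))
    simp only [D]
    rw [hm]
    exact hper.int_mul m x
  have hDc : Continuous D := by
    rw [(Circle.isCoveringMap_exp.isQuotientMap Circle.exp_surjective).continuous_iff]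
    have : D ∘ Circle.exp = fun x => X x - x := funext hD
    rw [this]; fun_prop
  set L := |s| + 1 with hL
  have hL0 : 0 < L := by positivity
  let κ : ℝ → ℝ := fun t => max 0 (min 1 (-t / L))
  have hκ0 : ∀ t, 0 ≤ κ t := fun t => le_max_left _ _
  have hκ1 : ∀ t, κ t ≤ 1 := fun t => max_le zero_le_one (min_le_left _ _)
  have hκc : Continuous κ := by simp only [κ]; fun_prop
  have hκp : ∀ t, 0 ≤ t → κ t = 0 := fun t ht =>
    max_eq_left ((min_le_right _ _).trans (div_nonpos_of_nonpos_of_nonneg (by linarith) hL0.le))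
  have hκn : ∀ t, t ≤ -L → κ t = 1 := fun t ht => by
    have : 1 ≤ -t / L := by rw [le_div_iff₀ hL0]; linarith
    simp only [κ]
    rw [min_eq_left this, max_eq_right zero_le_one]
  have hκL : ∀ a b, |κ a - κ b| ≤ |a - b| / L := by
    intro a b
    calc |κ a - κ b| ≤ |min 1 (-a / L) - min 1 (-b / L)| := by
          simpa [κ, max_comm] using abs_max_sub_max_le_abs (min 1 (-a / L)) (min 1 (-b / L)) 0
      _ ≤ |-a / L - -b / L| := by
          simpa [min_comm] using abs_min_sub_min_le_max (-a / L) 1 (-b / L) 1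
      _ = |a - b| / L := by
          rw [show -a / L - -b / L = -((a - b) / L) by ring, abs_neg, abs_div, abs_of_pos hL0]
  have hφm : StrictMono fun t => t + s * κ t := by
    intro a b hab
    have h1 := hκL a b
    rw [abs_of_neg (show a - b < 0 by linarith), le_div_iff₀ hL0] at h1
    have h2 : |s * (κ a - κ b)| * L ≤ |s| * (b - a) := by
      rw [abs_mul, mul_assoc]; gcongr; linarith
    have h3 : |s * (κ a - κ b)| < b - a := by
      by_contra! h
      have : (b - a) * L ≤ |s| * (b - a) := le_trans (by gcongr) h2
      rw [hL] at this
      nlinarith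
    have h4 := (abs_lt.1 h3).2
    simp only
    nlinarith
  obtain ⟨φ, hφ⟩ := exists_homeomorph_of_strictMono hφm
    (surjective_of_dist_le (C := |s|) (by fun_prop) fun t => by
      rw [add_sub_cancel_left, abs_mul, abs_of_nonneg (hκ0 t)]
      exact mul_le_of_le_one_right (abs_nonneg _) (hκ1 t))
  have hφ' : ∀ t, φ t = t + s * κ t := fun t => congrFun hφ t
  have hφm' : StrictMono φ := hφ ▸ hφm
  let M : ℝ → Circle → Circle := fun t θ => θ * Circle.exp ((1 - κ t) * D θ + κ t * β)
  let m : ℝ → ℝ → ℝ := fun t x => (1 - κ t) * X x + κ t * (x + β)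
  have hMm : ∀ t x, M t (Circle.exp x) = Circle.exp (m t x) := by
    intro t x
    simp only [M, m]
    rw [hD, ← Circle.exp_add]; congr 1; ring
  have hmm : ∀ t, StrictMono (m t) := by
    intro t x y hxy
    have h1 := hm hxy
    simp only [m]
    rcases (hκ0 t).eq_or_lt with h | h
    · rw [← h]; linarith
    · have : (1 - κ t) * X x ≤ (1 - κ t) * X y :=
        mul_le_mul_of_nonneg_left h1.le (by linarith [hκ1 t])
      nlinarith
  have hmper : ∀ t (j : ℤ) x, m t (x + j * (2 * π)) = m t x + j * (2 * π) := by
    intro t j x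
    have := hper.int_mul j x
    simp only [m] at this ⊢
    linear_combination (1 - κ t) * this
  have hMi : ∀ t, Function.Injective (M t) := by
    intro t θ₁ θ₂ h
    obtain ⟨x, rfl⟩ := Circle.exp_surjective θ₁
    obtain ⟨y, rfl⟩ := Circle.exp_surjective θ₂
    rw [hMm, hMm] at h
    obtain ⟨j, hj⟩ := Circle.exp_eq_exp.1 h
    rw [← hmper] at hj
    exact Circle.exp_eq_exp.2 ⟨j, (hmm t).injective hj⟩
  have hMs : ∀ t, Function.Surjective (M t) := by
    intro t θ
    obtain ⟨y, rfl⟩ := Circle.exp_surjective θ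
    have hcm : Continuous (m t) := by simp only [m]; fun_prop
    obtain ⟨n, hn⟩ := exists_int_gt ((y - m t 0) / (2 * π))
    obtain ⟨n', hn'⟩ := exists_int_lt ((y - m t 0) / (2 * π))
    rw [div_lt_iff₀ (by positivity)] at hn
    rw [lt_div_iff₀ (by positivity)] at hn'
    have e1 := hmper t n 0
    have e2 := hmper t n' 0
    obtain ⟨x, hx⟩ := mem_range_of_exists_le_of_exists_ge hcm (c := y)
      ⟨0 + n' * (2 * π), by rw [e2]; linarith⟩ ⟨0 + n * (2 * π), by rw [e1]; linarith⟩
    exact ⟨Circle.exp x, by rw [hMm, hx]⟩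
  have hMc : Continuous fun p : Circle × ℝ => M p.2 p.1 := by
    simp only [M]
    refine continuous_fst.mul (Circle.exp.continuous.comp ?_)
    fun_prop
  obtain ⟨Θ, hΘ⟩ := exists_homeomorph_of_bijective
    (f := fun p => (M p.2 p.1, φ p.2)) (hMc.prodMk (by fun_prop)) ⟨by
      rintro ⟨θ₁, t₁⟩ ⟨θ₂, t₂⟩ h
      simp only [Prod.mk.injEq, φ.injective.eq_iff] at h
      obtain ⟨h1, rfl⟩ := h
      rw [hMi _ h1], by
      rintro ⟨θ, t⟩
      obtain ⟨θ', h⟩ := hMs (φ.symm t) θ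
      exact ⟨(θ', φ.symm t), by simp [h]⟩⟩ (fun K hK => by
        refine ⟨univ ×ˢ (φ.symm '' (Prod.snd '' K)), isCompact_univ.prod
          ((hK.image continuous_snd).image φ.symm.continuous), fun p hp => ⟨trivial, ?_⟩⟩
        exact ⟨φ p.2, ⟨_, hp, rfl⟩, by simp⟩)
  have hΘ' : ∀ p, Θ p = (M p.2 p.1, φ p.2) := fun p => congrFun hΘ p
  have hφ0 : φ 0 = 0 := by rw [hφ', hκp 0 le_rfl]; simp
  refine ⟨Θ, -L, fun θ => ?_, fun p => ?_, fun p hp => ?_⟩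
  · obtain ⟨x, rfl⟩ := Circle.exp_surjective θ
    rw [hΘ', hφ0, ← hX, hMm]
    simp only [m, hκp 0 le_rfl]
    simp
  · rw [hΘ']
    show φ p.2 ≤ 0 ↔ _
    nth_rw 1 [← hφ0]
    exact hφm'.le_iff_le
  · rw [hΘ', hφ']
    simp only [M, hκn _ hp]
    simp

/-- Any homeomorphism of the circle extends over the lower half of the annulus to a homeomorphism
which near the end is a prescribed rotation and translation, up to a reflection. -/
theorem exists_isotopy (χ : Circle ≃ₜ Circle) (β s : ℝ) :
    ∃ (Θ : (Circle × ℝ) ≃ₜ (Circle × ℝ)) (σ : (Circle × ℝ) ≃ₜ (Circle × ℝ)) (N : ℝ),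
      (σ = Homeomorph.refl _ ∨ σ = circleFlip) ∧ (∀ θ, Θ (θ, 0) = (χ θ, 0)) ∧
      (∀ p, (Θ p).2 ≤ 0 ↔ p.2 ≤ 0) ∧
      ∀ p, p.2 ≤ N → Θ p = ((σ p).1 * Circle.exp β, p.2 + s) := by
  obtain ⟨X, hc, hX⟩ := exists_lift (χ : C(Circle, Circle))
  rcases strictMono_or_strictAnti_lift χ hc hX with hm | hm
  · obtain ⟨Θ, N, h1, h2, h3⟩ := exists_isotopy_of_strictMono χ hc hX hm β s
    exact ⟨Θ, Homeomorph.refl _, N, Or.inl rfl, h1, h2, h3⟩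
  · obtain ⟨Θ, N, h1, h2, h3⟩ := exists_isotopy_of_strictMono ((Homeomorph.inv Circle).trans χ)
      (X := fun x => X (-x)) (by fun_prop) (fun x => by rw [hX, Circle.exp_neg]; rfl)
      (fun x y hxy => hm (neg_lt_neg hxy)) β s
    refine ⟨circleFlip.trans Θ, circleFlip, N, Or.inr rfl, fun θ => ?_, fun p => ?_, fun p hp => ?_⟩
    · simp [h1]
    · simp [h2]
    · simpa using h3 (circleFlip p) hp

end Annulus

namespace Annulus

open Set Metric Filter Topology
open scoped Real

theorem exists_glue (g : (Circle × ℝ) ≃ₜ (Circle × ℝ)) (T : ℝ) {Φ : (Circle × ℝ) → (Circle × ℝ)}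
    (hc : ContinuousOn Φ {p | p.2 ≤ T}) (hb : BijOn Φ {p | p.2 ≤ T} (g '' {p | p.2 ≤ T}))
    (ht : ∀ p : Circle × ℝ, p.2 = T → Φ p = g p)
    (hK : ∀ K : Set (Circle × ℝ), IsCompact K →
      ∃ K', IsCompact K' ∧ ∀ p : Circle × ℝ, p.2 ≤ T → Φ p ∈ K → p ∈ K') :
    ∃ h : (Circle × ℝ) ≃ₜ (Circle × ℝ), (∀ p, p.2 ≤ T → h p = Φ p) ∧ ∀ p, T ≤ p.2 → h p = g p := by
  have hcl : IsClosed {p : Circle × ℝ | p.2 ≤ T} := isClosed_le continuous_snd continuous_const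
  suffices H : ∃ h : (Circle × ℝ) ≃ₜ (Circle × ℝ),
      ⇑h = fun p : Circle × ℝ => if p.2 ≤ T then Φ p else g p by
    obtain ⟨h, hh⟩ := H
    have hh' : ∀ p, h p = if p.2 ≤ T then Φ p else g p := fun p => congrFun hh p
    refine ⟨h, fun p hp => by rw [hh', if_pos hp], fun p hp => ?_⟩
    rw [hh']
    split_ifs with h1
    · exact ht p (le_antisymm h1 hp)
    · rfl
  refine exists_homeomorph_of_bijective
    (f := fun p => if p.2 ≤ T then Φ p else g p)
    (continuous_if (fun p hp => ht p (frontier_le_subset_eq continuous_snd continuous_const hp))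
      (by rwa [hcl.closure_eq]) g.continuous.continuousOn)
    ⟨fun p q hpq => ?_, fun y => ?_⟩ fun K h => ?_
  · simp only at hpq
    split_ifs at hpq with h1 h2 h2
    · exact hb.injOn h1 h2 hpq
    · obtain ⟨r, hr, hrp⟩ := hb.mapsTo h1
      exact absurd (g.injective (hrp.trans hpq) ▸ hr) h2
    · obtain ⟨r, hr, hrp⟩ := hb.mapsTo h2
      exact absurd (g.injective (hrp.trans hpq.symm) ▸ hr) h1
    · exact g.injective hpq
  · obtain ⟨q, rfl⟩ := g.surjective y
    by_cases hq : q.2 ≤ T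
    · obtain ⟨p, hp, hpq⟩ := hb.surjOn (mem_image_of_mem g hq)
      exact ⟨p, (if_pos hp).trans hpq⟩
    · exact ⟨q, if_neg hq⟩
  · obtain ⟨K', hK', hsub⟩ := hK K h
    refine ⟨K' ∪ g.symm '' K, hK'.union (h.image g.symm.continuous), fun p hp => ?_⟩
    simp only [mem_preimage] at hp
    split_ifs at hp with h1
    · exact Or.inl (hsub p h1 hp)
    · exact Or.inr ⟨_, hp, g.symm_apply_apply p⟩

open Classical in
/-- A left inverse of `polar`, defined on the whole plane. -/
noncomputable def polarInv (z : ℂ) : Circle × ℝ := if h : z ≠ 0 then polar.symm ⟨z, h⟩ else (1, 0)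

theorem polarInv_polar (p : Circle × ℝ) : polarInv (polar p) = p := by
  simp [polarInv, polar_ne_zero]

theorem polar_polarInv {z : ℂ} (hz : z ≠ 0) : (polar (polarInv z) : ℂ) = z := by
  simp [polarInv, hz]

theorem continuousOn_polarInv : ContinuousOn polarInv {z : ℂ | z ≠ 0} := by
  rw [continuousOn_iff_continuous_domRestrict]
  have : Set.domRestrict {z : ℂ | z ≠ 0} polarInv = polar.symm := by
    ext1 ⟨z, hz⟩
    exact dif_pos (show z ≠ 0 from hz)
  rw [this]
  exact polar.symm.continuous

theorem exists_circleHomeomorph {G : ℂ ≃ₜ ℂ} {F : ℂ → ℂ} (hc : ContinuousOn F (closedBall 0 1))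
    (hb : BijOn F (sphere 0 1) (G '' sphere 0 1)) :
    ∃ χ : Circle ≃ₜ Circle, ∀ θ : Circle, F (χ θ) = G θ := by
  have hs : ∀ θ : Circle, (θ : ℂ) ∈ sphere (0 : ℂ) 1 := fun θ => by
    rw [mem_sphere_zero_iff_norm, Circle.norm_coe]
  have hm : ∀ θ : Circle, G.symm (F θ) ∈ sphere (0 : ℂ) 1 := fun θ => by
    obtain ⟨z, hz, h⟩ := hb.mapsTo (hs θ)
    rw [← h, G.symm_apply_apply]
    exact hz
  let f : Circle → Circle := fun θ => ⟨G.symm (F θ), by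
    have := hm θ
    simpa [Submonoid.unitSphere] using this⟩
  have hf : ∀ θ, G (f θ) = F θ := fun θ => G.apply_symm_apply _
  have hfc : Continuous f := by
    refine Continuous.subtype_mk (G.symm.continuous.comp ?_) _
    exact hc.comp_continuous continuous_subtype_val fun θ => sphere_subset_closedBall (hs θ)
  have hfb : Function.Bijective f := by
    refine ⟨fun θ₁ θ₂ h => Circle.ext (hb.injOn (hs _) (hs _) ?_), fun θ => ?_⟩
    · rw [← hf, ← hf, h]
    · obtain ⟨z, hz, h⟩ := hb.surjOn (mem_image_of_mem G (hs θ))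
      have hz' : z ∈ Submonoid.unitSphere ℂ := hz
      exact ⟨⟨z, hz'⟩, Circle.ext (G.injective ((hf _).trans h))⟩
  let e := Continuous.homeoOfEquivCompactToT2 (f := Equiv.ofBijective f hfb) hfc
  refine ⟨e.symm, fun θ => ?_⟩
  rw [← hf]
  exact congrArg (fun θ : Circle => G θ) (e.apply_symm_apply θ)

theorem bijOn_polarInv {g : (Circle × ℝ) ≃ₜ (Circle × ℝ)} (hg : PreservesEnds g) {F : ℂ → ℂ}
    (hF0 : F 0 = 0)
    (hb : BijOn F (closedBall 0 1) (planeHomeomorph hg '' closedBall 0 1)) :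
    BijOn (fun p => polarInv (F (polar p))) {p | p.2 ≤ 0} (g '' {p | p.2 ≤ 0}) ∧
      ∀ p : Circle × ℝ, p.2 ≤ 0 → F (polar p) ≠ 0 := by
  have hG : ∀ p, planeHomeomorph hg (polar p) = polar (g p) := planeMap_polar g
  have hG0 : planeHomeomorph hg 0 = 0 := planeMap_zero g
  have hball : ∀ p : Circle × ℝ, (polar p : ℂ) ∈ closedBall (0 : ℂ) 1 ↔ p.2 ≤ 0 := fun p => by
    rw [mem_closedBall_zero_iff, norm_polar, Real.exp_le_one_iff]
  have h0 : (0 : ℂ) ∈ closedBall (0 : ℂ) 1 := mem_closedBall_self zero_le_one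
  have hne : ∀ p : Circle × ℝ, p.2 ≤ 0 → F (polar p) ≠ 0 := fun p hp h =>
    polar_ne_zero p (hb.injOn ((hball p).2 hp) h0 (h.trans hF0.symm))
  refine ⟨⟨fun p hp => ?_, fun p hp q hq hpq => ?_, ?_⟩, hne⟩
  · obtain ⟨z, hz, h⟩ := hb.mapsTo ((hball p).2 hp)
    have hz0 : z ≠ 0 := by
      rintro rfl
      exact hne p hp (h.symm.trans hG0)
    obtain ⟨q, rfl⟩ := exists_polar_eq hz0
    refine ⟨q, (hball q).1 hz, ?_⟩
    simp only
    rw [← h, hG, polarInv_polar]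
  · have h := congrArg (fun p => (polar p : ℂ)) hpq
    simp only [polar_polarInv (hne p hp), polar_polarInv (hne q hq)] at h
    exact polar.injective (Subtype.ext (hb.injOn ((hball p).2 hp) ((hball q).2 hq) h))
  · rintro _ ⟨q, hq, rfl⟩
    obtain ⟨z, hz, h⟩ := hb.surjOn (mem_image_of_mem _ ((hball q).2 hq))
    rw [hG] at h
    have hz0 : z ≠ 0 := by
      rintro rfl
      exact polar_ne_zero _ (h.symm.trans hF0)
    obtain ⟨p, rfl⟩ := exists_polar_eq hz0
    refine ⟨p, (hball p).1 hz, ?_⟩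
    simp only
    rw [h, polarInv_polar]

theorem exists_standard_below_zero {g : (Circle × ℝ) ≃ₜ (Circle × ℝ)} (hg : PreservesEnds g) :
    ∃ (h σ : (Circle × ℝ) ≃ₜ (Circle × ℝ)) (N : ℝ), (σ = Homeomorph.refl _ ∨ σ = circleFlip) ∧
      (∀ p, 0 ≤ p.2 → h p = g p) ∧ ∀ p, p.2 ≤ N → h p = σ p := by
  have hG : ∀ p, planeHomeomorph hg (polar p) = polar (g p) := planeMap_polar g
  obtain ⟨F, a, ha, hFc, hFb, hFs, ε, hε, hF⟩ :=
    exists_parametrization_linear (planeHomeomorph hg) (planeMap_zero g)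
  have hF0 : F 0 = 0 := by rw [hF 0 (by simpa using hε.le), mul_zero]
  obtain ⟨χ, hχ⟩ := exists_circleHomeomorph hFc hFs
  obtain ⟨Θ, σ, N, hσ, hΘ0, hΘ, hN⟩ := exists_isotopy χ (-Complex.arg a) (-Real.log ‖a‖)
  obtain ⟨hb, hne⟩ := bijOn_polarInv hg hF0 hFb
  have hσ2 : ∀ p, (σ p).2 = p.2 := by
    rintro p
    rcases hσ with rfl | rfl <;> rfl
  set N' := min N (min 0 (Real.log ε + Real.log ‖a‖)) with hN'
  have hlow : ∀ p : Circle × ℝ, p.2 ≤ N' → polarInv (F (polar (Θ p))) = σ p := by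
    intro p hp
    have h1 : p.2 ≤ N := hp.trans (min_le_left _ _)
    have h2 : p.2 ≤ Real.log ε + Real.log ‖a‖ :=
      hp.trans ((min_le_right _ _).trans (min_le_right _ _))
    rw [hF, hN p h1]
    · refine (congrArg polarInv ?_).trans (polarInv_polar (σ p))
      rw [coe_polar, coe_polar, hσ2]
      have e1 : (Real.exp (p.2 + -Real.log ‖a‖) : ℂ) = Real.exp p.2 / ‖a‖ := by
        rw [Real.exp_add, Real.exp_neg, Real.exp_log (norm_pos_iff.2 ha)]
        push_cast
        rw [div_eq_mul_inv]
      have e2 : a = ‖a‖ * Complex.exp (Complex.arg a * Complex.I) :=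
        (Complex.norm_mul_exp_arg_mul_I a).symm
      have hn : (‖a‖ : ℂ) ≠ 0 := by simpa using ha
      have e3 : Complex.exp (Complex.arg a * Complex.I) *
          Complex.exp (Complex.I * (-Complex.arg a : ℝ)) = 1 := by
        rw [mul_comm Complex.I, ← Complex.exp_add]; simp
      simp only [e1, Circle.coe_mul, Circle.coe_exp]
      nth_rw 1 [e2]
      field_simp
      linear_combination e3
    · rw [norm_polar, hN p h1, ← Real.le_log_iff_exp_le hε]
      simp only
      linarith
  suffices H : ∃ h : (Circle × ℝ) ≃ₜ (Circle × ℝ), (∀ p, p.2 ≤ 0 →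
      h p = polarInv (F (polar (Θ p)))) ∧ ∀ p, 0 ≤ p.2 → h p = g p by
    obtain ⟨h, hh1, hh2⟩ := H
    refine ⟨h, σ, N', hσ, hh2, fun p hp => ?_⟩
    rw [hh1 p (hp.trans ((min_le_right _ _).trans (min_le_left _ _))), hlow p hp]
  refine exists_glue g 0 ?_ ?_ ?_ ?_
  · refine continuousOn_polarInv.comp (hFc.comp (continuous_subtype_val.comp
      (polar.continuous.comp Θ.continuous)).continuousOn fun p hp => ?_) fun p hp =>
        hne _ ((hΘ p).2 hp)
    rw [mem_closedBall_zero_iff, norm_polar, Real.exp_le_one_iff]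
    exact (hΘ p).2 hp
  · refine hb.comp ⟨fun p hp => (hΘ p).2 hp, Θ.injective.injOn, fun q hq => ?_⟩
    refine ⟨Θ.symm q, (hΘ _).1 ?_, Θ.apply_symm_apply q⟩
    rw [Θ.apply_symm_apply]
    exact hq
  · rintro ⟨θ, t⟩ ht
    simp only at ht
    subst ht
    have : ∀ θ : Circle, (polar (θ, 0) : ℂ) = θ := fun θ => by simp [coe_polar]
    rw [hΘ0, this, hχ, ← this, hG, polarInv_polar]
  · intro K hK
    refine ⟨σ.symm '' K ∪ {p | N' ≤ p.2 ∧ p.2 ≤ 0}, (hK.image σ.symm.continuous).union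
      (isCompact_band _ _), fun p hp hpK => ?_⟩
    rcases le_total p.2 N' with hle | hle
    · simp only [hlow p hle] at hpK
      exact Or.inl ⟨_, hpK, σ.symm_apply_apply p⟩
    · exact Or.inr ⟨hle, hp⟩

end Annulus

namespace Annulus

open Set Pointwise

section Distortion

variable {G : Type*} [Group G]

/-- A set of sequences in a group is uniformly distorted if each of them lies in the powers of a
finite set of bounded size, with exponents independent of the sequence. -/
def UniformlyDistorted (C : Set (ℕ → G)) : Prop :=
  ∃ (m : ℕ) (w : ℕ → ℕ), ∀ g ∈ C, ∃ S : Set G,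
    S.Finite ∧ S.ncard ≤ m ∧ 1 ∈ S ∧ S⁻¹ = S ∧ ∀ n, g n ∈ S ^ w n

theorem UniformlyDistorted.mono {C D : Set (ℕ → G)} (hD : UniformlyDistorted D) (h : C ⊆ D) :
    UniformlyDistorted C := by
  obtain ⟨m, w, H⟩ := hD
  exact ⟨m, w, fun g hg => H g (h hg)⟩

theorem UniformlyDistorted.mul {C D : Set (ℕ → G)} (hC : UniformlyDistorted C)
    (hD : UniformlyDistorted D) : UniformlyDistorted (C * D) := by
  obtain ⟨m, w, H⟩ := hC
  obtain ⟨m', w', H'⟩ := hD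
  refine ⟨m + m', fun n => w n + w' n, ?_⟩
  rintro _ ⟨g, hg, h, hh, rfl⟩
  obtain ⟨S, hS, hm, h1, hi, hw⟩ := H g hg
  obtain ⟨T, hT, hm', h1', hi', hw'⟩ := H' h hh
  refine ⟨S ∪ T, hS.union hT, (ncard_union_le _ _).trans (add_le_add hm hm'), Or.inl h1, ?_,
    fun n => ?_⟩
  · rw [union_inv, hi, hi']
  · rw [pow_add]
    exact mul_mem_mul (pow_subset_pow_left subset_union_left (hw n))
      (pow_subset_pow_left subset_union_right (hw' n))

theorem UniformlyDistorted.inv {C : Set (ℕ → G)} (hC : UniformlyDistorted C) :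
    UniformlyDistorted C⁻¹ := by
  obtain ⟨m, w, H⟩ := hC
  refine ⟨m, w, fun g hg => ?_⟩
  obtain ⟨S, hS, hm, h1, hi, hw⟩ := H _ hg
  refine ⟨S, hS, hm, h1, hi, fun n => ?_⟩
  have := hw n
  rwa [Pi.inv_apply, ← Set.mem_inv, ← inv_pow, hi] at this

theorem uniformlyDistorted_pow (w : ℕ → ℕ) :
    UniformlyDistorted (range fun (φ : G) (n : ℕ) => φ ^ w n) := by
  refine ⟨3, w, ?_⟩
  rintro _ ⟨φ, rfl⟩
  refine ⟨{1, φ, φ⁻¹}, by simp, ?_, by simp, ?_, fun n => pow_mem_pow (by simp)⟩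
  · exact (ncard_insert_le _ _).trans (by
      have := ncard_insert_le φ {φ⁻¹}
      simp at this
      omega)
  · ext x
    simp only [mem_inv, mem_insert_iff, mem_singleton_iff, inv_eq_iff_eq_inv, inv_one, inv_inv]
    tauto

theorem uniformlyDistorted_const : UniformlyDistorted (range fun (φ : G) (_ : ℕ) => φ) := by
  simpa using uniformlyDistorted_pow (G := G) fun _ => 1

theorem uniformlyDistorted_of_finite {F : Set G} (hF : F.Finite) :
    UniformlyDistorted {g : ℕ → G | ∀ n, g n ∈ F} := by
  refine ⟨(insert 1 (F ∪ F⁻¹)).ncard, fun _ => 1, fun g hg => ⟨insert 1 (F ∪ F⁻¹),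
    (hF.union hF.inv).insert _, le_rfl, mem_insert _ _, ?_, fun n => ?_⟩⟩
  · ext x
    simp only [mem_inv, mem_insert_iff, mem_union, inv_eq_one, inv_inv]
    tauto
  · rw [pow_one]
    exact Or.inr (Or.inl (hg n))

theorem UniformlyDistorted.stronglyDistorted [Infinite G]
    (h : UniformlyDistorted (univ : Set (ℕ → G))) : StronglyDistorted G := by
  obtain ⟨m, w, H⟩ := h
  refine ⟨m, w, fun g => ?_⟩
  obtain ⟨S, hS, hm, -, -, hw⟩ := H g trivial
  obtain ⟨T, hST, hT⟩ := Infinite.exists_superset_card_eq hS.toFinset m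
    (by rwa [← ncard_eq_toFinset_card S hS])
  refine ⟨T, T.finite_toSet, by simpa using hT, fun n => pow_subset_pow_left (fun x hx => ?_)
    (hw n)⟩
  exact hST (hS.mem_toFinset.2 hx)

end Distortion

end Annulus

namespace Annulus

open Set Pointwise Filter Topology

/-- The group of self-homeomorphisms of the annulus. -/
abbrev AnnulusHomeo : Type := (Circle × ℝ) ≃ₜ (Circle × ℝ)

theorem mul_apply (f g : AnnulusHomeo) (p : Circle × ℝ) : (f * g) p = f (g p) := rfl

theorem one_apply (p : Circle × ℝ) : (1 : AnnulusHomeo) p = p := rfl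

theorem inv_apply_self (f : AnnulusHomeo) (p : Circle × ℝ) : f⁻¹ (f p) = p := f.symm_apply_apply p

theorem apply_inv_self (f : AnnulusHomeo) (p : Circle × ℝ) : f (f⁻¹ p) = p := f.apply_symm_apply p

theorem inv_apply_eq {f : AnnulusHomeo} {p q : Circle × ℝ} (h : f q = p) : f⁻¹ p = q := by
  rw [← h, inv_apply_self]

/-- The homeomorphism of the annulus acting by `e` on the second coordinate. -/
noncomputable def vertical (e : ℝ ≃ₜ ℝ) : AnnulusHomeo := (Homeomorph.refl Circle).prodCongr e

theorem vertical_apply (e : ℝ ≃ₜ ℝ) (p : Circle × ℝ) : vertical e p = (p.1, e p.2) := rfl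

/-- Vertical translation of the annulus. -/
noncomputable def shift (s : ℝ) : AnnulusHomeo := vertical (Homeomorph.addRight s)

theorem shift_apply (s : ℝ) (p : Circle × ℝ) : shift s p = (p.1, p.2 + s) := rfl

theorem shift_mul (s t : ℝ) : shift s * shift t = shift (t + s) :=
  Homeomorph.ext fun p => by simp [shift_apply, add_assoc]

theorem exists_piecewiseAffine {x : ℤ → ℝ} (hx : StrictMono x) (ha : ∀ y, ∃ i, y ≤ x i)
    (hb : ∀ y, ∃ i, x i ≤ y) :
    ∃ e : ℝ ≃ₜ ℝ, ∀ t, e t = x ⌊t⌋ + Int.fract t * (x (⌊t⌋ + 1) - x ⌊t⌋) := by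
  set f : ℝ → ℝ := fun t => x ⌊t⌋ + Int.fract t * (x (⌊t⌋ + 1) - x ⌊t⌋) with hf
  have hstep : ∀ i, 0 < x (i + 1) - x i := fun i => sub_pos.2 (hx (lt_add_one i))
  have hm : StrictMono f := by
    intro s t hst
    rcases (Int.floor_mono hst.le).eq_or_lt with h | h
    · simp only [hf, Int.fract, h]
      have := hstep ⌊t⌋
      gcongr
    · calc f s < x (⌊s⌋ + 1) := by
            have h1 := hstep ⌊s⌋
            have h2 := Int.fract_lt_one s
            simp only [hf]
            nlinarith
        _ ≤ x ⌊t⌋ := hx.monotone h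
        _ ≤ f t := le_add_of_nonneg_right (mul_nonneg (Int.fract_nonneg t) (hstep _).le)
  obtain ⟨e, he⟩ := exists_homeomorph_of_strictMono hm fun y => by
    obtain ⟨j, hj⟩ := ha y
    obtain ⟨i, hi⟩ := hb y
    obtain ⟨k, hk, hmax⟩ := Int.exists_greatest_of_bdd (P := fun i => x i ≤ y)
      ⟨j, fun z hz => hx.le_iff_le.1 (hz.trans hj)⟩ ⟨i, hi⟩
    have hk1 : y < x (k + 1) := by
      by_contra! h
      have := hmax _ h
      omega
    have hs := hstep k
    have h0 : 0 ≤ (y - x k) / (x (k + 1) - x k) := div_nonneg (by linarith) hs.le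
    have h1 : (y - x k) / (x (k + 1) - x k) < 1 := (div_lt_one hs).2 (by linarith)
    have hfl : ⌊(k : ℝ) + (y - x k) / (x (k + 1) - x k)⌋ = k := by
      rw [Int.floor_eq_iff]; constructor <;> linarith
    refine ⟨k + (y - x k) / (x (k + 1) - x k), ?_⟩
    simp only [hf, Int.fract, hfl]
    rw [add_sub_cancel_left, div_mul_cancel₀ _ hs.ne']
    ring
  exact ⟨e, fun t => congrFun he t⟩

/-- The homeomorphisms supported in the band between heights `0` and `1`. -/
def unitBand : Subgroup AnnulusHomeo where
  carrier := {u | ∀ p : Circle × ℝ, p.2 ≤ 0 ∨ 1 ≤ p.2 → u p = p}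
  mul_mem' hu hv p hp := by rw [mul_apply, hv p hp, hu p hp]
  one_mem' _ _ := rfl
  inv_mem' hu p hp := inv_apply_eq (hu p hp)

theorem unitBand_snd_mem (u : unitBand) {p : Circle × ℝ} (h0 : 0 ≤ p.2) (h1 : p.2 < 1) :
    0 ≤ ((u : AnnulusHomeo) p).2 ∧ ((u : AnnulusHomeo) p).2 < 1 := by
  constructor
  · by_contra! h
    have := (u : AnnulusHomeo).injective (u.2 _ (Or.inl h.le))
    rw [this] at h
    linarith
  · by_contra! h
    have := (u : AnnulusHomeo).injective (u.2 _ (Or.inr h))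
    rw [this] at h
    linarith

/-- The map acting on the band between the heights `i` and `i + 1` as a translate of `u i`. -/
noncomputable def glueFun (u : ℤ → unitBand) (p : Circle × ℝ) : Circle × ℝ :=
  shift ⌊p.2⌋ ((u ⌊p.2⌋ : AnnulusHomeo) (shift (-⌊p.2⌋) p))

theorem floor_glueFun (u : ℤ → unitBand) (p : Circle × ℝ) : ⌊(glueFun u p).2⌋ = ⌊p.2⌋ := by
  have h := unitBand_snd_mem (u ⌊p.2⌋) (p := shift (-⌊p.2⌋) p)
    (by rw [shift_apply]; linarith [Int.floor_le p.2])
    (by rw [shift_apply]; linarith [Int.lt_floor_add_one p.2])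
  rw [glueFun, shift_apply, Int.floor_eq_iff]
  constructor <;> linarith [h.1, h.2]

theorem glueFun_glueFun (u v : ℤ → unitBand) (p : Circle × ℝ) :
    glueFun u (glueFun v p) = glueFun (u * v) p := by
  have h := floor_glueFun v p
  rw [glueFun, h, glueFun, glueFun]
  simp [shift_apply]

theorem glueFun_one (p : Circle × ℝ) : glueFun 1 p = p := by
  simp [glueFun, shift_apply]

theorem glueFun_eq {u : ℤ → unitBand} {p : Circle × ℝ} {i : ℤ} (h : (i : ℝ) ≤ p.2)
    (h' : p.2 ≤ i + 1) : glueFun u p = shift i ((u i : AnnulusHomeo) (shift (-i) p)) := by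
  rcases h'.eq_or_lt with h1 | h1
  · have hf : ⌊p.2⌋ = i + 1 := by rw [h1]; simp
    rw [glueFun, hf, (u (i + 1)).2 _ (Or.inl (by rw [shift_apply]; simp [h1])),
      (u i).2 _ (Or.inr (by rw [shift_apply]; simp [h1]))]
    refine Prod.ext (by simp [shift_apply]) ?_
    simp only [shift_apply]
    push_cast
    ring
  · have hf : ⌊p.2⌋ = i := Int.floor_eq_iff.2 ⟨h, h1⟩
    rw [glueFun, hf]

theorem continuous_glueFun (u : ℤ → unitBand) : Continuous (glueFun u) := by
  have hcl : ∀ i : ℤ, IsClosed {p : Circle × ℝ | (i : ℝ) ≤ p.2 ∧ p.2 ≤ i + 1} := fun i =>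
    (isClosed_le continuous_const continuous_snd).inter
      (isClosed_le continuous_snd continuous_const)
  refine LocallyFinite.continuous (f := fun i : ℤ => {p : Circle × ℝ | (i : ℝ) ≤ p.2 ∧ p.2 ≤ i + 1})
    (fun p => ?_) (eq_univ_of_forall fun p => mem_iUnion.2
      ⟨⌊p.2⌋, Int.floor_le _, (Int.lt_floor_add_one _).le⟩) hcl fun i => ?_
  · refine ⟨{q | ⌊p.2⌋ - 1 < q.2 ∧ q.2 < ⌊p.2⌋ + 1}, ((isOpen_lt continuous_const
      continuous_snd).inter (isOpen_lt continuous_snd continuous_const)).mem_nhds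
        ⟨show (⌊p.2⌋ : ℝ) - 1 < p.2 by linarith [Int.floor_le p.2],
          show p.2 < (⌊p.2⌋ : ℝ) + 1 from Int.lt_floor_add_one _⟩, ?_⟩
    refine (finite_Icc (⌊p.2⌋ - 2) (⌊p.2⌋ + 1)).subset ?_
    rintro i ⟨q, ⟨h1, h2⟩, h3, h4⟩
    have e1 : (i : ℝ) < ((⌊p.2⌋ + 1 : ℤ) : ℝ) := by push_cast; linarith
    have e2 : ((⌊p.2⌋ - 2 : ℤ) : ℝ) < i := by push_cast; linarith
    exact ⟨(Int.cast_lt.1 e2).le, (Int.cast_lt.1 e1).le⟩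
  · refine ContinuousOn.congr (f := fun p => shift i ((u i : AnnulusHomeo) (shift (-i) p)))
      ?_ fun p hp => glueFun_eq hp.1 hp.2
    exact ((shift i).continuous.comp ((u i : AnnulusHomeo).continuous.comp
      (shift (-i)).continuous)).continuousOn

/-- The homomorphism gluing homeomorphisms of the bands between consecutive integer heights. -/
noncomputable def glue : (ℤ → unitBand) →* AnnulusHomeo where
  toFun u :=
    { toFun := glueFun u
      invFun := glueFun u⁻¹
      left_inv := fun p => by rw [glueFun_glueFun, inv_mul_cancel, glueFun_one]
      right_inv := fun p => by rw [glueFun_glueFun, mul_inv_cancel, glueFun_one]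
      continuous_toFun := continuous_glueFun u
      continuous_invFun := continuous_glueFun u⁻¹ }
  map_one' := Homeomorph.ext fun p => glueFun_one p
  map_mul' u v := Homeomorph.ext fun p => (glueFun_glueFun u v p).symm

theorem glue_apply (u : ℤ → unitBand) (p : Circle × ℝ) :
    glue u p = shift ⌊p.2⌋ ((u ⌊p.2⌋ : AnnulusHomeo) (shift (-⌊p.2⌋) p)) := rfl

theorem floor_glue (u : ℤ → unitBand) (p : Circle × ℝ) : ⌊(glue u p).2⌋ = ⌊p.2⌋ :=
  floor_glueFun u p

theorem glue_apply_of_eq_one {u : ℤ → unitBand} {p : Circle × ℝ} (h : u ⌊p.2⌋ = 1) :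
    glue u p = p := by
  rw [glue_apply, h]
  simp [shift_apply]

/-- Conjugating a glued homeomorphism by a map which translates the bands in its support. -/
theorem conj_glue {μ : AnnulusHomeo} {I : Set ℤ} {e : ℤ → ℤ} {u v : ℤ → unitBand}
    (hμ : ∀ p : Circle × ℝ, ⌊p.2⌋ ∈ I → μ p = (p.1, p.2 + (e ⌊p.2⌋ - ⌊p.2⌋ : ℤ)))
    (hu : ∀ i ∉ I, u i = 1) (hv : ∀ i ∈ I, v (e i) = u i) (hv' : ∀ j ∉ e '' I, v j = 1) :
    μ * glue u * μ⁻¹ = glue v := by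
  rw [mul_inv_eq_iff_eq_mul]
  refine Homeomorph.ext fun p => ?_
  have hfl : ∀ p : Circle × ℝ, ⌊p.2⌋ ∈ I → ⌊(μ p).2⌋ = e ⌊p.2⌋ := fun p hp => by
    rw [hμ p hp, Int.floor_add_intCast]; ring
  rw [mul_apply, mul_apply]
  by_cases hp : ⌊p.2⌋ ∈ I
  · rw [hμ _ (by rwa [floor_glue]), floor_glue, glue_apply v, hfl p hp, hv _ hp, hμ p hp,
      glue_apply]
    have : shift (-(e ⌊p.2⌋ : ℝ)) (p.1, p.2 + (e ⌊p.2⌋ - ⌊p.2⌋ : ℤ)) = shift (-⌊p.2⌋) p := by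
      simp only [shift_apply]; push_cast; ring_nf
    rw [this]
    simp only [shift_apply]; push_cast; ring_nf
  · rw [glue_apply_of_eq_one (hu _ hp), glue_apply_of_eq_one]
    apply hv'
    rintro ⟨i, hi, hie⟩
    have hq : ⌊(p.1, p.2).2⌋ = ⌊p.2⌋ := rfl
    set q : Circle × ℝ := ((μ p).1, (μ p).2 - (e i - i : ℤ)) with hqd
    have hqi : ⌊q.2⌋ = i := by
      rw [hqd, Int.floor_sub_intCast, ← hie]; ring
    have hμq : μ q = μ p := by
      rw [hμ q (by rwa [hqi]), hqi, hqd]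
      simp
    rw [μ.injective hμq] at hqi
    exact hp (hqi ▸ hi)

end Annulus

namespace Annulus

open Set Pointwise Filter Topology

theorem exists_spread : ∃ α : AnnulusHomeo, ∀ p : Circle × ℝ, ⌊p.2⌋ % 8 ≤ 6 →
    α p = (p.1, p.2 + (8 * (⌊p.2⌋ / 8) : ℤ)) := by
  have hx : StrictMono fun i : ℤ => ((i + 8 * (i / 8) : ℤ) : ℝ) := fun i j h => by
    simp only [Int.cast_lt]; omega
  obtain ⟨e, he⟩ := exists_piecewiseAffine hx
    (fun y => ⟨max 0 ⌈y⌉, (Int.le_ceil y).trans (Int.cast_le.2 (by omega))⟩)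
    (fun y => ⟨min 0 ⌊y⌋, (Int.cast_le.2 (by omega)).trans (Int.floor_le y)⟩)
  refine ⟨vertical e, fun p hp => ?_⟩
  rw [vertical_apply, he]
  refine Prod.ext rfl ?_
  have h : (⌊p.2⌋ + 1 + 8 * ((⌊p.2⌋ + 1) / 8) : ℤ) = ⌊p.2⌋ + 8 * (⌊p.2⌋ / 8) + 1 := by omega
  simp only [h, Int.fract]
  push_cast
  ring

theorem exists_slide : ∃ ν : AnnulusHomeo, (∀ p : Circle × ℝ, ⌊p.2⌋ % 8 = 1 → ν p = shift 4 p) ∧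
    ∀ p : Circle × ℝ, ¬ ⌊p.2⌋ % 8 ≤ 6 → ν p = p := by
  let φ : ℤ → ℝ := fun r => if r = 0 then 0 else if r = 1 then 5 else (r + 28) / 5
  have hφ : ∀ r s : ℤ, 0 ≤ r → r < s → s ≤ 7 → φ r < φ s := by
    intro r s hr hrs hs
    have hs' : 0 < s := hr.trans_lt hrs
    interval_cases s <;> interval_cases r <;> norm_num [φ]
  have hφ0 : ∀ r : ℤ, 0 ≤ r → r ≤ 7 → 0 ≤ φ r ∧ φ r < 8 := by
    intro r hr hr'
    interval_cases r <;> norm_num [φ]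
  have hx : StrictMono fun i : ℤ => 8 * ((i / 8 : ℤ) : ℝ) + φ (i % 8) := fun i j h => by
    simp only
    rcases (Int.ediv_le_ediv (by norm_num : (0 : ℤ) < 8) h.le).eq_or_lt with h1 | h1
    · rw [h1]
      have := hφ (i % 8) (j % 8) (by omega) (by omega) (by omega)
      linarith
    · have h2 := (hφ0 (i % 8) (by omega) (by omega)).2
      have h3 := (hφ0 (j % 8) (by omega) (by omega)).1
      have h4 : (((i / 8 : ℤ) + 1 : ℤ) : ℝ) ≤ ((j / 8 : ℤ) : ℝ) := Int.cast_le.2 h1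
      push_cast at h4
      linarith
  have hzero : ∀ k : ℤ, 8 * (((8 * k) / 8 : ℤ) : ℝ) + φ ((8 * k) % 8) = 8 * k := fun k => by
    rw [show (8 * k) / 8 = k by omega, show (8 * k) % 8 = 0 by omega]
    simp [φ]
  obtain ⟨e, he⟩ := exists_piecewiseAffine hx
    (fun y => ⟨8 * max 0 ⌈y⌉, by
      rw [hzero]
      have h1 : y ≤ (max 0 ⌈y⌉ : ℤ) := (Int.le_ceil y).trans (Int.cast_le.2 (by omega))
      have h2 : (0 : ℝ) ≤ (max 0 ⌈y⌉ : ℤ) := Int.cast_nonneg (by omega)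
      linarith⟩)
    (fun y => ⟨8 * min 0 ⌊y⌋, by
      rw [hzero]
      have h1 : (min 0 ⌊y⌋ : ℤ) ≤ y := (Int.cast_le.2 (by omega)).trans (Int.floor_le y)
      have h2 : (min 0 ⌊y⌋ : ℤ) ≤ (0 : ℝ) := by exact_mod_cast (by omega : min 0 ⌊y⌋ ≤ 0)
      linarith⟩)
  have hdiv : ∀ i : ℤ, (i : ℝ) = 8 * ((i / 8 : ℤ) : ℝ) + ((i % 8 : ℤ) : ℝ) := fun i => by
    exact_mod_cast (Int.mul_ediv_add_emod i 8).symm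
  refine ⟨vertical e, fun p hp => Prod.ext rfl ?_, fun p hp => Prod.ext rfl ?_⟩
  · rw [vertical_apply, he, shift_apply, show (⌊p.2⌋ + 1) / 8 = ⌊p.2⌋ / 8 by omega,
      show (⌊p.2⌋ + 1) % 8 = 2 by omega, hp]
    have := hdiv ⌊p.2⌋
    rw [hp] at this
    rw [show φ 1 = 5 by norm_num [φ], show φ 2 = 6 by norm_num [φ], Int.fract]
    push_cast at this ⊢
    linear_combination -this
  · have hp' : ⌊p.2⌋ % 8 = 7 := by omega
    rw [vertical_apply, he, show (⌊p.2⌋ + 1) / 8 = ⌊p.2⌋ / 8 + 1 by omega,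
      show (⌊p.2⌋ + 1) % 8 = 0 by omega, hp']
    have := hdiv ⌊p.2⌋
    rw [hp'] at this
    rw [show φ 7 = 7 by norm_num [φ], show φ 0 = 0 by norm_num [φ], Int.fract]
    push_cast at this ⊢
    linear_combination -this

theorem commute_of_disjoint {Z ν : AnnulusHomeo} {S : Set (Circle × ℝ)} (hZ : ∀ p ∈ S, Z p = p)
    (hν : ∀ p ∉ S, ν p = p) : Z * ν = ν * Z := by
  refine Homeomorph.ext fun p => ?_
  rw [mul_apply, mul_apply]
  by_cases hp : p ∈ S
  · have : ν p ∈ S := by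
      by_contra h
      exact h ((ν.injective (hν _ h)).symm ▸ hp)
    rw [hZ _ this, hZ _ hp]
  · have : Z p ∉ S := fun h => hp (Z.injective (hZ _ h) ▸ h)
    rw [hν _ this, hν _ hp]

theorem two_pow_mul_odd_injective :
    Function.Injective fun p : ℕ × ℕ => (8 * (2 ^ p.1 * (2 * p.2 + 1)) + 1 : ℤ) := by
  have hv : ∀ p : ℕ × ℕ, padicValNat 2 (2 ^ p.1 * (2 * p.2 + 1)) = p.1 := fun p => by
    rw [padicValNat.mul (by positivity) (by positivity), padicValNat.prime_pow,
      padicValNat.eq_zero_of_not_dvd (by omega), add_zero]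
  rintro p q h
  have h' : 2 ^ p.1 * (2 * p.2 + 1) = 2 ^ q.1 * (2 * q.2 + 1) := by
    have h1 : (2 ^ p.1 * (2 * p.2 + 1) : ℤ) = 2 ^ q.1 * (2 * q.2 + 1) := by
      simp only at h; omega
    exact_mod_cast h1
  have h1 : p.1 = q.1 := by rw [← hv p, h', hv q]
  rw [h1] at h'
  have h2 := Nat.eq_of_mul_eq_mul_left (by positivity) h'
  exact Prod.ext h1 (by omega)

/-- The partial products of the entries of `f` at the indices `1, 9, 17, ...`. -/
def partialProd {K : Type*} [Group K] (f : ℤ → K) : ℕ → K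
  | 0 => f 1
  | l + 1 => f (8 * (l + 1) + 1) * partialProd f l

/-- The partial products of the entries of `f`, placed at the indices `1, 9, 17, ...`. -/
def partialFamily {K : Type*} [Group K] (f : ℤ → K) (j : ℤ) : K :=
  if 0 ≤ j ∧ j % 8 = 1 then partialProd f (j / 8).toNat else 1

theorem partialFamily_of_not {K : Type*} [Group K] {f : ℤ → K} {j : ℤ}
    (h : ¬ (0 ≤ j ∧ j % 8 = 1)) : partialFamily f j = 1 := if_neg h

theorem partialFamily_mul_inv {K : Type*} [Group K] {f : ℤ → K}
    (hf : ∀ i, ¬ (0 ≤ i ∧ i % 8 = 1) → f i = 1) :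
    partialFamily f * (fun j => partialFamily f (j - 8))⁻¹ = f := by
  funext j
  rw [Pi.mul_apply, Pi.inv_apply, mul_inv_eq_iff_eq_mul]
  by_cases h : 0 ≤ j ∧ j % 8 = 1
  · rw [partialFamily, if_pos h]
    rcases eq_or_ne j 1 with rfl | hj
    · rw [partialFamily_of_not (by omega), mul_one]
      rfl
    · rw [partialFamily, if_pos (by omega)]
      obtain ⟨l, hl⟩ : ∃ l : ℕ, j = 8 * (l + 1) + 1 := ⟨(j / 8 - 1).toNat, by omega⟩
      rw [show (j / 8).toNat = l + 1 by omega, show ((j - 8) / 8).toNat = l by omega, partialProd,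
        ← hl]
  · rw [partialFamily_of_not h, partialFamily_of_not (by omega), hf j h, mul_one]

theorem conj_shift_glue (k : ℤ) (u : ℤ → unitBand) :
    shift k * glue u * (shift k)⁻¹ = glue fun j => u (j - k) :=
  conj_glue (I := univ) (e := fun i => i + k) (fun p _ => by simp [shift_apply])
    (fun i hi => absurd trivial hi) (fun i _ => by simp)
    fun j hj => absurd ⟨j - k, trivial, by simp⟩ hj

theorem slide_conj {ν : AnnulusHomeo} (hν : ∀ p : Circle × ℝ, ⌊p.2⌋ % 8 = 1 → ν p = shift 4 p)
    (f : ℤ → unitBand) :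
    ν * glue (partialFamily f) * ν⁻¹ = shift 4 * glue (partialFamily f) * (shift 4)⁻¹ := by
  have h := conj_shift_glue 4 (partialFamily f)
  simp only [Int.cast_ofNat] at h
  rw [h]
  refine conj_glue (I := {i | i % 8 = 1}) (e := fun i => i + 4) (fun p hp => ?_)
    (fun i hi => partialFamily_of_not fun h => hi h.2) (fun i _ => by simp) fun j hj => ?_
  · rw [hν p hp]
    simp [shift_apply]
  · refine partialFamily_of_not fun h => hj ⟨j - 4, h.2, by simp⟩

theorem spread_pow {α : AnnulusHomeo} (hα : ∀ p : Circle × ℝ, ⌊p.2⌋ % 8 ≤ 6 →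
    α p = (p.1, p.2 + (8 * (⌊p.2⌋ / 8) : ℤ))) (n : ℕ) (p : Circle × ℝ) (hp : ⌊p.2⌋ % 8 ≤ 6) :
    (α ^ n) p = (p.1, p.2 + (8 * ((2 ^ n - 1) * (⌊p.2⌋ / 8)) : ℤ)) := by
  induction n with
  | zero => simp
  | succ n ih =>
    rw [pow_succ', mul_apply, ih]
    have h : ⌊p.2 + (8 * ((2 ^ n - 1) * (⌊p.2⌋ / 8)) : ℤ)⌋ =
        ⌊p.2⌋ + 8 * ((2 ^ n - 1) * (⌊p.2⌋ / 8)) := Int.floor_add_intCast _ _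
    have h8 : (⌊p.2⌋ + 8 * ((2 ^ n - 1) * (⌊p.2⌋ / 8))) / 8 = 2 ^ n * (⌊p.2⌋ / 8) := by
      rw [Int.add_mul_ediv_left _ _ (by norm_num)]; ring
    rw [hα _ (by simp only [h]; rwa [Int.add_mul_emod_self_left])]
    simp only [h, h8]
    refine Prod.ext rfl ?_
    push_cast
    ring

theorem spread_shift_spread {α : AnnulusHomeo} (hα : ∀ p : Circle × ℝ, ⌊p.2⌋ % 8 ≤ 6 →
    α p = (p.1, p.2 + (8 * (⌊p.2⌋ / 8) : ℤ))) (n : ℕ) (p : Circle × ℝ) (hp : ⌊p.2⌋ % 8 ≤ 6) :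
    (α ^ n * shift 8 * α) p =
      (p.1, p.2 + (8 * (2 ^ n * (2 * (⌊p.2⌋ / 8) + 1)) + ⌊p.2⌋ % 8 - ⌊p.2⌋ : ℤ)) := by
  rw [mul_apply, mul_apply, hα p hp, shift_apply]
  have h : ⌊p.2 + (8 * (⌊p.2⌋ / 8) : ℤ) + 8⌋ = ⌊p.2⌋ + 8 * (⌊p.2⌋ / 8 + 1) := by
    rw [show p.2 + (8 * (⌊p.2⌋ / 8) : ℤ) + 8 = p.2 + (8 * (⌊p.2⌋ / 8 + 1) : ℤ) by
      push_cast; ring, Int.floor_add_intCast]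
  have h8 : (⌊p.2⌋ + 8 * (⌊p.2⌋ / 8 + 1)) / 8 = 2 * (⌊p.2⌋ / 8) + 1 := by omega
  rw [spread_pow hα n _ (by simp only [h]; omega)]
  simp only [h, h8]
  refine Prod.ext rfl ?_
  have h3 : (⌊p.2⌋ : ℝ) = 8 * ((⌊p.2⌋ / 8 : ℤ) : ℝ) + ((⌊p.2⌋ % 8 : ℤ) : ℝ) := by
    exact_mod_cast (Int.mul_ediv_add_emod ⌊p.2⌋ 8).symm
  push_cast
  linear_combination h3

end Annulus

namespace Annulus

open Set Pointwise Filter Topology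

/-- The conjugate of `glue (partialFamily (f n))` by the `n`-th spreading map is the part of a
single homeomorphism `R`, independent of `n`, inside the image of the bands not congruent to `7`
modulo `8`. -/
theorem exists_universal (f : ℕ → ℤ → unitBand) {α : AnnulusHomeo}
    (hα : ∀ p : Circle × ℝ, ⌊p.2⌋ % 8 ≤ 6 → α p = (p.1, p.2 + (8 * (⌊p.2⌋ / 8) : ℤ))) :
    ∃ R : AnnulusHomeo, ∀ n, ∃ Z : AnnulusHomeo, (∀ p : Circle × ℝ, ⌊p.2⌋ % 8 ≤ 6 → Z p = p) ∧
      (α ^ n * shift 8 * α)⁻¹ * R * (α ^ n * shift 8 * α) = glue (partialFamily (f n)) * Z := by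
  classical
  let c : ℕ × ℕ → unitBand := fun p => partialProd (f p.1) p.2
  let r : ℤ → unitBand := Function.extend
    (fun p : ℕ × ℕ => (8 * (2 ^ p.1 * (2 * p.2 + 1)) + 1 : ℤ)) c 1
  refine ⟨glue r, fun n => ?_⟩
  let I : Set ℤ := {i | i % 8 ≤ 6}
  let e : ℤ → ℤ := fun i => 8 * (2 ^ n * (2 * (i / 8) + 1)) + i % 8
  set W := α ^ n * shift 8 * α with hW
  have hWp : ∀ p : Circle × ℝ, ⌊p.2⌋ ∈ I → W p = (p.1, p.2 + (e ⌊p.2⌋ - ⌊p.2⌋ : ℤ)) := fun p hp =>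
    spread_shift_spread hα n p hp
  have hre : ∀ i ∈ I, r (e i) = partialFamily (f n) i := by
    intro i _
    by_cases h : 0 ≤ i ∧ i % 8 = 1
    · rw [partialFamily, if_pos h]
      have : e i = 8 * (2 ^ n * (2 * ((i / 8).toNat : ℤ) + 1)) + 1 := by
        simp only [e, h.2]
        rw [Int.toNat_of_nonneg (by omega)]
      rw [this]
      exact two_pow_mul_odd_injective.extend_apply c 1 (n, (i / 8).toNat)
    · rw [partialFamily_of_not h]
      refine Function.extend_apply' _ _ _ ?_
      rintro ⟨⟨m, k⟩, hmk⟩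
      simp only [e] at hmk
      have h1 : i % 8 = 1 := by omega
      have h2 : (2 ^ n * (2 * (i / 8) + 1) : ℤ) = 2 ^ m * (2 * k + 1) := by omega
      have h3 : (0 : ℤ) < 2 ^ n * (2 * (i / 8) + 1) := by rw [h2]; positivity
      have h4 : 0 < 2 * (i / 8) + 1 := pos_of_mul_pos_right h3 (by positivity)
      omega
  let r₁ : ℤ → unitBand := fun j => if j ∈ e '' I then r j else 1
  let r₂ : ℤ → unitBand := fun j => if j ∈ e '' I then 1 else r j
  have hr : r = r₁ * r₂ := by
    funext j
    simp only [Pi.mul_apply, r₁, r₂]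
    split_ifs <;> simp
  have hconj : W * glue (partialFamily (f n)) * W⁻¹ = glue r₁ :=
    conj_glue hWp (fun i hi => partialFamily_of_not fun h => hi (by
      show i % 8 ≤ 6
      omega)) (fun i hi => by
        simp only [r₁]
        rw [if_pos (mem_image_of_mem e hi), hre i hi]) fun j hj => if_neg hj
  refine ⟨W⁻¹ * glue r₂ * W, fun p hp => ?_, ?_⟩
  · rw [mul_apply, mul_apply, glue_apply_of_eq_one, inv_apply_self]
    have : ⌊(W p).2⌋ = e ⌊p.2⌋ := by
      rw [hWp p hp, Int.floor_add_intCast]; ring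
    rw [this]
    exact if_pos (show e ⌊p.2⌋ ∈ e '' I from mem_image_of_mem e hp)
  · rw [hr, map_mul, ← hconj]
    group

theorem commutator_mul {G : Type*} [Group G] {P Z ν : G} (h : Z * ν = ν * Z) :
    P * Z * ν * (P * Z)⁻¹ * ν⁻¹ = P * ν * P⁻¹ * ν⁻¹ := by
  rw [mul_assoc P Z ν, h]
  group

theorem mul_telescope {G : Type*} [Group G] (P t : G) :
    P * (t * P * t⁻¹)⁻¹ * (t * (P * (t * P * t⁻¹)⁻¹) * t⁻¹) = P * (t * t * P * (t * t)⁻¹)⁻¹ := by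
  simp only [mul_inv_rev, inv_inv, mul_assoc, inv_mul_cancel_left]

theorem uniformlyDistorted_glue_residue : UniformlyDistorted {g : ℕ → AnnulusHomeo |
    ∃ f : ℕ → ℤ → unitBand, (∀ n i, ¬ (0 ≤ i ∧ i % 8 = 1) → f n i = 1) ∧
      ∀ n, g n = glue (f n)} := by
  obtain ⟨α, hα⟩ := exists_spread
  obtain ⟨ν, hν, hν'⟩ := exists_slide
  let C : Set (ℕ → AnnulusHomeo) := range fun φ _ => φ
  let W : Set (ℕ → AnnulusHomeo) := (range fun φ n => φ ^ n) * C * C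
  let U : Set (ℕ → AnnulusHomeo) := W⁻¹ * C * W
  let D : Set (ℕ → AnnulusHomeo) := U * C * U⁻¹ * C
  have hC : UniformlyDistorted C := uniformlyDistorted_const
  have hW : UniformlyDistorted W := ((uniformlyDistorted_pow _).mul hC).mul hC
  have hU : UniformlyDistorted U := (hW.inv.mul hC).mul hW
  have hD : UniformlyDistorted D := ((hU.mul hC).mul hU.inv).mul hC
  refine (hD.mul ((hC.mul hD).mul hC)).mono ?_
  rintro g ⟨f, hf, hg⟩
  obtain ⟨R, hR⟩ := exists_universal f hα
  choose Z hZ hRZ using hR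
  let w : ℕ → AnnulusHomeo := fun n => α ^ n * shift 8 * α
  have hw : w ∈ W := mul_mem_mul (mul_mem_mul ⟨α, rfl⟩ ⟨shift 8, rfl⟩) ⟨α, rfl⟩
  let u : ℕ → AnnulusHomeo := fun n => (w n)⁻¹ * R * w n
  have hu : u ∈ U := mul_mem_mul (mul_mem_mul (Set.inv_mem_inv.2 hw) ⟨R, rfl⟩) hw
  let d : ℕ → AnnulusHomeo := fun n => u n * ν * (u n)⁻¹ * ν⁻¹
  have hd : d ∈ D := mul_mem_mul (mul_mem_mul (mul_mem_mul hu ⟨ν, rfl⟩) (Set.inv_mem_inv.2 hu))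
    ⟨ν⁻¹, rfl⟩
  have : g = d * ((fun _ => shift 4) * d * fun _ => (shift 4)⁻¹) := by
    funext n
    have hdn : d n = glue (partialFamily (f n)) *
        (shift 4 * glue (partialFamily (f n)) * (shift 4)⁻¹)⁻¹ := by
      have h1 : d n = glue (partialFamily (f n)) * ν * (glue (partialFamily (f n)))⁻¹ * ν⁻¹ := by
        simp only [d, u, w]
        rw [hRZ n]
        exact commutator_mul (commute_of_disjoint (hZ n) hν')
      rw [h1, ← slide_conj hν]
      group
    have h48 : shift 4 * shift 4 = shift ((8 : ℤ) : ℝ) := by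
      rw [shift_mul]; norm_num
    have h8 := conj_shift_glue 8 (partialFamily (f n))
    rw [← h48] at h8
    simp only [Pi.mul_apply]
    rw [hdn, mul_telescope, h8, ← map_inv, ← map_mul, partialFamily_mul_inv (hf n), hg n]
  rw [this]
  exact mul_mem_mul hd (mul_mem_mul (mul_mem_mul ⟨shift 4, rfl⟩ hd) ⟨_, rfl⟩)

theorem uniformlyDistorted_glue : UniformlyDistorted {g : ℕ → AnnulusHomeo |
    ∃ f : ℕ → ℤ → unitBand, (∀ n i, i < 0 → f n i = 1) ∧ ∀ n, g n = glue (f n)} := by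
  have key : ∀ k : ℕ, UniformlyDistorted {g : ℕ → AnnulusHomeo |
      ∃ f : ℕ → ℤ → unitBand, (∀ n (i : ℤ), ¬ (0 ≤ i ∧ i % 8 < (k : ℤ)) → f n i = 1) ∧
        ∀ n, g n = glue (f n)} := by
    intro k
    induction k with
    | zero =>
      refine (uniformlyDistorted_const (G := AnnulusHomeo)).mono ?_
      rintro g ⟨f, hf, hg⟩
      refine ⟨1, funext fun n => ?_⟩
      rw [hg n, show f n = 1 from funext fun i => hf n i (by push_cast; omega), map_one]
    | succ k ih =>
      have hC := uniformlyDistorted_const (G := AnnulusHomeo)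
      refine (ih.mul ((hC.mul uniformlyDistorted_glue_residue).mul hC)).mono ?_
      rintro g ⟨f, hf, hg⟩
      let f₁ : ℕ → ℤ → unitBand := fun n i => if i % 8 < k then f n i else 1
      let f₂ : ℕ → ℤ → unitBand := fun n i => if i % 8 < k then 1 else f n i
      have hf12 : ∀ n, f n = f₁ n * f₂ n := fun n => funext fun i => by
        simp only [f₁, f₂, Pi.mul_apply]
        split_ifs <;> simp
      have hg' : g = (fun n => glue (f₁ n)) * ((fun _ => shift ((k - 1 : ℤ) : ℝ)) *
          (fun n => glue fun j => f₂ n (j + (k - 1))) * fun _ => (shift ((k - 1 : ℤ) : ℝ))⁻¹) := by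
        funext n
        have h := conj_shift_glue (k - 1) fun j => f₂ n (j + (k - 1))
        simp only [sub_add_cancel] at h
        simp only [Pi.mul_apply]
        rw [h, hg n, hf12 n, map_mul]
      rw [hg']
      refine mul_mem_mul ⟨f₁, fun n i hi => ?_, fun _ => rfl⟩
        (mul_mem_mul (mul_mem_mul ⟨_, rfl⟩ ⟨fun n j => f₂ n (j + (k - 1)), fun n i hi => ?_,
          fun _ => rfl⟩) ⟨_, rfl⟩)
      · simp only [f₁]
        split_ifs with h
        · exact hf n i (by push_cast; omega)
        · rfl
      · simp only [f₂]
        split_ifs with h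
        · rfl
        · exact hf n _ (by push_cast; omega)
  refine (key 8).mono ?_
  rintro g ⟨f, hf, hg⟩
  exact ⟨f, fun n i hi => hf n i (by omega), hg⟩

end Annulus

namespace Annulus

open Set Pointwise Filter Topology
open scoped Real

/-- The reflection of the annulus exchanging the ends. -/
noncomputable def reflect : AnnulusHomeo := vertical (Homeomorph.neg ℝ)

theorem reflect_apply (p : Circle × ℝ) : reflect p = (p.1, -p.2) := rfl

theorem reflect_mul_reflect : reflect * reflect = 1 :=
  Homeomorph.ext fun p => by simp [reflect_apply]

theorem circleFlip_mul_circleFlip : circleFlip * circleFlip = (1 : AnnulusHomeo) :=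
  Homeomorph.ext fun p => by simp

theorem PreservesEnds.mul {g h : AnnulusHomeo} (hg : PreservesEnds g) (hh : PreservesEnds h) :
    PreservesEnds (g * h) := hh.trans hg

theorem PreservesEnds.inv {g : AnnulusHomeo} (hg : PreservesEnds g) : PreservesEnds g⁻¹ := hg.symm

theorem preservesEnds_of_snd_eq {g : AnnulusHomeo} (hg : ∀ p, (g p).2 = p.2) : PreservesEnds g :=
  ⟨fun N => ⟨N, fun p hp => by rwa [hg]⟩, fun N => ⟨N, fun p hp => by rwa [hg]⟩⟩

theorem preservesEnds_shift (s : ℝ) : PreservesEnds (shift s) :=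
  ⟨fun N => ⟨N - s, fun p hp => by rw [shift_apply]; simp only; linarith⟩,
    fun N => ⟨N - s, fun p hp => by rw [shift_apply]; simp only; linarith⟩⟩

theorem preservesEnds_reflect_conj {g : AnnulusHomeo} (hg : PreservesEnds g) :
    PreservesEnds (reflect * g * reflect) := by
  constructor
  · intro N
    obtain ⟨M, hM⟩ := hg.2 (-N)
    refine ⟨-M, fun p hp => ?_⟩
    have := hM (reflect p) (by rw [reflect_apply]; simp only; linarith)
    rw [mul_apply, mul_apply, reflect_apply]
    simp only; linarith
  · intro N
    obtain ⟨M, hM⟩ := hg.1 (-N)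
    refine ⟨-M, fun p hp => ?_⟩
    have := hM (reflect p) (by rw [reflect_apply]; simp only; linarith)
    rw [mul_apply, mul_apply, reflect_apply]
    simp only; linarith

theorem PreservesEnds.of_eq {g h k : AnnulusHomeo} (hg : PreservesEnds g) (hk : PreservesEnds k)
    {N M : ℝ} (hN : ∀ p, p.2 ≤ N → h p = k p) (hM : ∀ p, M ≤ p.2 → h p = g p) :
    PreservesEnds h := by
  constructor
  · intro B
    obtain ⟨A, hA⟩ := hk.1 B
    refine ⟨min A N, fun p hp => ?_⟩
    rw [hN p (hp.trans (min_le_right _ _))]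
    exact hA p (hp.trans (min_le_left _ _))
  · intro B
    obtain ⟨A, hA⟩ := hg.2 B
    refine ⟨max A M, fun p hp => ?_⟩
    rw [hM p ((le_max_right _ _).trans hp)]
    exact hA p ((le_max_left _ _).trans hp)

theorem isPreconnected_fiber {s : Set ℝ} (hs : IsPreconnected s) :
    IsPreconnected {p : Circle × ℝ | p.2 ∈ s} := by
  have : {p : Circle × ℝ | p.2 ∈ s} = univ ×ˢ s := by ext; simp
  rw [this]
  exact isPreconnected_univ.prod hs

theorem exists_forall_lt_abs (g : AnnulusHomeo) (N : ℝ) :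
    ∃ M, ∀ p : Circle × ℝ, M < |p.2| → N < |(g p).2| := by
  obtain ⟨A, hA⟩ := exists_bound_of_isCompact ((isCompact_band (-N) N).image g.symm.continuous)
  refine ⟨A, fun p hp => ?_⟩
  by_contra! h
  have := hA (g.symm (g p)) (mem_image_of_mem _ (abs_le.1 h))
  rw [g.symm_apply_apply] at this
  linarith

theorem snd_pos_or_neg {g : AnnulusHomeo} {s : Set ℝ} (hs : IsPreconnected s)
    (h : ∀ p : Circle × ℝ, p.2 ∈ s → 0 < |(g p).2|) :
    (∀ p : Circle × ℝ, p.2 ∈ s → 0 < (g p).2) ∨ ∀ p : Circle × ℝ, p.2 ∈ s → (g p).2 < 0 := by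
  by_contra! hcon
  obtain ⟨⟨p, hp, hp'⟩, q, hq, hq'⟩ := hcon
  obtain ⟨r, hr, hr0⟩ := ((isPreconnected_fiber hs).image (fun p => (g p).2)
    (continuous_snd.comp g.continuous).continuousOn).ordConnected.out
      (mem_image_of_mem _ hp) (mem_image_of_mem _ hq) ⟨hp', hq'⟩
  have := h r hr
  rw [show (g r).2 = 0 from hr0, abs_zero] at this
  exact lt_irrefl _ this

theorem preservesEnds_of_pos {g : AnnulusHomeo} {M : ℝ} (hM : ∀ p : Circle × ℝ, M < |p.2| →
    0 < |(g p).2|) (hpos : ∀ p : Circle × ℝ, p.2 ∈ Ioi M → 0 < (g p).2) : PreservesEnds g := by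
  have hneg : ∀ p : Circle × ℝ, p.2 ∈ Iio (-M) → (g p).2 < 0 := by
    refine (snd_pos_or_neg (g := g) isPreconnected_Iio fun p hp => hM p
      (lt_abs.2 (Or.inr (lt_neg_of_lt_neg hp)))).resolve_left fun h => ?_
    obtain ⟨A, hA⟩ := exists_bound_of_isCompact ((isCompact_band (-M) M).image g.continuous)
    set q : Circle × ℝ := (1, min (-1) (-A - 1))
    have hq1 : q.2 ≤ -1 := min_le_left _ _
    have hq2 : q.2 ≤ -A - 1 := min_le_right _ _
    have hgq : g (g.symm q) = q := g.apply_symm_apply q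
    rcases lt_or_ge M (g.symm q).2 with h1 | h1
    · have := hpos _ h1
      rw [hgq] at this; linarith
    · rcases lt_or_ge (g.symm q).2 (-M) with h2 | h2
      · have := h _ h2
        rw [hgq] at this; linarith
      · have := hA (g (g.symm q)) (mem_image_of_mem _ ⟨h2, h1⟩)
        rw [hgq, abs_le] at this; linarith
  constructor
  · intro N
    obtain ⟨B, hB⟩ := exists_forall_lt_abs g |N|
    refine ⟨min (-M - 1) (-|B| - 1), fun p hp => ?_⟩
    have h1 := hneg p (by
      have := hp.trans (min_le_left _ _)
      simp only [mem_Iio]; linarith)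
    have h2 := hB p (by
      have := hp.trans (min_le_right _ _)
      have := le_abs_self B
      exact lt_abs.2 (Or.inr (by linarith)))
    rw [abs_of_neg h1] at h2
    linarith [neg_abs_le N]
  · intro N
    obtain ⟨B, hB⟩ := exists_forall_lt_abs g |N|
    refine ⟨max (M + 1) (|B| + 1), fun p hp => ?_⟩
    have h1 := hpos p (by
      have := (le_max_left _ _).trans hp
      simp only [mem_Ioi]; linarith)
    have h2 := hB p (by
      have := (le_max_right _ _).trans hp
      have := le_abs_self B
      exact lt_abs.2 (Or.inl (by linarith)))
    rw [abs_of_pos h1] at h2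
    linarith [le_abs_self N]

theorem preservesEnds_or (g : AnnulusHomeo) : PreservesEnds g ∨ PreservesEnds (reflect * g) := by
  obtain ⟨M, hM⟩ := exists_forall_lt_abs g 0
  rcases snd_pos_or_neg (g := g) isPreconnected_Ioi fun p (hp : M < p.2) =>
    hM p (lt_abs.2 (Or.inl hp)) with h | h
  · exact Or.inl (preservesEnds_of_pos hM h)
  · refine Or.inr (preservesEnds_of_pos (M := M) (fun p hp => ?_) fun p hp => ?_)
    · rw [mul_apply, reflect_apply, abs_neg]
      exact hM p hp
    · rw [mul_apply, reflect_apply]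
      exact neg_pos.2 (h p hp)

theorem exists_standard_below {g : AnnulusHomeo} (hg : PreservesEnds g) (T : ℝ) :
    ∃ (h σ : AnnulusHomeo) (N : ℝ), (σ = 1 ∨ σ = circleFlip) ∧
      (∀ p, T ≤ p.2 → h p = g p) ∧ ∀ p, p.2 ≤ N → h p = σ p := by
  obtain ⟨h, σ, N, hσ, h1, h2⟩ := exists_standard_below_zero
    (((preservesEnds_shift (-T)).mul hg).mul (preservesEnds_shift T))
  refine ⟨shift T * h * shift (-T), σ, N + T, hσ, fun p hp => ?_, fun p hp => ?_⟩
  · rw [mul_apply, mul_apply, h1 _ (by rw [shift_apply]; simp only; linarith)]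
    simp [shift_apply]
  · rw [mul_apply, mul_apply, h2 _ (by rw [shift_apply]; simp only; linarith)]
    rcases hσ with rfl | rfl <;> simp [shift_apply]

/-- There is no homotopy from the identity of the circle to the inversion. -/
theorem not_id_and_circleFlip {h : AnnulusHomeo} {N M : ℝ} (hN : ∀ p, p.2 ≤ N → h p = p)
    (hM : ∀ p, M ≤ p.2 → h p = circleFlip p) : False := by
  let H : C(ℝ × ℝ, Circle) := ⟨fun q => (h (Circle.exp q.1, q.2)).1, by fun_prop⟩
  obtain ⟨e, he⟩ := Circle.exp_surjective (H 0)
  obtain ⟨L, ⟨-, hL⟩, -⟩ := Circle.isCoveringMap_exp.existsUnique_continuousMap_lifts H 0 e he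
  have hL' : ∀ x t, Circle.exp (L (x, t)) = (h (Circle.exp x, t)).1 := fun x t => congrFun hL (x, t)
  obtain ⟨m, hm⟩ := Circle.exp_eq_exp.1 (
    show Circle.exp (L (0 + 2 * π, 0)) = Circle.exp (L (0, 0)) by
      rw [hL', hL', Circle.exp_add_two_pi])
  have hall : ∀ q : ℝ × ℝ, L (q.1 + 2 * π, q.2) = L q + m * (2 * π) := fun q =>
    congrFun (Circle.isCoveringMap_exp.eq_of_comp_eq
      (show Continuous fun q : ℝ × ℝ => L (q.1 + 2 * π, q.2) by fun_prop)
      (show Continuous fun q : ℝ × ℝ => L q + m * (2 * π) by fun_prop) (funext fun q => by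
        simp only [Function.comp]
        rw [hL', Circle.exp_add_two_pi]
        have := hL' q.1 q.2
        rw [← this]
        exact (Circle.exp_eq_exp.2 ⟨m, rfl⟩).symm) 0 hm) q
  obtain ⟨j, hj⟩ := exists_int_of_exp_eq (f := fun x => L (x, N)) (g := id) (by fun_prop)
    continuous_id fun x => by rw [hL', hN _ le_rfl]; rfl
  obtain ⟨k, hk⟩ := exists_int_of_exp_eq (f := fun x => L (x, M)) (g := fun x => -x) (by fun_prop)
    continuous_neg fun x => by rw [hL', hM _ le_rfl, Circle.exp_neg]; rfl
  have h1 := hall (0, N)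
  have h2 := hall (0, M)
  have e1 := hj (0 + 2 * π)
  have e2 := hj 0
  have e3 := hk (0 + 2 * π)
  have e4 := hk 0
  simp only [id] at h1 h2 e1 e2 e3 e4
  linarith [Real.pi_pos]

end Annulus

namespace Annulus

open Set Pointwise Filter Topology

theorem PreservesEnds.lt_snd {a : AnnulusHomeo} (ha : PreservesEnds a) {s t : ℝ}
    (h : ∀ p : Circle × ℝ, p.2 = t → s < (a p).2) (p : Circle × ℝ) (hp : t ≤ p.2) :
    s < (a p).2 := by
  by_contra! hs
  obtain ⟨B, hB⟩ := ha.inv.1 t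
  obtain ⟨q, hq, hqt⟩ := ((isPreconnected_fiber isPreconnected_Iic).image (fun q => (a⁻¹ q).2)
    (continuous_snd.comp (a⁻¹ : AnnulusHomeo).continuous).continuousOn).ordConnected.out
      (mem_image_of_mem _ (show ((1 : Circle), min B s).2 ∈ Iic s from min_le_right B s))
      (mem_image_of_mem _ (show (a p).2 ∈ Iic s from hs))
      ⟨hB (1, min B s) (min_le_left _ _), by simpa only [inv_apply_self] using hp⟩
  have := h (a⁻¹ q) hqt
  rw [apply_inv_self] at this
  exact (not_lt.2 hq) this

theorem reflect_conj_apply (a : AnnulusHomeo) (p : Circle × ℝ) :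
    (reflect * a * reflect) p = reflect (a (reflect p)) := rfl

theorem reflect_reflect (p : Circle × ℝ) : reflect (reflect p) = p := by
  simp [reflect_apply]

theorem PreservesEnds.snd_lt {a : AnnulusHomeo} (ha : PreservesEnds a) {s t : ℝ}
    (h : ∀ p : Circle × ℝ, p.2 = t → (a p).2 < s) (p : Circle × ℝ) (hp : p.2 ≤ t) :
    (a p).2 < s := by
  have := (preservesEnds_reflect_conj ha).lt_snd (s := -s) (t := -t) (fun p hp => by
    rw [reflect_conj_apply, reflect_apply (a _)]
    exact neg_lt_neg (h _ (by rw [reflect_apply, hp, neg_neg]))) (reflect p)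
      (by rw [reflect_apply]; exact neg_le_neg hp)
  rw [reflect_conj_apply, reflect_reflect, reflect_apply] at this
  exact neg_lt_neg_iff.1 this

/-- A homeomorphism which agrees near the upper end with one that is trivial near the lower end. -/
def Oriented (a : AnnulusHomeo) : Prop :=
  PreservesEnds a ∧ ∃ (h : AnnulusHomeo) (N M : ℝ), (∀ p, p.2 ≤ N → h p = p) ∧
    ∀ p, M ≤ p.2 → h p = a p

theorem exists_compress {N₀ N q : ℝ} (h₀ : N₀ < N) (hq : N < q) :
    ∃ φ : ℝ ≃ₜ ℝ, StrictMono φ ∧ (∀ t, q ≤ t → φ t = t) ∧ φ N₀ = N := by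
  set c := (q - N) / (q - N₀) with hc
  have hc0 : 0 < c := div_pos (by linarith) (by linarith)
  have hc1 : c < 1 := (div_lt_one (by linarith)).2 (by linarith)
  have hcm : c * (q - N₀) = q - N := div_mul_cancel₀ _ (by linarith)
  have hge : ∀ t, q ≤ t → max t (q + (t - q) * c) = t := fun t ht => max_eq_left (by nlinarith)
  have hm : StrictMono fun t => max t (q + (t - q) * c) :=
    fun s t hst => max_lt_max hst (by nlinarith)
  obtain ⟨φ, hφ⟩ := exists_homeomorph_of_strictMono hm fun y => by
      rcases le_total q y with hy | hy
      · exact ⟨y, hge y hy⟩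
      · refine ⟨q + (y - q) / c, ?_⟩
        simp only [add_sub_cancel_left]
        rw [div_mul_cancel₀ _ hc0.ne', add_sub_cancel]
        refine max_eq_right ?_
        have : (y - q) / c ≤ y - q := by
          rw [div_le_iff₀ hc0]; nlinarith
        linarith
  refine ⟨φ, hφ ▸ hm, fun t ht => by rw [hφ]; exact hge t ht, ?_⟩
  rw [hφ]
  exact (max_eq_right (by nlinarith)).trans (by nlinarith)

theorem Oriented.exists_id_below {a : AnnulusHomeo} (ha : Oriented a) {N T : ℝ} (hNT : N < T)
    (haT : ∀ p : Circle × ℝ, T ≤ p.2 → N < (a p).2) :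
    ∃ h : AnnulusHomeo, (∀ p, T ≤ p.2 → h p = a p) ∧ ∀ p, p.2 ≤ N → h p = p := by
  obtain ⟨hpe, h₁, N₁, M₁, hN₁, hM₁⟩ := ha
  obtain ⟨h₀, σ, N₀, hσ, hT₀, hN₀⟩ := exists_standard_below hpe T
  obtain rfl : σ = 1 := hσ.resolve_right fun hσ => by
    subst hσ
    refine not_id_and_circleFlip (h := circleFlip * (h₁⁻¹ * h₀)) (N := min N₀ N₁) (M := max T M₁)
      (fun p hp => ?_) fun p hp => ?_
    · rw [mul_apply, mul_apply, hN₀ p (hp.trans (min_le_left _ _)),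
        inv_apply_eq (hN₁ (circleFlip p) (hp.trans (min_le_right _ _))), ← mul_apply,
        circleFlip_mul_circleFlip, one_apply]
    · rw [mul_apply, mul_apply, hT₀ p ((le_max_left _ _).trans hp),
        inv_apply_eq (hM₁ p ((le_max_right _ _).trans hp))]
  obtain ⟨M, hM⟩ := hpe.2 T
  obtain ⟨r, ⟨hr, -⟩, hmin⟩ := (isCompact_band T (max M T)).exists_isMinOn (f := fun p => (a p).2)
    ⟨(1, T), le_refl T, le_max_right _ _⟩ (continuous_snd.comp a.continuous).continuousOn
  obtain ⟨φ, hmono, hφ, hφN⟩ := exists_compress (N₀ := min N₀ (N - 1)) (N := N) (q := min (a r).2 T)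
    ((min_le_right _ _).trans_lt (by linarith)) (lt_min (haT r hr) hNT)
  have hlow : ∀ p : Circle × ℝ, T ≤ p.2 → min (a r).2 T ≤ (a p).2 := fun p hp => by
    rcases le_total p.2 (max M T) with h | h
    · exact (min_le_left _ _).trans (hmin ⟨hp, h⟩)
    · exact (min_le_right _ _).trans (hM p ((le_max_left _ _).trans h))
  have hfix : ∀ p : Circle × ℝ, min (a r).2 T ≤ p.2 → vertical φ p = p := fun p hp => by
    rw [vertical_apply, hφ _ hp]
  refine ⟨vertical φ * h₀ * (vertical φ)⁻¹, fun p hp => ?_, fun p hp => ?_⟩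
  · rw [mul_apply, mul_apply, inv_apply_eq (hfix p ((min_le_right _ _).trans hp)), hT₀ p hp,
      hfix _ (hlow p hp)]
  · rw [mul_apply, mul_apply, hN₀, one_apply, apply_inv_self]
    have : (vertical φ)⁻¹ p = (p.1, φ.symm p.2) := inv_apply_eq (by simp [vertical_apply])
    rw [this]
    refine (hmono.le_iff_le.1 ?_).trans (min_le_left N₀ (N - 1))
    rwa [φ.apply_symm_apply, hφN]

theorem Oriented.exists_id_above {a : AnnulusHomeo} (ha : Oriented (reflect * a * reflect))
    {M T : ℝ} (hTM : T < M) (haT : ∀ p : Circle × ℝ, p.2 ≤ T → (a p).2 < M) :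
    ∃ h : AnnulusHomeo, (∀ p, p.2 ≤ T → h p = a p) ∧ ∀ p, M ≤ p.2 → h p = p := by
  obtain ⟨h, hh, hM⟩ := ha.exists_id_below (N := -M) (T := -T) (neg_lt_neg hTM) fun p hp => by
    rw [reflect_conj_apply, reflect_apply (a _)]
    exact neg_lt_neg (haT _ (by rw [reflect_apply]; exact neg_le.1 hp))
  refine ⟨reflect * h * reflect, fun p hp => ?_, fun p hp => ?_⟩
  · rw [reflect_conj_apply, hh _ (by rw [reflect_apply]; exact neg_le_neg hp), reflect_conj_apply,
      reflect_reflect, reflect_reflect]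
  · rw [reflect_conj_apply, hM _ (by rw [reflect_apply]; exact neg_le_neg hp), reflect_reflect]

/-- The homeomorphisms preserving the ends which are trivial near the lower end. -/
def lowerTrivial : Subgroup AnnulusHomeo where
  carrier := {a | PreservesEnds a ∧ ∃ N, ∀ p : Circle × ℝ, p.2 ≤ N → a p = p}
  mul_mem' := by
    rintro a b ⟨ha, N, hN⟩ ⟨hb, M, hM⟩
    refine ⟨ha.mul hb, min N M, fun p hp => ?_⟩
    rw [mul_apply, hM p (hp.trans (min_le_right _ _)), hN p (hp.trans (min_le_left _ _))]
  one_mem' := ⟨preservesEnds_of_snd_eq fun _ => rfl, 0, fun _ _ => rfl⟩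
  inv_mem' := fun ⟨ha, N, hN⟩ => ⟨ha.inv, N, fun p hp => inv_apply_eq (hN p hp)⟩

theorem oriented_of_mem {a : AnnulusHomeo} (ha : a ∈ lowerTrivial) : Oriented a :=
  ⟨ha.1, a, ha.2.choose, 0, ha.2.choose_spec, fun _ _ => rfl⟩

theorem oriented_reflect_conj_of_mem {a : AnnulusHomeo} (ha : a ∈ lowerTrivial) :
    Oriented (reflect * a * reflect) := by
  obtain ⟨ha, N, hN⟩ := ha
  refine ⟨preservesEnds_reflect_conj ha, 1, 0, -N, fun _ _ => rfl, fun p hp => ?_⟩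
  rw [reflect_conj_apply, hN _ (by rw [reflect_apply]; exact neg_le.1 hp), reflect_reflect,
    one_apply]

/-- The action on a circle extends to a homeomorphism supported in a band around it. -/
theorem exists_localized {a : AnnulusHomeo} (ha : a ∈ lowerTrivial) {s t s' : ℝ} (hs : s < t)
    (hs' : t < s') (h : ∀ p : Circle × ℝ, p.2 = t → s < (a p).2 ∧ (a p).2 < s') :
    ∃ u : AnnulusHomeo, (∀ p, p.2 = t → u p = a p) ∧ ∀ p, p.2 ≤ s ∨ s' ≤ p.2 → u p = p := by
  obtain ⟨v, hv, hvs⟩ := (oriented_of_mem ha).exists_id_below hs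
    (ha.1.lt_snd fun p hp => (h p hp).1)
  obtain ⟨w, hw, hws⟩ := (oriented_reflect_conj_of_mem ha).exists_id_above hs'
    (ha.1.snd_lt fun p hp => (h p hp).2)
  have key : ∀ p : Circle × ℝ, t ≤ p.2 → (w * a⁻¹ * v) p = w p := fun p hp => by
    rw [mul_apply, mul_apply, hv p hp, inv_apply_self]
  refine ⟨w * a⁻¹ * v, fun p hp => by rw [key p hp.ge, hw p hp.le], fun p hp => ?_⟩
  rcases hp with hp | hp
  · have hwa : a⁻¹ p = w⁻¹ p := by
      set q := a⁻¹ p with hq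
      have hap : a q = p := apply_inv_self a p
      have hqt : q.2 ≤ t := by
        by_contra! hqt
        have := ha.1.lt_snd (fun p hp => (h p hp).1) q hqt.le
        rw [hap] at this
        linarith
      exact (inv_apply_eq (by rw [hw q hqt, hap])).symm
    rw [mul_apply, mul_apply, hvs p hp, hwa, apply_inv_self]
  · rw [key p (hs'.le.trans hp), hws p hp]

end Annulus

namespace Annulus

open Set Pointwise Filter Topology

theorem PreservesEnds.le_snd_of_fix {d : AnnulusHomeo} (hd : PreservesEnds d) {c : ℝ}
    (h : ∀ p : Circle × ℝ, p.2 = c → d p = p) (p : Circle × ℝ) (hp : c ≤ p.2) : c ≤ (d p).2 :=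
  le_of_forall_lt fun s hs => hd.lt_snd (fun q hq => by rwa [h q hq, hq]) p hp

theorem PreservesEnds.snd_le_of_fix {d : AnnulusHomeo} (hd : PreservesEnds d) {c : ℝ}
    (h : ∀ p : Circle × ℝ, p.2 = c → d p = p) (p : Circle × ℝ) (hp : p.2 ≤ c) : (d p).2 ≤ c :=
  le_of_forall_gt fun s hs => hd.snd_lt (fun q hq => by rwa [h q hq, hq]) p hp

/-- A homeomorphism fixing a circle can be made trivial below this circle. -/
theorem PreservesEnds.exists_upper {d : AnnulusHomeo} (hd : PreservesEnds d) {c : ℝ}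
    (h : ∀ p : Circle × ℝ, p.2 = c → d p = p) :
    ∃ e : AnnulusHomeo, PreservesEnds e ∧ (∀ p, p.2 ≤ c → e p = p) ∧ ∀ p, c ≤ p.2 → e p = d p := by
  obtain ⟨e, he, he'⟩ := exists_glue d c (Φ := id) continuousOn_id (by
    have : d '' {p | p.2 ≤ c} = {p | p.2 ≤ c} := by
      refine Subset.antisymm (image_subset_iff.2 fun p hp => hd.snd_le_of_fix h p hp)
        fun p hp => ⟨d⁻¹ p, hd.inv.snd_le_of_fix (fun q hq => inv_apply_eq (h q hq)) p hp,
          apply_inv_self d p⟩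
    rw [this]
    exact bijOn_id _) (fun p hp => (h p hp).symm) fun K hK => ⟨K, hK, fun p _ hp => hp⟩
  exact ⟨e, hd.of_eq (k := 1) (preservesEnds_of_snd_eq fun _ => rfl) he he', he, he'⟩

theorem preservesEnds_glue (u : ℤ → unitBand) : PreservesEnds (glue u) := by
  have h : ∀ p, |(glue u p).2 - p.2| < 1 := fun p => Int.abs_sub_lt_one_of_floor_eq_floor
    (floor_glue u p)
  refine ⟨fun N => ⟨N - 1, fun p hp => ?_⟩, fun N => ⟨N + 1, fun p hp => ?_⟩⟩ <;>
  · have := abs_lt.1 (h p)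
    linarith [this.1, this.2]

/-- The homeomorphism supported in the band between `i` and `i + 1`, moved to the unit band. -/
noncomputable def toUnitBand (u : AnnulusHomeo) (i : ℝ)
    (hu : ∀ p : Circle × ℝ, p.2 ≤ i ∨ i + 1 ≤ p.2 → u p = p) : unitBand :=
  ⟨shift (-i) * u * shift i, fun p hp => by
    rw [mul_apply, mul_apply, hu _ (by
      rw [shift_apply]
      exact hp.imp (fun h => by simp only; linarith) fun h => by simp only; linarith)]
    simp [shift_apply]⟩

theorem glue_apply_of_eq_toUnitBand {f : ℤ → unitBand} {u : AnnulusHomeo} {p : Circle × ℝ}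
    (hu : ∀ q : Circle × ℝ, q.2 ≤ (⌊p.2⌋ : ℝ) ∨ (⌊p.2⌋ : ℝ) + 1 ≤ q.2 → u q = q)
    (hf : f ⌊p.2⌋ = toUnitBand u ⌊p.2⌋ hu) : glue f p = u p := by
  rw [glue_apply, hf, toUnitBand]
  simp [shift_apply]

/-- A homeomorphism fixing the circles at nonnegative integer heights preserves the bands. -/
theorem exists_eq_glue {d : AnnulusHomeo} (hd : PreservesEnds d)
    (h0 : ∀ p : Circle × ℝ, p.2 ≤ 0 → d p = p)
    (h : ∀ i : ℤ, 0 ≤ i → ∀ p : Circle × ℝ, p.2 = i → d p = p) :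
    ∃ f : ℤ → unitBand, (∀ i < 0, f i = 1) ∧ d = glue f := by
  have key : ∀ i : ℤ, 0 ≤ i → ∃ u : AnnulusHomeo,
      (∀ p : Circle × ℝ, p.2 ≤ i ∨ (i : ℝ) + 1 ≤ p.2 → u p = p) ∧
      ∀ p : Circle × ℝ, i ≤ p.2 → p.2 ≤ i + 1 → u p = d p := fun i hi => by
    have h1 : ∀ p : Circle × ℝ, p.2 = (i : ℝ) + 1 → d p = p := fun p hp =>
      h (i + 1) (by omega) p (by rw [hp]; push_cast; rfl)
    obtain ⟨v, -, hv, hv'⟩ := hd.exists_upper (h i hi)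
    obtain ⟨w, -, hw, hw'⟩ := hd.exists_upper h1
    refine ⟨w⁻¹ * v, fun p hp => ?_, fun p hp hp' => ?_⟩
    · rw [mul_apply]
      rcases hp with hp | hp
      · rw [hv p hp]
        exact inv_apply_eq (hw p (by linarith))
      · rw [hv' p (by linarith)]
        exact inv_apply_eq (hw' p hp)
    · rw [mul_apply, hv' p hp]
      exact inv_apply_eq (hw _ (hd.snd_le_of_fix h1 p hp'))
  choose! u hu hud using key
  refine ⟨fun i => if hi : 0 ≤ i then toUnitBand (u i) i (hu i hi) else 1, fun i hi =>
    dif_neg (not_le.2 hi), Homeomorph.ext fun p => ?_⟩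
  by_cases hi : 0 ≤ ⌊p.2⌋
  · rw [glue_apply_of_eq_toUnitBand (hu _ hi) (dif_pos hi),
      hud _ hi p (Int.floor_le _) (Int.lt_floor_add_one _).le]
  · rw [glue_apply_of_eq_one (dif_neg hi), h0]
    exact (Int.floor_lt.1 (not_le.1 hi)).le.trans_eq Int.cast_zero

end Annulus

namespace Annulus

open Set Pointwise Filter Topology

/-- Scaling by two in the vertical direction. -/
noncomputable def dilate : AnnulusHomeo := vertical (Homeomorph.mulRight₀ (2 : ℝ) two_ne_zero)

theorem dilate_pow_apply (k : ℕ) (p : Circle × ℝ) : (dilate ^ k) p = (p.1, p.2 * 2 ^ k) := by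
  induction k with
  | zero => simp
  | succ k ih =>
    rw [pow_succ', mul_apply, ih, dilate, vertical_apply, Homeomorph.coe_mulRight₀]
    simp [pow_succ, mul_assoc]

theorem preservesEnds_of_support {d : AnnulusHomeo} {N M : ℝ} (hN : ∀ p, p.2 ≤ N → d p = p)
    (hM : ∀ p, M ≤ p.2 → d p = p) : PreservesEnds d :=
  PreservesEnds.of_eq (g := 1) (k := 1) (preservesEnds_of_snd_eq fun _ => rfl)
    (preservesEnds_of_snd_eq fun _ => rfl) hN hM

/-- A homeomorphism with bounded support is conjugate to one supported in the unit band. -/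
theorem exists_eq_conj_glue {d : AnnulusHomeo} {n : ℕ}
    (hd : ∀ p : Circle × ℝ, p.2 ≤ -2 ^ n ∨ 2 ^ n ≤ p.2 → d p = p) :
    ∃ f : ℤ → unitBand, (∀ i < 0, f i = 1) ∧
      d = dilate ^ (n + 1) * shift (-2⁻¹) * glue f * (dilate ^ (n + 1) * shift (-2⁻¹))⁻¹ := by
  set θ := dilate ^ (n + 1) * shift (-2⁻¹) with hθ
  have hθ' : ∀ p : Circle × ℝ, (θ p).2 = 2 ^ n * (2 * p.2 - 1) := fun p => by
    rw [hθ, mul_apply, shift_apply, dilate_pow_apply, pow_succ]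
    ring
  have h0 : ∀ p : Circle × ℝ, p.2 ≤ 0 ∨ 1 ≤ p.2 → (θ⁻¹ * d * θ) p = p := fun p hp => by
    rw [mul_apply, mul_apply, hd, inv_apply_self]
    have : (0 : ℝ) < 2 ^ n := by positivity
    rw [hθ']
    refine hp.imp (fun h => ?_) fun h => ?_ <;> nlinarith
  obtain ⟨f, hf, hfd⟩ := exists_eq_glue (d := θ⁻¹ * d * θ) (preservesEnds_of_support
    (fun p hp => h0 p (Or.inl hp)) fun p hp => h0 p (Or.inr hp)) (fun p hp => h0 p (Or.inl hp))
    fun i hi p hp => h0 p (by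
      rw [hp]
      rcases hi.eq_or_lt with rfl | hi
      · left; simp
      · right; exact_mod_cast hi)
  exact ⟨f, hf, by rw [← hfd]; group⟩

/-- The sequences in normal form: the `n`-th term is trivial low down and moves the circles at
half-integer heights above `n` within the surrounding bands. -/
def normalForm : Set (ℕ → AnnulusHomeo) :=
  {b | ∀ n, b n ∈ lowerTrivial ∧ (∀ p : Circle × ℝ, p.2 ≤ -(n + 1) → b n p = p) ∧
    ∀ i : ℤ, (n : ℤ) ≤ i → ∀ p : Circle × ℝ, p.2 = i + 2⁻¹ → i < (b n p).2 ∧ (b n p).2 < i + 1}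

/-- A homeomorphism in normal form is glued from pieces, a bounded part, and shifted pieces. -/
theorem exists_normalForm_factor {b : AnnulusHomeo} {n : ℕ} (hb : b ∈ lowerTrivial)
    (hlow : ∀ p : Circle × ℝ, p.2 ≤ -(n + 1) → b p = p)
    (hcirc : ∀ i : ℤ, (n : ℤ) ≤ i → ∀ p : Circle × ℝ, p.2 = i + 2⁻¹ →
      i < (b p).2 ∧ (b p).2 < i + 1) :
    ∃ f f' f'' : ℤ → unitBand, (∀ i < 0, f i = 1) ∧ (∀ i < 0, f' i = 1) ∧ (∀ i < 0, f'' i = 1) ∧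
      b = glue f * ((dilate ^ (n + 2) * shift (-2⁻¹) * glue f' *
        (dilate ^ (n + 2) * shift (-2⁻¹))⁻¹) * (shift 2⁻¹ * glue f'' * (shift 2⁻¹)⁻¹)) := by
  have key : ∀ i : ℤ, (n : ℤ) ≤ i → ∃ u : AnnulusHomeo, (∀ p, p.2 = (i : ℝ) + 2⁻¹ → u p = b p) ∧
      ∀ p, p.2 ≤ (i : ℝ) ∨ (i : ℝ) + 1 ≤ p.2 → u p = p := fun i hi =>
    exists_localized hb (by norm_num) (by norm_num) (hcirc i hi)
  choose! u hub hu using key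
  set f : ℤ → unitBand := fun i =>
    if hi : (n : ℤ) ≤ i then toUnitBand (u i) i (hu i hi) else 1 with hf
  have hn : ∀ p : Circle × ℝ, p.2 < n → glue f p = p := fun p hp =>
    glue_apply_of_eq_one (dif_neg (not_le.2 (Int.floor_lt.2 (by exact_mod_cast hp))))
  set d := (glue f)⁻¹ * b with hdef
  have hd : PreservesEnds d := (preservesEnds_glue f).inv.mul hb.1
  have hn0 : (0 : ℝ) ≤ n := n.cast_nonneg
  have hdlow : ∀ p : Circle × ℝ, p.2 ≤ -(n + 1) → d p = p := fun p hp => by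
    rw [hdef, mul_apply, hlow p hp]
    exact inv_apply_eq (hn p (by linarith))
  have hdc : ∀ i : ℤ, (n : ℤ) ≤ i → ∀ p : Circle × ℝ, p.2 = i + 2⁻¹ → d p = p := fun i hi p hp => by
    have hfl : ⌊p.2⌋ = i := by
      rw [hp, Int.floor_eq_iff]
      constructor <;> linarith
    subst hfl
    rw [hdef, mul_apply, ← hub _ hi p hp]
    exact inv_apply_eq (glue_apply_of_eq_toUnitBand (hu _ hi) (dif_pos hi))
  obtain ⟨e, he, heid, hed⟩ := hd.exists_upper (hdc n le_rfl)
  rw [Int.cast_natCast] at heid hed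
  obtain ⟨f'', hf'', hef⟩ := exists_eq_glue (d := (shift 2⁻¹)⁻¹ * e * shift 2⁻¹)
    (((preservesEnds_shift _).inv.mul he).mul (preservesEnds_shift _)) (fun p hp => by
      rw [mul_apply, mul_apply, heid _ (by rw [shift_apply]; simp only; linarith), inv_apply_self])
    fun i hi p hp => by
      rw [mul_apply, mul_apply, inv_apply_eq]
      rcases le_total (n : ℤ) i with h | h
      · have : (n : ℝ) ≤ i := by exact_mod_cast h
        rw [hed _ (by rw [shift_apply]; simp only; linarith),
          hdc i h _ (by rw [shift_apply]; simp only; linarith)]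
      · have : (i : ℝ) ≤ n := by exact_mod_cast h
        rw [heid _ (by rw [shift_apply]; simp only; linarith)]
  have hpow : (n : ℝ) + 1 ≤ 2 ^ (n + 1) := by exact_mod_cast (Nat.lt_two_pow_self (n := n + 1)).le
  obtain ⟨f', hf', hdf⟩ := exists_eq_conj_glue (d := d * e⁻¹) (n := n + 1) fun p hp => by
    rw [mul_apply]
    rcases hp with hp | hp
    · rw [inv_apply_eq (heid p (by linarith)), hdlow p (by linarith)]
    · have : e⁻¹ p = d⁻¹ p := by
        refine inv_apply_eq ?_
        rw [hed, apply_inv_self]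
        refine hd.inv.le_snd_of_fix (fun q hq => inv_apply_eq (hdc n le_rfl q ?_)) p (by linarith)
        rw [hq, Int.cast_natCast]
      rw [this, apply_inv_self]
  refine ⟨f, f', f'', fun i hi => dif_neg (by omega), hf', hf'', ?_⟩
  rw [← hdf, ← hef, hdef]
  simp only [mul_assoc, mul_inv_cancel, mul_inv_cancel_left, inv_mul_cancel, mul_one]

theorem uniformlyDistorted_normalForm : UniformlyDistorted normalForm := by
  have hc := uniformlyDistorted_const (G := AnnulusHomeo)
  have hp := uniformlyDistorted_pow (G := AnnulusHomeo) fun n => n + 2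
  refine (uniformlyDistorted_glue.mul ((((hp.mul hc).mul uniformlyDistorted_glue).mul
    (hp.mul hc).inv).mul ((hc.mul uniformlyDistorted_glue).mul hc.inv))).mono fun b hb => ?_
  choose f f' f'' hf hf' hf'' h using fun n =>
    exists_normalForm_factor (hb n).1 (hb n).2.1 (hb n).2.2
  have hg : ∀ {f : ℕ → ℤ → unitBand}, (∀ n i, i < 0 → f n i = 1) → (fun n => glue (f n)) ∈
      {g : ℕ → AnnulusHomeo | ∃ f : ℕ → ℤ → unitBand, (∀ n i, i < 0 → f n i = 1) ∧
        ∀ n, g n = glue (f n)} := fun {f} hf => ⟨f, hf, fun _ => rfl⟩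
  rw [show b = _ from funext h]
  exact mul_mem_mul (hg hf) (mul_mem_mul (mul_mem_mul (mul_mem_mul (mul_mem_mul
    (mem_range_self dilate) (mem_range_self (shift (-2⁻¹)))) (hg hf'))
    (inv_mem_inv.2 (mul_mem_mul (mem_range_self dilate) (mem_range_self (shift (-2⁻¹))))))
    (mul_mem_mul (mul_mem_mul (mem_range_self (shift 2⁻¹)) (hg hf''))
      (inv_mem_inv.2 (mem_range_self (shift 2⁻¹)))))

end Annulus

namespace Annulus

open Set Pointwise Filter Topology

theorem exists_next_level {a : ℕ → AnnulusHomeo} (ha : ∀ n, PreservesEnds (a n)) (k : ℕ) (z : ℝ) :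
    ∃ z', z + 1 ≤ z' ∧ ∀ n ≤ k, (∀ p : Circle × ℝ, p.2 = z' → z < (a n p).2) ∧
      ∀ p : Circle × ℝ, p.2 = z → (a n p).2 < z' := by
  have key : ∀ n, ∃ M, ∀ z', M ≤ z' → (∀ p : Circle × ℝ, p.2 = z' → z < (a n p).2) ∧
      ∀ p : Circle × ℝ, p.2 = z → (a n p).2 < z' := fun n => by
    obtain ⟨M, hM⟩ := (ha n).2 (z + 1)
    obtain ⟨M', hM'⟩ := (ha n).inv.2 (z + 1)
    refine ⟨max M M', fun z' hz' => ⟨fun p hp => ?_, fun p hp => ?_⟩⟩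
    · have := hM p (((le_max_left _ _).trans hz').trans_eq hp.symm)
      linarith
    · by_contra! h
      have := hM' (a n p) (((le_max_right _ _).trans hz').trans h)
      rw [inv_apply_self] at this
      linarith
  choose M hM using key
  obtain ⟨B, hB⟩ := ((finite_Iic k).image M).bddAbove
  exact ⟨max (z + 1) B, le_max_left _ _, fun n hn => hM n _
    ((hB (mem_image_of_mem M hn)).trans (le_max_right _ _))⟩

theorem exists_upper_levels {a : ℕ → AnnulusHomeo} (ha : ∀ n, PreservesEnds (a n)) :
    ∃ z : ℕ → ℝ, z 0 = 0 ∧ (∀ k, z k + 1 ≤ z (k + 1)) ∧ ∀ k, ∀ n ≤ k,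
      ∀ p : Circle × ℝ, p.2 = z (k + 1) → z k < (a n p).2 ∧ (a n p).2 < z (k + 2) := by
  choose s hs hsn using exists_next_level ha
  let z : ℕ → ℝ := fun k => Nat.rec 0 (fun k z => s k z) k
  have hz : ∀ k, z (k + 1) = s k (z k) := fun k => rfl
  refine ⟨z, rfl, fun k => by rw [hz]; exact hs _ _, fun k n hn p hp => ⟨?_, ?_⟩⟩
  · exact (hsn k (z k) n hn).1 p (hp.trans (hz k))
  · rw [hz (k + 1)]
    exact (hsn (k + 1) (z (k + 1)) n (by omega)).2 p hp

theorem add_one_le_imp_le {y : ℕ → ℝ} (h0 : 0 ≤ y 0) (hy : ∀ k, y k + 1 ≤ y (k + 1)) (k : ℕ) :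
    (k : ℝ) ≤ y k := by
  induction k with
  | zero => simpa
  | succ k ih => push_cast; linarith [hy k]

/-- Levels adapted to a sequence of homeomorphisms which are trivial low down. -/
theorem exists_levels {a : ℕ → AnnulusHomeo} (ha : ∀ n, a n ∈ lowerTrivial) :
    ∃ E : ℝ ≃ₜ ℝ, StrictMono E ∧ (∀ n : ℕ, ∀ p : Circle × ℝ, p.2 ≤ E (-(n + 1)) → a n p = p) ∧
      ∀ n : ℕ, ∀ i : ℤ, (n : ℤ) < i → ∀ p : Circle × ℝ, p.2 = E i →
        E (i - 1) < (a n p).2 ∧ (a n p).2 < E (i + 1) := by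
  obtain ⟨z, hz0, hz, hzc⟩ := exists_upper_levels fun n => (ha n).1
  choose N hN using fun n => (ha n).2
  let y : ℕ → ℝ := fun k => Nat.rec (|N 0| + 1) (fun k y => y + 1 + |N (k + 1)|) k
  have hy : ∀ k, y (k + 1) = y k + 1 + |N (k + 1)| := fun k => rfl
  have hy0 : y 0 = |N 0| + 1 := rfl
  have hy1 : ∀ k, y k + 1 ≤ y (k + 1) := fun k => by rw [hy]; linarith [abs_nonneg (N (k + 1))]
  have hyk := add_one_le_imp_le (by rw [hy0]; positivity) hy1
  have hzk := add_one_le_imp_le hz0.ge hz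
  have hyN : ∀ k, -y k ≤ N k := fun k => by
    rcases k with - | k
    · rw [hy0]; linarith [neg_abs_le (N 0)]
    · rw [hy]; linarith [neg_abs_le (N (k + 1)), hyk k, k.cast_nonneg (α := ℝ)]
  let x : ℤ → ℝ := fun i => Int.rec z (fun k => -y k) i
  have hxz : ∀ k : ℕ, x k = z k := fun k => rfl
  have hxy : ∀ k : ℕ, x (-(k + 1)) = -y k := fun k => by
    rw [← Int.negSucc_eq]
  have hx : StrictMono x := by
    refine strictMono_int_of_lt_succ fun i => ?_
    rcases i with k | k
    · have := hz k
      rw [Int.ofNat_eq_natCast, hxz, show (k : ℤ) + 1 = (k + 1 : ℕ) by push_cast; rfl, hxz]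
      linarith
    · rw [Int.negSucc_eq, hxy]
      rcases k with - | k
      · have : x (-((0 : ℕ) + 1) + 1) = z 0 := hxz 0
        rw [this, hz0, hy0]
        linarith [abs_nonneg (N 0)]
      · rw [show -(((k + 1 : ℕ) : ℤ) + 1) + 1 = -((k : ℤ) + 1) by push_cast; ring, hxy]
        linarith [hy1 k]
  obtain ⟨E, hE⟩ := exists_piecewiseAffine hx
    (fun r => by
      obtain ⟨k, hk⟩ := exists_nat_ge r
      exact ⟨k, hk.trans (hzk k)⟩)
    fun r => by
      obtain ⟨k, hk⟩ := exists_nat_ge (-r)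
      refine ⟨-(k + 1), ?_⟩
      rw [hxy]
      linarith [hyk k]
  have hEi : ∀ i : ℤ, E i = x i := fun i => by rw [hE]; simp
  have hm : StrictMono E := (E.continuous.strictMono_of_inj E.injective).resolve_right fun h => by
    have h1 := h (zero_lt_one' ℝ)
    have e0 := hEi 0
    have e1 := hEi 1
    rw [Int.cast_zero] at e0
    rw [Int.cast_one] at e1
    rw [e0, e1] at h1
    exact absurd (hx (zero_lt_one' ℤ)) h1.not_gt
  refine ⟨E, hm, fun n p hp => hN n p (hp.trans ?_), fun n i hi p hp => ?_⟩
  · have := hEi (-(n + 1))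
    push_cast at this
    rw [this, hxy]
    exact hyN n
  · obtain ⟨k, rfl⟩ : ∃ k : ℕ, i = (k + 1 : ℕ) := ⟨(i - 1).toNat, by omega⟩
    have e0 := hEi k
    have e1 := hEi (k + 1 : ℕ)
    have e2 := hEi (k + 2 : ℕ)
    rw [hxz] at e0 e1 e2
    push_cast at hp hi e0 e1 e2 ⊢
    rw [add_sub_cancel_right, e0, show (k : ℝ) + 1 + 1 = k + 2 by ring, e2]
    exact hzc k n (by omega) p (hp.trans e1)

theorem exists_conj_mem_normalForm {a : ℕ → AnnulusHomeo} (ha : ∀ n, a n ∈ lowerTrivial) :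
    ∃ θ : AnnulusHomeo, (fun n => θ⁻¹ * a n * θ) ∈ normalForm := by
  obtain ⟨E, hE, hlow, hcirc⟩ := exists_levels ha
  set θ := vertical E * dilate with hθ
  have hθ2 : ∀ p : Circle × ℝ, (θ p).2 = E (p.2 * 2) := fun p => rfl
  have hinv : ∀ p : Circle × ℝ, E ((θ⁻¹ p).2 * 2) = p.2 := fun p => by rw [← hθ2, apply_inv_self]
  have hθe : PreservesEnds θ := by
    constructor
    · refine fun N => ⟨E.symm N / 2, fun p hp => ?_⟩
      rw [hθ2, ← E.apply_symm_apply N]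
      exact hE.monotone (by linarith)
    · refine fun N => ⟨E.symm N / 2, fun p hp => ?_⟩
      rw [hθ2, ← E.apply_symm_apply N]
      exact hE.monotone (by linarith)
  have hlow' : ∀ n : ℕ, ∀ p : Circle × ℝ, p.2 ≤ -(n + 1) → (θ⁻¹ * a n * θ) p = p := fun n p hp => by
    rw [mul_apply, mul_apply, hlow n, inv_apply_self]
    rw [hθ2]
    refine hE.monotone ?_
    have : (0 : ℝ) ≤ n := n.cast_nonneg
    linarith
  refine ⟨θ, fun n => ⟨⟨(hθe.inv.mul (ha n).1).mul hθe, _, hlow' n⟩, hlow' n, fun i hi p hp => ?_⟩⟩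
  have h2 := hcirc n (2 * i + 1) (by omega) (θ p) (by
    rw [hθ2, hp]; push_cast; congr 1; ring)
  rw [← hinv (a n (θ p)), hE.lt_iff_lt, hE.lt_iff_lt] at h2
  push_cast at h2
  rw [mul_apply, mul_apply]
  constructor <;> linarith [h2.1, h2.2]

theorem uniformlyDistorted_lowerTrivial :
    UniformlyDistorted {a : ℕ → AnnulusHomeo | ∀ n, a n ∈ lowerTrivial} := by
  have hc := uniformlyDistorted_const (G := AnnulusHomeo)
  refine ((hc.mul uniformlyDistorted_normalForm).mul hc.inv).mono fun a ha => ?_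
  obtain ⟨θ, hθ⟩ := exists_conj_mem_normalForm ha
  have : a = (fun _ => θ) * (fun n => θ⁻¹ * a n * θ) * (fun _ => θ)⁻¹ := by
    funext n
    simp only [Pi.mul_apply, Pi.inv_apply, mul_assoc, mul_inv_cancel, mul_inv_cancel_left, mul_one]
  rw [this]
  exact mul_mem_mul (mul_mem_mul (mem_range_self θ) hθ) (inv_mem_inv.2 (mem_range_self θ))

/-- Up to finitely many homeomorphisms, every homeomorphism is a product of one which is trivial
near the lower end and one which is trivial near the upper end. -/
theorem exists_fragmentation (g : AnnulusHomeo) :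
    ∃ σ ∈ ({1, circleFlip, reflect, reflect * circleFlip} : Set AnnulusHomeo),
      ∃ a ∈ lowerTrivial, ∃ b ∈ lowerTrivial, g = σ * (a * (reflect * b * reflect)) := by
  have key : ∀ g : AnnulusHomeo, PreservesEnds g → ∃ σ ∈ ({1, circleFlip} : Set AnnulusHomeo),
      ∃ a ∈ lowerTrivial, ∃ b ∈ lowerTrivial, g = σ * (a * (reflect * b * reflect)) := by
    intro g hg
    obtain ⟨h, σ, N, hσ, h0, hN⟩ := exists_standard_below hg 0
    have hσσ : σ * σ = 1 := by
      rcases hσ with rfl | rfl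
      · exact one_mul 1
      · exact circleFlip_mul_circleFlip
    have hσe : PreservesEnds σ := preservesEnds_of_snd_eq fun p => by
      rcases hσ with rfl | rfl <;> rfl
    have hh : PreservesEnds h := hg.of_eq hσe hN h0
    have hk : PreservesEnds (h⁻¹ * g) := hh.inv.mul hg
    refine ⟨σ, hσ, σ * h, ⟨hσe.mul hh, N, fun p hp => ?_⟩, reflect * (h⁻¹ * g) * reflect,
      ⟨preservesEnds_reflect_conj hk, 0, fun p hp => ?_⟩, ?_⟩
    · rw [mul_apply, hN p hp, ← mul_apply, hσσ, one_apply]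
    · have hp' : 0 ≤ (reflect p).2 := by rw [reflect_apply]; exact neg_nonneg.2 hp
      rw [reflect_conj_apply, mul_apply, ← h0 _ hp', inv_apply_self, reflect_reflect]
    · calc g = (σ * σ) * (h * ((reflect * reflect) * (h⁻¹ * g) * (reflect * reflect))) := by
            rw [hσσ, reflect_mul_reflect]; group
        _ = _ := by simp only [mul_assoc]
  rcases preservesEnds_or g with hg | hg
  · obtain ⟨σ, hσ, a, ha, b, hb, h⟩ := key g hg
    exact ⟨σ, by rcases hσ with rfl | rfl <;> simp, a, ha, b, hb, h⟩
  · obtain ⟨σ, hσ, a, ha, b, hb, h⟩ := key _ hg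
    refine ⟨reflect * σ, by rcases hσ with rfl | rfl <;> simp, a, ha, b, hb, ?_⟩
    rw [mul_assoc, ← h, ← mul_assoc, reflect_mul_reflect, one_mul]

theorem uniformlyDistorted_univ : UniformlyDistorted (univ : Set (ℕ → AnnulusHomeo)) := by
  have hc := uniformlyDistorted_const (G := AnnulusHomeo)
  have hl := uniformlyDistorted_lowerTrivial
  refine ((uniformlyDistorted_of_finite (toFinite
    ({1, circleFlip, reflect, reflect * circleFlip} : Set AnnulusHomeo))).mul
      (hl.mul ((hc.mul hl).mul hc))).mono fun g _ => ?_
  choose σ hσ a ha b hb h using fun n => exists_fragmentation (g n)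
  rw [show g = _ from funext h]
  exact mul_mem_mul (s := {g : ℕ → AnnulusHomeo | ∀ n, g n ∈ _}) hσ (mul_mem_mul
    (s := {a : ℕ → AnnulusHomeo | ∀ n, a n ∈ lowerTrivial}) ha (mul_mem_mul (mul_mem_mul
      (mem_range_self reflect) (show b ∈ {a : ℕ → AnnulusHomeo | ∀ n, a n ∈ lowerTrivial} from hb))
      (mem_range_self reflect)))

instance : Infinite AnnulusHomeo :=
  Infinite.of_injective shift fun s t h => by
    have := congrArg (fun g : AnnulusHomeo => (g (1, 0)).2) h
    simpa [shift_apply] using this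

end Annulus

/-- The homeomorphism group of the open annulus `S¹ × ℝ` is strongly distorted. -/
theorem stronglyDistorted_homeo_annulus :
    StronglyDistorted ((Circle × ℝ) ≃ₜ (Circle × ℝ)) := by
  exact Annulus.uniformlyDistorted_univ.stronglyDistorted
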